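/- Let K be an algebraic field extension of ℚ (a subfield of ℂ consisting of numbers algebraic over ℚ) which is not totally real, i.e., K contains an element having a non-real conjugate over ℚ. Then for every α ∈ O_K such that σ(α) ≥ 0 for all field embeddings σ : K → ℝ, there exist w, x, y, z ∈ O_K with α = w² + wx + x² + y² + z². Moreover, for all w, x, y, z ∈ O_K and all embeddings σ : K → ℝ one has σ(w² + wx + x² + y² + z²) ≥ 0; that is, the quadratic form W² + WX + X² + Y² + Z² is universal over K. -/

import Mathlib

open Polynomial

set_option synthInstance.maxHeartbeats 400000
set_option maxHeartbeats 400000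

noncomputable section

section Epstein
open MeasureTheory Set ENNReal Module

theorem add_pow_succ_le {r D : ℝ} (hr : 1 ≤ r) (hD : 0 ≤ D) (k : ℕ) :
    (r + D) ^ (k + 1) ≤ r ^ (k + 1) + ((1 + D) ^ (k + 1) - 1) * r ^ k := by
  induction k with
  | zero => simp
  | succ k ih =>
    have h1 : (0:ℝ) ≤ (1 + D) ^ (k + 1) - 1 := by
      have := one_le_pow₀ (a := 1 + D) (n := k + 1) (by linarith); linarith
    have h2 : r ^ k ≤ r ^ (k + 1) := pow_le_pow_right₀ hr (by omega)
    calc (r + D) ^ (k + 1 + 1) = (r + D) ^ (k + 1) * (r + D) := pow_succ _ _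
      _ ≤ (r ^ (k + 1) + ((1 + D) ^ (k + 1) - 1) * r ^ k) * (r + D) := by gcongr
      _ = r ^ (k + 2) + (((1 + D) ^ (k + 1) - 1) + D) * r ^ (k + 1)
          + (((1 + D) ^ (k + 1) - 1) * D) * r ^ k := by ring
      _ ≤ r ^ (k + 2) + (((1 + D) ^ (k + 1) - 1) + D) * r ^ (k + 1)
          + (((1 + D) ^ (k + 1) - 1) * D) * r ^ (k + 1) := by gcongr
      _ = _ := by ring

theorem pow_succ_le_sub_pow {r D : ℝ} (hr : 0 < r) (hD : 0 ≤ D) (k : ℕ) :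
    r ^ (k + 1) ≤ (max (r - D) 0) ^ (k + 1) + (k + 1) * D * r ^ k := by
  rcases le_total D r with h | h
  · rw [max_eq_left (by linarith)]
    have := one_add_mul_le_pow (a := - D / r) (by rw [le_div_iff₀ hr]; linarith) (k + 1)
    have h2 : r - D = r * (1 + -D / r) := by field_simp; ring
    rw [h2, mul_pow]
    have h3 := mul_le_mul_of_nonneg_left this (pow_pos hr (k + 1)).le
    have h4 : r ^ (k + 1) * (1 + ((k + 1 : ℕ) : ℝ) * (-D / r))
        = r ^ (k + 1) - (k + 1) * D * r ^ k := by
      push_cast; field_simp; ring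
    linarith
  · have h1 : (0:ℝ) ≤ (max (r - D) 0) ^ (k + 1) := by positivity
    have h2 : r ^ (k + 1) ≤ D * r ^ k := by rw [pow_succ']; gcongr
    have h3 : D * r ^ k ≤ (k + 1) * D * r ^ k := by
      have : (0:ℝ) ≤ k * (D * r ^ k) := by positivity
      nlinarith
    linarith

theorem lintegral_Ioi_rpow {a c : ℝ} (ha : 0 < a) (hc : 0 < c) :
    ∫⁻ r in Ioi c, ENNReal.ofReal (a * r ^ (-a - 1)) = ENNReal.ofReal (c ^ (-a)) := by
  rw [← ofReal_integral_eq_lintegral_ofReal]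
  · congr 1
    rw [integral_const_mul, integral_Ioi_rpow_of_lt (by linarith) hc]
    have : -a - 1 + 1 = -a := by ring
    rw [this]; field_simp
  · exact (integrableOn_Ioi_rpow_of_lt (by linarith) hc).const_mul a
  · refine (ae_restrict_mem measurableSet_Ioi).mono fun r hr => ?_
    have : 0 < r := hc.trans hr
    positivity

variable {E : Type*} [NormedAddCommGroup E] [NormedSpace ℝ E] [MeasurableSpace E] [BorelSpace E]
  [FiniteDimensional ℝ E] (μ : Measure E) [μ.IsAddHaarMeasure] {ι : Type*} [Finite ι]
  (b : Basis ι ℝ E)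

theorem lattice_count_le (M : E → ℝ) {D : ℝ} (hM : Measurable M)
    (hadd : ∀ x y, M (x + y) ≤ M x + M y)
    (hD : ∀ x ∈ ZSpan.fundamentalDomain b, M x ≤ D) (r : ℝ) :
    μ (ZSpan.fundamentalDomain b) * ∑' x : Submodule.span ℤ (Set.range b),
      (Set.indicator {x : E | M x < r} 1 (x : E) : ℝ≥0∞) ≤ μ {x | M x < r + D} := by
  have hF := ZSpan.isAddFundamentalDomain b μ
  have : VAddInvariantMeasure (Submodule.span ℤ (range b)) E μ :=
    inferInstanceAs (VAddInvariantMeasure (Submodule.span ℤ (range b)).toAddSubgroup E μ)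
  have : Countable (Submodule.span ℤ (Set.range b)) := by infer_instance
  have hmeas : MeasurableSet {x | M x < r + D} := hM measurableSet_Iio
  rw [← lintegral_indicator_one hmeas, hF.lintegral_eq_tsum, ← ENNReal.tsum_mul_left]
  refine ENNReal.tsum_le_tsum fun g => ?_
  by_cases hg : M (g : E) < r
  · rw [Set.indicator_of_mem (by exact hg), Pi.one_apply, mul_one]
    rw [setLIntegral_congr_fun (g := fun _ => 1)
      (((ZSpan.fundamentalDomain_measurableSet b).const_vadd g))]
    · rw [setLIntegral_one]
      exact (measure_vadd μ g _).ge
    · rintro _ ⟨x, hx, rfl⟩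
      refine Set.indicator_of_mem ?_ _
      have := hadd (g : E) x
      have h2 := hD x hx
      show M ((g : E) + x) < r + D
      linarith
  · rw [Set.indicator_of_notMem (by exact hg)]; simp

theorem le_lattice_count (M : E → ℝ) {D : ℝ} (hM : Measurable M)
    (hadd : ∀ x y, M (x + y) ≤ M x + M y) (hneg : ∀ x, M (-x) = M x)
    (hD : ∀ x ∈ ZSpan.fundamentalDomain b, M x ≤ D) (r : ℝ) :
    μ {x | M x < r - D} ≤ μ (ZSpan.fundamentalDomain b) *
      ∑' x : Submodule.span ℤ (Set.range b),
      (Set.indicator {x : E | M x < r} 1 (x : E) : ℝ≥0∞) := by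
  have hF := ZSpan.isAddFundamentalDomain b μ
  have : VAddInvariantMeasure (Submodule.span ℤ (range b)) E μ :=
    inferInstanceAs (VAddInvariantMeasure (Submodule.span ℤ (range b)).toAddSubgroup E μ)
  have hmeas : MeasurableSet {x | M x < r - D} := hM measurableSet_Iio
  rw [← lintegral_indicator_one hmeas, hF.lintegral_eq_tsum, ← ENNReal.tsum_mul_left]
  refine ENNReal.tsum_le_tsum fun g => ?_
  by_cases hg : M (g : E) < r
  · rw [Set.indicator_of_mem (by exact hg), Pi.one_apply, mul_one]
    refine (lintegral_mono (g := fun _ => 1) fun x => ?_).trans ?_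
    · exact Set.indicator_le_self' (fun _ _ => zero_le) x
    · rw [setLIntegral_one]
      exact (measure_vadd μ g _).le
  · rw [Set.indicator_of_notMem (by exact hg), mul_zero, nonpos_iff_eq_zero]
    rw [setLIntegral_congr_fun (g := fun _ => 0)
      (((ZSpan.fundamentalDomain_measurableSet b).const_vadd g))]
    · simp
    · rintro _ ⟨x, hx, rfl⟩
      refine Set.indicator_of_notMem (fun h => hg ?_) _
      have h : M ((g : E) + x) < r - D := h
      have h1 := hadd ((g : E) + x) (-x)
      rw [add_neg_cancel_right, hneg] at h1
      have h2 := hD x hx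
      linarith

open scoped Classical in
theorem epstein_bound (M : E → ℝ) {D κ : ℝ} {k : ℕ} {s : ℝ} (hM : Measurable M)
    (hadd : ∀ x y, M (x + y) ≤ M x + M y) (hneg : ∀ x, M (-x) = M x)
    (hD : ∀ x ∈ ZSpan.fundamentalDomain b, M x ≤ D) (hD0 : 0 ≤ D) (hκ : 0 ≤ κ)
    (hvol : ∀ r : ℝ, 0 ≤ r → μ {x | M x < r} = ENNReal.ofReal (κ * r ^ (k + 1)))
    (h0 : M 0 = 0)
    (hone : ∀ x ∈ Submodule.span ℤ (Set.range b), x ≠ 0 → 1 ≤ M x)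
    (hs : 1 < s) (hs2 : s ≤ 2) {B : ℝ}
    (hB : B = κ * (1 + D) ^ (k + 1) + κ * ((k + 1) * D) +
      (μ (ZSpan.fundamentalDomain b)).toReal) :
    μ (ZSpan.fundamentalDomain b) * ∑' x : Submodule.span ℤ (Set.range b),
      (if (x : E) = 0 then 0 else ENNReal.ofReal (M x ^ (-((k + 1) * s)))) ≤
      ENNReal.ofReal (κ * (s / (s - 1))) + ENNReal.ofReal (B * (2 * (k + 1))) ∧
    ENNReal.ofReal (κ * (s / (s - 1))) ≤
      μ (ZSpan.fundamentalDomain b) * ∑' x : Submodule.span ℤ (Set.range b),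
      (if (x : E) = 0 then 0 else ENNReal.ofReal (M x ^ (-((k + 1) * s)))) +
      ENNReal.ofReal (B * (2 * (k + 1))) := by
  have : Countable (Submodule.span ℤ (Set.range b)) := by infer_instance
  set v := μ (ZSpan.fundamentalDomain b) with hv
  have hvtop : v ≠ ∞ := (ZSpan.fundamentalDomain_isBounded b).measure_lt_top.ne
  set a : ℝ := (k + 1) * s with ha
  have hk : (0 : ℝ) < k + 1 := by positivity
  have ha0 : 0 < a := by positivity
  have hB0 : 0 ≤ B := by rw [hB]; positivity
  -- the counting function of nonzero lattice points
  set n : ℝ → ℝ≥0∞ := fun r => ∑' x : Submodule.span ℤ (Set.range b),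
      (if (x : E) = 0 then 0 else Set.indicator {x : E | M x < r} 1 (x : E) : ℝ≥0∞) with hn
  have hnfull : ∀ r : ℝ, 0 < r → ∑' x : Submodule.span ℤ (Set.range b),
      (Set.indicator {x : E | M x < r} 1 (x : E) : ℝ≥0∞) = n r + 1 := by
    intro r hr
    have h1 : (1 : ℝ≥0∞) = ∑' x : Submodule.span ℤ (Set.range b), if x = 0 then 1 else 0 := by
      rw [tsum_ite_eq]
    rw [h1, hn, ← ENNReal.tsum_add]
    refine tsum_congr fun x => ?_
    by_cases hx : x = 0
    · subst hx; simp [h0, hr]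
    · have : (x : E) ≠ 0 := by simpa using hx
      simp [hx]
  have hsum : ∑' x : Submodule.span ℤ (Set.range b),
      (if (x : E) = 0 then 0 else ENNReal.ofReal (M x ^ (-a))) =
      ∫⁻ r in Ioi (1:ℝ), n r * ENNReal.ofReal (a * r ^ (-a - 1)) := by
    have h1 : ∀ r, n r * ENNReal.ofReal (a * r ^ (-a - 1)) =
      ∑' x : Submodule.span ℤ (Set.range b), (if (x : E) = 0 then 0 else
        Set.indicator (Ioi (M x)) (fun r => ENNReal.ofReal (a * r ^ (-a - 1))) r) := by
      intro r
      rw [hn, ← ENNReal.tsum_mul_right]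
      refine tsum_congr fun x => ?_
      split_ifs with hx
      · simp
      · by_cases hr : M x < r
        · rw [Set.indicator_of_mem (by exact hr), Set.indicator_of_mem (by exact hr)]; simp
        · rw [Set.indicator_of_notMem (by exact hr), Set.indicator_of_notMem (by exact hr)]; simp
    simp_rw [h1]
    rw [lintegral_tsum]
    · refine tsum_congr fun x => ?_
      split_ifs with hx
      · simp
      · have hx1 := hone x x.2 hx
        rw [lintegral_indicator measurableSet_Ioi, Measure.restrict_restrict measurableSet_Ioi,
          Set.inter_eq_left.2 (Ioi_subset_Ioi hx1), lintegral_Ioi_rpow ha0 (by linarith)]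
    · intro x
      split_ifs with hx
      · exact aemeasurable_const
      · refine AEMeasurable.indicator ?_ measurableSet_Ioi
        exact (by fun_prop : Measurable _).aemeasurable
  have hupper : ∀ r : ℝ, 1 ≤ r → v * n r ≤ ENNReal.ofReal (κ * r ^ (k + 1) + B * r ^ k) := by
    intro r hr
    calc v * n r ≤ v * (n r + 1) := by gcongr; exact le_self_add
      _ ≤ μ {x | M x < r + D} := by
        rw [← hnfull r (by linarith)]; exact lattice_count_le μ b M hM hadd hD r
      _ = ENNReal.ofReal (κ * (r + D) ^ (k + 1)) := hvol _ (by linarith)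
      _ ≤ _ := by
        apply ENNReal.ofReal_le_ofReal
        have h1 := mul_le_mul_of_nonneg_left (add_pow_succ_le hr hD0 k) hκ
        have h2 : κ * ((1 + D) ^ (k + 1) - 1) ≤ B := by
          have : 0 ≤ κ * ((k + 1) * D) := by positivity
          have : 0 ≤ v.toReal := ENNReal.toReal_nonneg
          rw [hB]; linarith
        have h3 := mul_le_mul_of_nonneg_right h2 (show (0:ℝ) ≤ r ^ k by positivity)
        linarith
  have hlower : ∀ r : ℝ, 1 ≤ r → ENNReal.ofReal (κ * r ^ (k + 1)) ≤
      v * n r + ENNReal.ofReal (B * r ^ k) := by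
    intro r hr
    have hr0 : 0 < r := by linarith
    have h1 : μ {x | M x < r - D} = ENNReal.ofReal (κ * (max (r - D) 0) ^ (k + 1)) := by
      rcases le_total D r with h | h
      · rw [max_eq_left (by linarith), hvol _ (by linarith)]
      · rw [max_eq_right (by linarith), ← hvol _ le_rfl]
        have h3 : ∀ r ≤ (0:ℝ), μ {x | M x < r} = 0 := by
          intro r hr
          have := hvol 0 le_rfl
          simp only [ne_eq, Nat.succ_ne_zero, not_false_eq_true, zero_pow, mul_zero,
            ENNReal.ofReal_zero] at this
          exact measure_mono_null (fun x hx => lt_of_lt_of_le hx hr) this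
        rw [h3 _ (by linarith), h3 _ le_rfl]
    have h2 := le_lattice_count μ b M hM hadd hneg hD r
    rw [hnfull r hr0, h1, mul_add, mul_one] at h2
    calc ENNReal.ofReal (κ * r ^ (k + 1))
        ≤ ENNReal.ofReal (κ * (max (r - D) 0) ^ (k + 1) + κ * ((k + 1) * D) * r ^ k) := by
          apply ENNReal.ofReal_le_ofReal
          have := mul_le_mul_of_nonneg_left (pow_succ_le_sub_pow hr0 hD0 k) hκ
          linarith
      _ = ENNReal.ofReal (κ * (max (r - D) 0) ^ (k + 1)) +
          ENNReal.ofReal (κ * ((k + 1) * D) * r ^ k) :=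
          ENNReal.ofReal_add (by positivity) (by positivity)
      _ ≤ v * n r + v + ENNReal.ofReal (κ * ((k + 1) * D) * r ^ k) := by gcongr
      _ ≤ v * n r + ENNReal.ofReal (B * r ^ k) := by
          rw [add_assoc]
          gcongr
          rw [← ENNReal.ofReal_toReal hvtop, ← ENNReal.ofReal_add (by positivity) (by positivity)]
          apply ENNReal.ofReal_le_ofReal
          have h5 : 1 ≤ r ^ k := one_le_pow₀ hr
          have h6 : v.toReal ≤ v.toReal * r ^ k := le_mul_of_one_le_right (by positivity) h5
          have h7 : 0 ≤ κ * (1 + D) ^ (k + 1) * r ^ k := by positivity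
          rw [hB]
          linarith
  -- comparison integrals
  have hmain : ∫⁻ r in Ioi (1:ℝ), ENNReal.ofReal (κ * r ^ (k + 1)) *
      ENNReal.ofReal (a * r ^ (-a - 1)) = ENNReal.ofReal (κ * (s / (s - 1))) := by
    have h1 := lintegral_Ioi_rpow (a := a - (k + 1)) (c := 1) (by rw [ha]; nlinarith) one_pos
    rw [Real.one_rpow] at h1
    have h2 : κ * (s / (s - 1)) = (κ * (s / (s - 1))) * 1 := by ring
    rw [h2, ENNReal.ofReal_mul (by have : 0 < s - 1 := by linarith
                                   positivity), ← h1, ← lintegral_const_mul _ (by fun_prop)]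
    refine setLIntegral_congr_fun measurableSet_Ioi fun r hr => ?_
    have hr0 : (0:ℝ) < r := one_pos.trans hr
    have hs1 : 0 < s - 1 := by linarith
    rw [← ENNReal.ofReal_mul (by positivity), ← ENNReal.ofReal_mul (by positivity)]
    congr 1
    have : r ^ (-(a - (k + 1)) - 1) = r ^ (k + 1) * r ^ (-a - 1) := by
      rw [← Real.rpow_natCast, ← Real.rpow_add hr0]
      congr 1; push_cast; ring
    rw [this, ha]
    have : ((k:ℝ) + 1) * s - (k + 1) = (k + 1) * (s - 1) := by ring
    rw [this]; field_simp
  have herr : ∫⁻ r in Ioi (1:ℝ), ENNReal.ofReal (B * r ^ k) *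
      ENNReal.ofReal (a * r ^ (-a - 1)) ≤ ENNReal.ofReal (B * (2 * (k + 1))) := by
    have h1 := lintegral_Ioi_rpow (a := 1) (c := 1) one_pos one_pos
    rw [Real.one_rpow] at h1
    rw [show B * (2 * (k + 1)) = (B * (2 * (k + 1))) * 1 by ring, ENNReal.ofReal_mul
      (by positivity), ← h1, ← lintegral_const_mul _ (by fun_prop)]
    refine setLIntegral_mono (by fun_prop) fun r hr => ?_
    have hr0 : (0:ℝ) < r := one_pos.trans hr
    rw [← ENNReal.ofReal_mul (by positivity), ← ENNReal.ofReal_mul (by positivity)]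
    apply ENNReal.ofReal_le_ofReal
    have h3 : r ^ k * r ^ (-a - 1) ≤ r ^ (-1 - 1 : ℝ) := by
      rw [← Real.rpow_natCast, ← Real.rpow_add hr0]
      apply Real.rpow_le_rpow_of_exponent_le hr.le
      rw [ha]; nlinarith
    have h4 : a ≤ 2 * (k + 1) := by rw [ha]; nlinarith
    calc B * r ^ k * (a * r ^ (-a - 1)) = B * a * (r ^ k * r ^ (-a - 1)) := by ring
      _ ≤ B * (2 * (k + 1)) * r ^ (-1 - 1 : ℝ) := by gcongr
      _ = _ := by ring
  have hmeasn : Measurable n := by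
    refine Measurable.tsum fun x => ?_
    split_ifs with hx
    · exact measurable_const
    · have : (fun r : ℝ => Set.indicator {x : E | M x < r} (1 : E → ℝ≥0∞) (x : E)) =
        Set.indicator (Ioi (M x)) 1 := by
        ext r; simp [Set.indicator]
      rw [this]
      exact measurable_one.indicator measurableSet_Ioi
  have hvs : v * ∫⁻ r in Ioi (1:ℝ), n r * ENNReal.ofReal (a * r ^ (-a - 1)) =
      ∫⁻ r in Ioi (1:ℝ), v * n r * ENNReal.ofReal (a * r ^ (-a - 1)) := by
    rw [← lintegral_const_mul _ (by fun_prop)]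
    simp_rw [mul_assoc]
  rw [hsum, hvs]
  constructor
  · refine le_trans ?_ (add_le_add hmain.le herr)
    rw [← lintegral_add_left (by fun_prop)]
    refine setLIntegral_mono (by fun_prop) fun r hr => ?_
    have hr0 : (0:ℝ) < r := one_pos.trans hr
    rw [← add_mul, ← ENNReal.ofReal_add (by positivity) (by positivity)]
    gcongr
    exact hupper r hr.le
  · rw [← hmain]
    refine le_trans ?_ (add_le_add le_rfl herr)
    rw [← lintegral_add_left (by fun_prop)]
    refine setLIntegral_mono (by fun_prop) fun r hr => ?_
    rw [← add_mul]
    gcongr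
    exact hlower r hr.le

end Epstein

section LogSpace
open NumberField NumberField.mixedEmbedding NumberField.Units NumberField.Units.dirichletUnitTheorem
open MeasureTheory Set ENNReal Module Finset

open scoped Classical

variable {K : Type*} [Field K] [NumberField K]

/-- The coordinates at all infinite places of a point of the logarithmic space, normalised by the
multiplicities, the missing one being determined by the vanishing of the trace. -/
def logCoord (y : logSpace K) (w : InfinitePlace K) : ℝ :=
  if h : w ≠ w₀ then y ⟨w, h⟩ / w.mult else -(∑ v, y v) / w.mult

theorem mult_pos_real (w : InfinitePlace K) : (0 : ℝ) < w.mult := by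
  exact_mod_cast InfinitePlace.mult_pos

theorem logCoord_sub (y z : logSpace K) (w : InfinitePlace K) :
    logCoord (y - z) w = logCoord y w - logCoord z w := by
  unfold logCoord
  split_ifs with h
  · simp [sub_div]
  · simp only [Pi.sub_apply, Finset.sum_sub_distrib]; ring

theorem continuous_logCoord (w : InfinitePlace K) :
    Continuous fun y : logSpace K => logCoord y w := by
  unfold logCoord
  split_ifs with h <;> fun_prop

theorem sum_mult_logCoord (y : logSpace K) :
    ∑ w : InfinitePlace K, (w.mult : ℝ) * logCoord y w = 0 := by
  rw [Fintype.sum_eq_add_sum_subtype_ne _ (w₀ : InfinitePlace K)]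
  have h1 : ∀ w : {w : InfinitePlace K // w ≠ w₀}, (w.1.mult : ℝ) * logCoord y w.1 = y w := by
    intro w
    have := mult_pos_real w.1
    unfold logCoord
    rw [dif_pos w.2]; field_simp
  simp_rw [h1]
  unfold logCoord
  have := mult_pos_real (w₀ : InfinitePlace K)
  rw [dif_neg (by simp)]
  field_simp
  ring

theorem normAtPlace_eq_logCoord {x : mixedSpace K} (hx : mixedEmbedding.norm x ≠ 0)
    (w : InfinitePlace K) :
    normAtPlace w x = mixedEmbedding.norm x ^ ((finrank ℚ K : ℝ)⁻¹) *
      Real.exp (logCoord (logMap x) w) := by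
  have hpos : ∀ w, 0 < normAtPlace w x := fun w => by
    refine lt_of_le_of_ne (normAtPlace_nonneg w x) (Ne.symm fun h => hx ?_)
    rw [mixedEmbedding.norm_apply]
    exact Finset.prod_eq_zero (Finset.mem_univ w) (by rw [h, zero_pow InfinitePlace.mult_ne_zero])
  have hN : 0 < mixedEmbedding.norm x := lt_of_le_of_ne (mixedEmbedding.norm_nonneg x) hx.symm
  have hd : (0:ℝ) < finrank ℚ K := by exact_mod_cast finrank_pos
  have hne : ∀ w : InfinitePlace K, w ≠ w₀ →
      logCoord (logMap x) w = Real.log (normAtPlace w x) -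
        Real.log (mixedEmbedding.norm x) * (finrank ℚ K : ℝ)⁻¹ := by
    intro w h
    have := mult_pos_real w
    unfold logCoord
    rw [dif_pos h, logMap_apply]
    field_simp
  have hall : logCoord (logMap x) w = Real.log (normAtPlace w x) -
        Real.log (mixedEmbedding.norm x) * (finrank ℚ K : ℝ)⁻¹ := by
    by_cases h : w ≠ w₀
    · exact hne w h
    · push Not at h
      subst h
      have h1 := sum_mult_logCoord (logMap x)
      have h2 : ∑ w : InfinitePlace K, (w.mult : ℝ) * (Real.log (normAtPlace w x) -
        Real.log (mixedEmbedding.norm x) * (finrank ℚ K : ℝ)⁻¹) = 0 := by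
        simp_rw [mul_sub]
        rw [Finset.sum_sub_distrib, ← Finset.sum_mul]
        have h3 : (∑ w : InfinitePlace K, (w.mult : ℝ)) = finrank ℚ K := by
          exact_mod_cast InfinitePlace.sum_mult_eq (K := K)
        have h4 : Real.log (mixedEmbedding.norm x) =
            ∑ w : InfinitePlace K, (w.mult : ℝ) * Real.log (normAtPlace w x) := by
          rw [mixedEmbedding.norm_apply, Real.log_prod]
          · simp
          · intro w _; exact pow_ne_zero _ (hpos w).ne'
        rw [h3, ← h4]
        field_simp; ring
      rw [← h1] at h2
      rw [Fintype.sum_eq_add_sum_subtype_ne _ (w₀ : InfinitePlace K),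
        Fintype.sum_eq_add_sum_subtype_ne _ (w₀ : InfinitePlace K)] at h2
      have h5 : ∀ w : {w : InfinitePlace K // w ≠ w₀}, logCoord (logMap x) w.1 = _ :=
        fun w => hne w.1 w.2
      simp_rw [h5] at h2
      have := mult_pos_real (w₀ : InfinitePlace K)
      have h6 := add_right_cancel h2
      exact (mul_left_cancel₀ this.ne' h6).symm
  rw [hall, Real.exp_sub, Real.exp_log (hpos w), Real.rpow_def_of_pos hN]
  field_simp

/-- The gauge on the logarithmic space which governs the twisted norms. -/
def logGauge (y : logSpace K) : ℝ :=
  univ.sup' univ_nonempty fun w : InfinitePlace K => Real.exp (-logCoord y w)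

theorem one_le_logGauge (y : logSpace K) : 1 ≤ logGauge y := by
  by_contra! h
  unfold logGauge at h
  rw [Finset.sup'_lt_iff] at h
  have h1 : 0 < ∑ w : InfinitePlace K, (w.mult : ℝ) * logCoord y w := by
    refine Finset.sum_pos (fun w hw => mul_pos (mult_pos_real w) ?_) univ_nonempty
    have := h w hw
    rw [Real.exp_lt_one_iff] at this
    linarith
  rw [sum_mult_logCoord] at h1
  exact lt_irrefl _ h1

theorem continuous_logGauge : Continuous (logGauge : logSpace K → ℝ) := by
  unfold logGauge
  refine Continuous.finset_sup'_apply _ fun w _ => ?_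
  have := continuous_logCoord w
  fun_prop

/-- The maximum norm on the mixed space twisted by a point of the logarithmic space. -/
def twistNorm (y : logSpace K) (x : mixedSpace K) : ℝ :=
  univ.sup' univ_nonempty fun w : InfinitePlace K => normAtPlace w x * Real.exp (-logCoord y w)

theorem twistNorm_eq (y : logSpace K) {x : mixedSpace K} (hx : mixedEmbedding.norm x ≠ 0) :
    twistNorm y x = mixedEmbedding.norm x ^ ((finrank ℚ K : ℝ)⁻¹) * logGauge (y - logMap x) := by
  unfold twistNorm logGauge
  have hN : 0 ≤ mixedEmbedding.norm x ^ ((finrank ℚ K : ℝ)⁻¹) :=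
    Real.rpow_nonneg (mixedEmbedding.norm_nonneg x) _
  rw [Finset.mul₀_sup' hN]
  congr 1
  ext w
  rw [normAtPlace_eq_logCoord hx, logCoord_sub, mul_assoc, ← Real.exp_add]
  congr 2; ring

theorem twistNorm_add_le (y : logSpace K) (x x' : mixedSpace K) :
    twistNorm y (x + x') ≤ twistNorm y x + twistNorm y x' := by
  unfold twistNorm
  refine Finset.sup'_le _ _ fun w hw => ?_
  have h1 := Finset.le_sup' (fun w : InfinitePlace K => normAtPlace w x * Real.exp (-logCoord y w)) hw
  have h2 := Finset.le_sup' (fun w : InfinitePlace K => normAtPlace w x' * Real.exp (-logCoord y w)) hw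
  have h3 := mul_le_mul_of_nonneg_right (normAtPlace_add_le w x x')
    (Real.exp_pos (-logCoord y w)).le
  linarith

theorem twistNorm_neg (y : logSpace K) (x : mixedSpace K) : twistNorm y (-x) = twistNorm y x := by
  unfold twistNorm; simp_rw [normAtPlace_neg]

theorem twistNorm_zero (y : logSpace K) : twistNorm y 0 = 0 := by
  unfold twistNorm; simp

theorem measurable_twistNorm (y : logSpace K) : Measurable (twistNorm y) := by
  have : Continuous (twistNorm y) := by
    unfold twistNorm
    refine Continuous.finset_sup'_apply _ fun w _ => ?_
    have := continuous_normAtPlace w (K := K)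
    fun_prop
  exact this.measurable

theorem twistNorm_le_norm_mul (y : logSpace K) (x : mixedSpace K) :
    twistNorm y x ≤ ‖x‖ * logGauge y := by
  unfold twistNorm
  refine Finset.sup'_le _ _ fun w hw => ?_
  have h2 := Finset.le_sup' (fun w : InfinitePlace K => Real.exp (-logCoord y w)) hw
  have h1 : normAtPlace w x ≤ ‖x‖ := by
    rw [norm_eq_sup'_normAtPlace]
    exact Finset.le_sup' (fun w : InfinitePlace K => normAtPlace w x) hw
  exact mul_le_mul h1 h2 (Real.exp_pos _).le (norm_nonneg _)

theorem volume_twistNorm_lt (y : logSpace K) {r : ℝ} (hr : 0 ≤ r) :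
    volume {x | twistNorm y x < r} =
      ENNReal.ofReal ((convexBodyLTFactor K : ℝ) * r ^ (finrank ℚ K)) := by
  have h1 : {x | twistNorm y x < r} = convexBodyLT K
      (fun w => Real.toNNReal r * Real.toNNReal (Real.exp (logCoord y w))) := by
    ext x
    have h2 : ∀ w : InfinitePlace K, normAtPlace w x * Real.exp (-logCoord y w) < r ↔
        normAtPlace w x < r * Real.exp (logCoord y w) := fun w => by
      rw [Real.exp_neg, ← div_eq_mul_inv, div_lt_iff₀ (Real.exp_pos _)]
    simp only [mem_ofPred_eq, twistNorm, Finset.sup'_lt_iff, Finset.mem_univ, true_implies, h2]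
    simp only [convexBodyLT, Set.mem_prod, Set.mem_pi, Set.mem_univ, true_implies, mem_ball_zero_iff]
    simp only [NNReal.coe_mul, Real.coe_toNNReal _ hr, Real.coe_toNNReal _ (Real.exp_pos _).le]
    constructor
    · intro h
      refine ⟨fun w => ?_, fun w => ?_⟩
      · have := h w.1; rw [normAtPlace_apply_of_isReal w.2] at this; exact this
      · have := h w.1; rw [normAtPlace_apply_of_isComplex w.2] at this; exact this
    · rintro ⟨h, h'⟩ w
      rcases w.isReal_or_isComplex with hw | hw
      · rw [normAtPlace_apply_of_isReal hw]; exact h ⟨w, hw⟩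
      · rw [normAtPlace_apply_of_isComplex hw]; exact h' ⟨w, hw⟩
  rw [h1, convexBodyLT_volume, ENNReal.ofReal_mul (by positivity), ENNReal.ofReal_coe_nnreal]
  congr 1
  rw [← ENNReal.ofReal_coe_nnreal]
  congr 1
  push_cast
  simp_rw [mul_pow, Real.coe_toNNReal _ hr, Real.coe_toNNReal _ (Real.exp_pos _).le]
  rw [Finset.prod_mul_distrib]
  have h3 : ∏ w : InfinitePlace K, Real.exp (logCoord y w) ^ w.mult = 1 := by
    simp_rw [← Real.exp_nat_mul]
    rw [← Real.exp_sum, sum_mult_logCoord, Real.exp_zero]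
  have h4 : ∏ w : InfinitePlace K, r ^ w.mult = r ^ finrank ℚ K := by
    rw [Finset.prod_pow_eq_pow_sum, InfinitePlace.sum_mult_eq]
  rw [h3, h4, mul_one]

/-- The integral appearing as the local factor at infinity. -/
def logGaugeIntegral (K : Type*) [Field K] [NumberField K] (s : ℝ) : ℝ≥0∞ :=
  ∫⁻ y : logSpace K, ENNReal.ofReal (logGauge y ^ (-(finrank ℚ K * s)))

theorem lintegral_twistNorm {x : mixedSpace K} (hx : mixedEmbedding.norm x ≠ 0) (s : ℝ) :
    ∫⁻ y : logSpace K, ENNReal.ofReal (twistNorm y x ^ (-(finrank ℚ K * s))) =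
      ENNReal.ofReal (mixedEmbedding.norm x ^ (-s)) * logGaugeIntegral K s := by
  have hN := mixedEmbedding.norm_nonneg x
  have hd : (0:ℝ) < finrank ℚ K := by exact_mod_cast finrank_pos
  unfold logGaugeIntegral
  rw [← lintegral_sub_right_eq_self
    (fun y : logSpace K => ENNReal.ofReal (logGauge y ^ (-(finrank ℚ K * s)))) (logMap x),
    ← lintegral_const_mul]
  · refine lintegral_congr fun y => ?_
    rw [twistNorm_eq y hx, ← ENNReal.ofReal_mul (Real.rpow_nonneg hN _),
      Real.mul_rpow (Real.rpow_nonneg hN _) (zero_le_one.trans (one_le_logGauge _)),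
      ← Real.rpow_mul hN]
    congr 3
    field_simp
  · have := (continuous_logGauge (K := K)).measurable
    fun_prop

end LogSpace

section ClassZeta
open NumberField NumberField.mixedEmbedding NumberField.Units NumberField.Units.dirichletUnitTheorem
open MeasureTheory Set ENNReal Module Finset

open scoped Classical

variable {K : Type*} [Field K] [NumberField K]

/-- Every coset of a subgroup contributes equally to a sum of a function on the quotient. -/
theorem tsum_quotient_mk {G : Type*} [Group G] (H : Subgroup G) (g : G ⧸ H → ℝ≥0∞) :
    ∑' u : G, g (QuotientGroup.mk u) = (ENat.card H : ℝ≥0∞) * ∑' q, g q := by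
  let e : (G ⧸ H) × H → G := fun p => p.1.out * p.2
  have hmk : ∀ p, (QuotientGroup.mk (e p) : G ⧸ H) = p.1 := by
    rintro ⟨q, t⟩
    simp [e, QuotientGroup.mk_mul_of_mem]
  have he : Function.Bijective e := by
    constructor
    · rintro ⟨q, t⟩ ⟨q', t'⟩ h
      have h1 := hmk (q, t)
      rw [h, hmk] at h1
      simp only at h1
      subst h1
      simpa [e] using h
    · intro u
      have h1 : (QuotientGroup.mk (Quotient.out (QuotientGroup.mk u : G ⧸ H)) : G ⧸ H) =
        QuotientGroup.mk u := QuotientGroup.out_eq' _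
      exact ⟨(QuotientGroup.mk u, ⟨_, QuotientGroup.eq.1 h1⟩), by simp [e]⟩
  rw [← (Equiv.ofBijective e he).tsum_eq]
  simp only [Equiv.ofBijective_apply, hmk]
  rw [ENNReal.tsum_prod (f := fun q (_ : H) => g q)]
  simp only [ENNReal.tsum_const]
  rw [ENNReal.tsum_mul_left]

/-- The fundamental parallelotope of the unit lattice. -/
def unitDomain (K : Type*) [Field K] [NumberField K] : Set (logSpace K) :=
  ZSpan.fundamentalDomain ((basisUnitLattice K).ofZLatticeBasis ℝ (unitLattice K))

theorem tsum_unit_lintegral (h : logSpace K → ℝ≥0∞) :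
    ∑' u : (𝓞 K)ˣ, ∫⁻ y in unitDomain K, h (y - logEmbedding K (Additive.ofMul u)) =
      torsionOrder K * ∫⁻ y, h y := by
  let g : (𝓞 K)ˣ ⧸ torsion K → ℝ≥0∞ := fun q =>
    ∫⁻ y in unitDomain K, h (y - logEmbeddingEquiv K (Additive.ofMul q))
  have h1 := tsum_quotient_mk (torsion K) g
  simp only [g, logEmbeddingEquiv_apply] at h1
  rw [h1]
  congr 1
  · have := Fintype.ofFinite (torsion K)
    rw [torsionOrder, ENat.card_eq_coe_fintype_card, Nat.card_eq_fintype_card]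
    simp
  · have hF : IsAddFundamentalDomain (unitLattice K).toAddSubgroup (unitDomain K) volume :=
      ZLattice.isAddFundamentalDomain (basisUnitLattice K) volume
    have hV : VAddInvariantMeasure (unitLattice K).toAddSubgroup (logSpace K) volume :=
      inferInstance
    have hM : MeasurableConstVAdd (unitLattice K).toAddSubgroup (logSpace K) := inferInstance
    have hC : Countable (unitLattice K).toAddSubgroup :=
      inferInstanceAs (Countable (unitLattice K))
    rw [hF.lintegral_eq_tsum' h]
    let e : (𝓞 K)ˣ ⧸ torsion K ≃ (unitLattice K).toAddSubgroup :=
      Additive.ofMul.trans (logEmbeddingEquiv K).toEquiv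
    rw [← e.tsum_eq]
    refine tsum_congr fun q => ?_
    refine lintegral_congr fun y => ?_
    congr 1
    change y - (e q : logSpace K) = -(e q : logSpace K) + y
    abel

theorem norm_mixedEmbedding_eq_absNorm (x : 𝓞 K) :
    mixedEmbedding.norm (mixedEmbedding K (x : K)) = Ideal.absNorm (Ideal.span {x}) := by
  rw [norm_eq_norm, Ideal.absNorm_span_singleton]
  rw [← Algebra.coe_norm_int]
  simp [Nat.cast_natAbs]

theorem norm_mixedEmbedding_ne_zero {x : 𝓞 K} (hx : x ≠ 0) :
    mixedEmbedding.norm (mixedEmbedding K (x : K)) ≠ 0 := by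
  rw [norm_mixedEmbedding_eq_absNorm]
  simpa [Ideal.absNorm_eq_zero_iff] using hx

/-- The partial zeta function of an ideal class, with values in the extended reals. -/
def idealClassSum (C : ClassGroup (𝓞 K)) (s : ℝ) : ℝ≥0∞ :=
  ∑' I : {I : nonZeroDivisors (Ideal (𝓞 K)) // ClassGroup.mk0 I = C},
    ENNReal.ofReal ((Ideal.absNorm I.1.1 : ℝ) ^ (-s))

theorem exists_bijective_mul_generator {C : ClassGroup (𝓞 K)}
    {J : nonZeroDivisors (Ideal (𝓞 K))} (hJ : C * ClassGroup.mk0 J = 1) :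
    ∃ g : {I : nonZeroDivisors (Ideal (𝓞 K)) // ClassGroup.mk0 I = C} → 𝓞 K,
      (∀ I, Ideal.span {g I} = I.1.1 * J.1) ∧
      ∃ e : {I : nonZeroDivisors (Ideal (𝓞 K)) // ClassGroup.mk0 I = C} × (𝓞 K)ˣ ≃
        {x : 𝓞 K // x ∈ J.1 ∧ x ≠ 0}, ∀ p, (e p : 𝓞 K) = p.2 * g p.1 := by
  have h1 : ∀ I : {I : nonZeroDivisors (Ideal (𝓞 K)) // ClassGroup.mk0 I = C},
      ∃ x, Ideal.span {x} = I.1.1 * J.1 := by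
    intro I
    have h2 : ClassGroup.mk0 (I.1 * J) = 1 := by rw [map_mul, I.2, hJ]
    have h3 := (ClassGroup.mk0_eq_one_iff (I.1 * J).2).1 h2
    obtain ⟨x, hx⟩ := h3
    exact ⟨x, by rw [← Ideal.submodule_span_eq, ← hx]; rfl⟩
  choose g hg using h1
  have hg0 : ∀ I, g I ≠ 0 := by
    intro I h
    have h2 := hg I
    rw [h] at h2
    have : (I.1 * J).1 = 0 := by
      change I.1.1 * J.1 = 0
      rw [← h2]; simp
    exact nonZeroDivisors.coe_ne_zero _ this
  refine ⟨g, hg, Equiv.ofBijective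
    (fun p => ⟨p.2 * g p.1, ?_, mul_ne_zero p.2.ne_zero (hg0 _)⟩) ⟨?_, ?_⟩, fun p => rfl⟩
  · refine Ideal.mul_mem_left _ _ ?_
    have : g p.1 ∈ Ideal.span {g p.1} := Ideal.mem_span_singleton_self _
    rw [hg] at this
    have hle : p.1.1.1 * J.1 ≤ J.1 := Ideal.mul_le_right.trans le_rfl
    exact hle this
  · rintro ⟨I, u⟩ ⟨I', u'⟩ h
    simp only [Subtype.mk.injEq] at h
    have h2 : I.1.1 * J.1 = I'.1.1 * J.1 := by
      rw [← hg, ← hg, Ideal.span_singleton_eq_span_singleton]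
      refine ⟨u * u'⁻¹, ?_⟩
      rw [Units.val_mul]
      calc g I * (u * (u'⁻¹ : (𝓞 K)ˣ)) = (u * g I) * (u'⁻¹ : (𝓞 K)ˣ) := by ring
        _ = g I' * (u' * (u'⁻¹ : (𝓞 K)ˣ)) := by rw [h]; ring
        _ = g I' := by simp
    have h3 : I = I' := by
      apply Subtype.ext
      apply Subtype.ext
      exact mul_right_cancel₀ (nonZeroDivisors.coe_ne_zero J) h2
    subst h3
    have h4 := mul_right_cancel₀ (hg0 I) h
    rw [Units.ext h4]
  · rintro ⟨x, hxJ, hx0⟩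
    obtain ⟨I, hI⟩ := Ideal.dvd_span_singleton.2 hxJ
    have hI0 : I ≠ 0 := by
      rintro rfl
      rw [mul_zero] at hI
      exact hx0 (Ideal.span_singleton_eq_bot.1 hI)
    let I' : nonZeroDivisors (Ideal (𝓞 K)) := ⟨I, mem_nonZeroDivisors_of_ne_zero hI0⟩
    have h2 : ClassGroup.mk0 (I' * J) = 1 := by
      refine (ClassGroup.mk0_eq_one_iff (I' * J).2).2 ?_
      change (I * J.1).IsPrincipal
      rw [mul_comm, ← hI]
      exact ⟨x, rfl⟩
    have h3 : ClassGroup.mk0 I' = C := by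
      rw [map_mul] at h2
      exact mul_right_cancel (h2.trans hJ.symm)
    have h4 : Ideal.span {g ⟨I', h3⟩} = Ideal.span {x} := by
      rw [hg, hI, mul_comm]
    rw [Ideal.span_singleton_eq_span_singleton] at h4
    obtain ⟨u, hu⟩ := h4
    exact ⟨(⟨I', h3⟩, u), by simp [← hu, mul_comm]⟩

theorem tsum_twistNorm_ideal {C : ClassGroup (𝓞 K)}
    {J : nonZeroDivisors (Ideal (𝓞 K))} (hJ : C * ClassGroup.mk0 J = 1) (s : ℝ) :
    ∑' x : {x : 𝓞 K // x ∈ J.1 ∧ x ≠ 0}, ∫⁻ y in unitDomain K,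
      ENNReal.ofReal (twistNorm y (mixedEmbedding K ((x : 𝓞 K) : K)) ^ (-(finrank ℚ K * s))) =
    torsionOrder K * logGaugeIntegral K s * ENNReal.ofReal ((Ideal.absNorm J.1 : ℝ) ^ (-s)) *
      idealClassSum C s := by
  obtain ⟨g, hg, e, he⟩ := exists_bijective_mul_generator hJ
  rw [← e.tsum_eq, ENNReal.tsum_prod', idealClassSum, ← ENNReal.tsum_mul_left]
  refine tsum_congr fun I => ?_
  have hgI : g I ≠ 0 := by
    have := (e (I, 1)).2.2
    rw [he] at this
    exact right_ne_zero_of_mul this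
  have hn := norm_mixedEmbedding_ne_zero hgI
  have h1 : ∀ (u : (𝓞 K)ˣ) (y : logSpace K),
      twistNorm y (mixedEmbedding K ((e (I, u) : 𝓞 K) : K)) =
      twistNorm (y - logEmbedding K (Additive.ofMul u)) (mixedEmbedding K (g I : K)) := by
    intro u y
    have hu : mixedEmbedding.norm (mixedEmbedding K ((u : 𝓞 K) : K)) = 1 := norm_unit u
    have h2 : mixedEmbedding K ((e (I, u) : 𝓞 K) : K) =
        mixedEmbedding K ((u : 𝓞 K) : K) * mixedEmbedding K (g I : K) := by
      rw [he]; simp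
    have h3 : mixedEmbedding.norm (mixedEmbedding K ((e (I, u) : 𝓞 K) : K)) =
        mixedEmbedding.norm (mixedEmbedding K (g I : K)) := by
      rw [h2, map_mul, hu, one_mul]
    rw [twistNorm_eq _ (h3 ▸ hn), twistNorm_eq _ hn, h3, h2, logMap_mul (by rw [hu]; simp) hn,
      logMap_eq_logEmbedding, sub_sub]
  simp_rw [h1]
  rw [tsum_unit_lintegral (fun y => ENNReal.ofReal (twistNorm y (mixedEmbedding K (g I : K)) ^
    (-(finrank ℚ K * s)))), lintegral_twistNorm hn, norm_mixedEmbedding_eq_absNorm, hg, map_mul,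
    Nat.cast_mul, Real.mul_rpow (Nat.cast_nonneg _) (Nat.cast_nonneg _),
    ENNReal.ofReal_mul (Real.rpow_nonneg (Nat.cast_nonneg _) _)]
  ring

end ClassZeta

section ClassZetaBound
open NumberField NumberField.mixedEmbedding NumberField.Units NumberField.Units.dirichletUnitTheorem
open MeasureTheory Set ENNReal Module Finset

open scoped Classical

variable {K : Type*} [Field K] [NumberField K]

theorem mem_span_mk0_latticeBasis {J : nonZeroDivisors (Ideal (𝓞 K))} {x : mixedSpace K} :
    x ∈ Submodule.span ℤ
      (Set.range (fractionalIdealLatticeBasis K (FractionalIdeal.mk0 K J))) ↔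
      ∃ a ∈ J.1, mixedEmbedding K (a : K) = x := by
  rw [mem_span_fractionalIdealLatticeBasis]
  constructor
  · rintro ⟨z, hz, hzx⟩
    rw [FractionalIdeal.coe_mk0, SetLike.mem_coe, FractionalIdeal.mem_coeIdeal] at hz
    obtain ⟨a, ha, rfl⟩ := hz
    exact ⟨a, ha, hzx⟩
  · rintro ⟨a, ha, hax⟩
    refine ⟨_, ?_, hax⟩
    rw [FractionalIdeal.coe_mk0, SetLike.mem_coe]
    exact FractionalIdeal.mem_coeIdeal_of_mem _ ha

theorem tsum_span_fractionalIdealLatticeBasis (J : nonZeroDivisors (Ideal (𝓞 K)))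
    (f : mixedSpace K → ℝ≥0∞) :
    ∑' x : Submodule.span ℤ (Set.range (fractionalIdealLatticeBasis K (FractionalIdeal.mk0 K J))),
      (if (x : mixedSpace K) = 0 then 0 else f x) =
    ∑' x : {x : 𝓞 K // x ∈ J.1 ∧ x ≠ 0}, f (mixedEmbedding K ((x : 𝓞 K) : K)) := by
  let g : {x : 𝓞 K // x ∈ J.1 ∧ x ≠ 0} →
      Submodule.span ℤ (Set.range (fractionalIdealLatticeBasis K (FractionalIdeal.mk0 K J))) :=
    fun x => ⟨mixedEmbedding K ((x : 𝓞 K) : K), mem_span_mk0_latticeBasis.2 ⟨x, x.2.1, rfl⟩⟩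
  have hg : Function.Injective g := by
    intro x y h
    have h1 : mixedEmbedding K ((x : 𝓞 K) : K) = mixedEmbedding K ((y : 𝓞 K) : K) :=
      congrArg Subtype.val h
    exact Subtype.ext (RingOfIntegers.ext ((mixedEmbedding_injective K) h1))
  rw [← hg.tsum_eq]
  · refine tsum_congr fun x => ?_
    have : (g x : mixedSpace K) ≠ 0 := by
      change mixedEmbedding K ((x : 𝓞 K) : K) ≠ 0
      simpa using x.2.2
    rw [if_neg this]
  · intro x hx
    have hx0 : (x : mixedSpace K) ≠ 0 := by
      intro h
      exact hx (if_pos h)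
    obtain ⟨a, ha, hzx⟩ := mem_span_mk0_latticeBasis.1 x.2
    refine ⟨⟨a, ha, ?_⟩, Subtype.ext hzx⟩
    rintro rfl
    exact hx0 (by rw [← hzx]; simp)

theorem one_le_twistNorm (y : logSpace K) {x : 𝓞 K} (hx : x ≠ 0) :
    1 ≤ twistNorm y (mixedEmbedding K (x : K)) := by
  rw [twistNorm_eq y (norm_mixedEmbedding_ne_zero hx), norm_mixedEmbedding_eq_absNorm]
  have h1 : (1 : ℝ) ≤ Ideal.absNorm (Ideal.span {x}) := by
    have : Ideal.absNorm (Ideal.span {x}) ≠ 0 := by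
      simpa [Ideal.absNorm_eq_zero_iff] using hx
    exact_mod_cast Nat.one_le_iff_ne_zero.2 this
  exact one_le_mul_of_one_le_of_one_le (Real.one_le_rpow h1 (by positivity)) (one_le_logGauge _)

theorem exists_logGauge_le : ∃ D : ℝ, 0 ≤ D ∧ ∀ y ∈ unitDomain K, logGauge y ≤ D := by
  have h1 : Bornology.IsBounded (unitDomain K) := ZSpan.fundamentalDomain_isBounded _
  obtain ⟨D, hD⟩ := (h1.isCompact_closure.image continuous_logGauge).bddAbove
  refine ⟨max D 0, le_max_right _ _, fun y hy => le_max_of_le_left (hD ?_)⟩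
  exact ⟨y, subset_closure hy, rfl⟩

theorem logGaugeIntegral_ne_zero (s : ℝ) : logGaugeIntegral K s ≠ 0 := by
  unfold logGaugeIntegral
  have hm : Measurable fun y : logSpace K =>
      ENNReal.ofReal (logGauge y ^ (-(finrank ℚ K * s))) := by
    have := (continuous_logGauge (K := K)).measurable
    fun_prop
  rw [Ne, lintegral_eq_zero_iff hm]
  intro h
  have h2 : ∀ᵐ y : logSpace K, False := by
    filter_upwards [h] with y hy
    simp only [Pi.zero_apply, ENNReal.ofReal_eq_zero] at hy
    have : 0 < logGauge y ^ (-(finrank ℚ K * s)) :=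
      Real.rpow_pos_of_pos (zero_lt_one.trans_le (one_le_logGauge y)) _
    linarith
  rw [Filter.eventually_false_iff_eq_bot, ae_eq_bot] at h2
  exact (NeZero.ne (volume : Measure (logSpace K))) h2

theorem logGaugeIntegral_antitone {s t : ℝ} (h : s ≤ t) :
    logGaugeIntegral K t ≤ logGaugeIntegral K s := by
  refine lintegral_mono fun y => ENNReal.ofReal_le_ofReal ?_
  refine Real.rpow_le_rpow_of_exponent_le (one_le_logGauge y) ?_
  have : (0:ℝ) < finrank ℚ K := by exact_mod_cast finrank_pos
  nlinarith

/-- Integrated form of the lattice point estimate, for the ideals of a class. -/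
theorem idealClassSum_unfolded {C : ClassGroup (𝓞 K)}
    {J : nonZeroDivisors (Ideal (𝓞 K))} (hJ : C * ClassGroup.mk0 J = 1) :
    ∃ B : ℝ, ∀ s : ℝ, 1 < s → s ≤ 2 →
    let X := ENNReal.ofReal (Ideal.absNorm J.1) *
        volume (ZSpan.fundamentalDomain (latticeBasis K)) *
        (torsionOrder K * logGaugeIntegral K s * ENNReal.ofReal ((Ideal.absNorm J.1 : ℝ) ^ (-s)) *
          idealClassSum C s)
    X ≤ volume (unitDomain K) * ENNReal.ofReal ((convexBodyLTFactor K : NNReal) * (s / (s - 1))) +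
      ENNReal.ofReal B ∧
    volume (unitDomain K) * ENNReal.ofReal ((convexBodyLTFactor K : NNReal) * (s / (s - 1))) ≤
      X + ENNReal.ofReal B := by
  set b := fractionalIdealLatticeBasis K (FractionalIdeal.mk0 K J) with hb
  obtain ⟨D₁, hD₁0, hD₁⟩ := exists_logGauge_le (K := K)
  obtain ⟨D₂, hD₂⟩ := (ZSpan.fundamentalDomain_isBounded b).exists_norm_le
  set D := max D₂ 0 * D₁ with hDdef
  have hD0 : 0 ≤ D := by positivity
  have hd : (0:ℕ) < finrank ℚ K := finrank_pos
  obtain ⟨k, hk⟩ : ∃ k, finrank ℚ K = k + 1 := ⟨finrank ℚ K - 1, by omega⟩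
  have hk' : (finrank ℚ K : ℝ) = k + 1 := by exact_mod_cast hk
  set κ : ℝ := ((convexBodyLTFactor K : NNReal) : ℝ) with hκ
  set B₀ := κ * (1 + D) ^ (k + 1) + κ * ((k + 1) * D) +
      (volume (ZSpan.fundamentalDomain b)).toReal with hB₀
  set V := volume (unitDomain K) with hV
  have hVtop : V ≠ ∞ := (ZSpan.fundamentalDomain_isBounded _).measure_lt_top.ne
  refine ⟨V.toReal * (B₀ * (2 * (k + 1))), fun s hs hs2 => ?_⟩
  set S : logSpace K → ℝ≥0∞ := fun y => ∑' x : {x : 𝓞 K // x ∈ J.1 ∧ x ≠ 0},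
    ENNReal.ofReal (twistNorm y (mixedEmbedding K ((x : 𝓞 K) : K)) ^ (-(finrank ℚ K * s)))
  have hmeas : ∀ x : mixedSpace K, Measurable fun y : logSpace K =>
      ENNReal.ofReal (twistNorm y x ^ (-(finrank ℚ K * s))) := by
    intro x
    have : Continuous fun y : logSpace K => twistNorm y x := by
      unfold twistNorm
      refine Continuous.finset_sup'_apply _ fun w _ => ?_
      have := continuous_logCoord w (K := K)
      fun_prop
    have := this.measurable
    fun_prop
  have hv : volume (ZSpan.fundamentalDomain b) = ENNReal.ofReal (Ideal.absNorm J.1) *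
        volume (ZSpan.fundamentalDomain (latticeBasis K)) := by
    rw [hb, volume_fundamentalDomain_fractionalIdealLatticeBasis, FractionalIdeal.coe_mk0,
      FractionalIdeal.coeIdeal_absNorm]
    simp
  have hcount : Countable {x : 𝓞 K // x ∈ J.1 ∧ x ≠ 0} := by
    have : Countable (𝓞 K) := (RingOfIntegers.basis K).equivFun.injective.countable
    infer_instance
  have hint : ∫⁻ y in unitDomain K, S y = torsionOrder K * logGaugeIntegral K s *
      ENNReal.ofReal ((Ideal.absNorm J.1 : ℝ) ^ (-s)) * idealClassSum C s := by
    rw [← tsum_twistNorm_ideal hJ, lintegral_tsum fun x => (hmeas _).aemeasurable]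
  have hSm : Measurable S := Measurable.tsum fun x => hmeas _
  have hkey : ∀ y ∈ unitDomain K,
      volume (ZSpan.fundamentalDomain b) * S y ≤
        ENNReal.ofReal (κ * (s / (s - 1))) + ENNReal.ofReal (B₀ * (2 * (k + 1))) ∧
      ENNReal.ofReal (κ * (s / (s - 1))) ≤
        volume (ZSpan.fundamentalDomain b) * S y + ENNReal.ofReal (B₀ * (2 * (k + 1))) := by
    intro y hy
    have h1 := epstein_bound (μ := volume) (b := b) (M := twistNorm y) (D := D) (κ := κ) (k := k)
      (s := s) (measurable_twistNorm y) (twistNorm_add_le y) (twistNorm_neg y) ?_ hD0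
      (NNReal.coe_nonneg _) ?_ (twistNorm_zero y) ?_ hs hs2 hB₀
    · have h2 := tsum_span_fractionalIdealLatticeBasis J
        (fun x => ENNReal.ofReal (twistNorm y x ^ (-(finrank ℚ K * s))))
      simp only [hk'] at h2
      simp only [S, hk']
      rw [← h2]
      convert h1
    · intro x hx
      refine (twistNorm_le_norm_mul y x).trans ?_
      exact mul_le_mul (le_max_of_le_left (hD₂ x hx)) (hD₁ y hy)
        (zero_le_one.trans (one_le_logGauge y)) (le_max_right _ _)
    · intro r hr
      rw [volume_twistNorm_lt y hr, hk]
    · intro x hx hx0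
      obtain ⟨a, ha, hzx⟩ := mem_span_mk0_latticeBasis.1 hx
      rw [← hzx]
      refine one_le_twistNorm y ?_
      rintro rfl
      exact hx0 (by rw [← hzx]; simp)
  have hdom : MeasurableSet (unitDomain K) := ZSpan.fundamentalDomain_measurableSet _
  intro X
  have hX : X = ∫⁻ y in unitDomain K, volume (ZSpan.fundamentalDomain b) * S y := by
    rw [lintegral_const_mul _ hSm, hint, hv]
  have hB : ENNReal.ofReal (V.toReal * (B₀ * (2 * (k + 1)))) =
      V * ENNReal.ofReal (B₀ * (2 * (k + 1))) := by
    rw [ENNReal.ofReal_mul ENNReal.toReal_nonneg, ENNReal.ofReal_toReal hVtop]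
  rw [hB, hX]
  constructor
  · calc _ ≤ ∫⁻ y in unitDomain K,
          (ENNReal.ofReal (κ * (s / (s - 1))) + ENNReal.ofReal (B₀ * (2 * (k + 1)))) :=
          setLIntegral_mono' hdom fun y hy => (hkey y hy).1
      _ = _ := by rw [setLIntegral_const, add_mul]; ring
  · calc _ = ∫⁻ y in unitDomain K, ENNReal.ofReal (κ * (s / (s - 1))) := by
          rw [setLIntegral_const, mul_comm]
      _ ≤ ∫⁻ y in unitDomain K, (volume (ZSpan.fundamentalDomain b) * S y +
          ENNReal.ofReal (B₀ * (2 * (k + 1)))) :=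
          setLIntegral_mono' hdom fun y hy => (hkey y hy).2
      _ = _ := by
          rw [lintegral_add_right _ measurable_const, setLIntegral_const]
          ring

end ClassZetaBound

section ClassZetaReal
open NumberField NumberField.mixedEmbedding NumberField.Units NumberField.Units.dirichletUnitTheorem
open MeasureTheory Set ENNReal Module Finset

open scoped Classical

variable {K : Type*} [Field K] [NumberField K]

theorem idealClassSum_ne_zero (C : ClassGroup (𝓞 K)) (s : ℝ) : idealClassSum C s ≠ 0 := by
  obtain ⟨I, hI⟩ := ClassGroup.mk0_surjective C
  unfold idealClassSum
  rw [Ne, ENNReal.tsum_eq_zero]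
  intro h
  have h1 := h ⟨I, hI⟩
  rw [ENNReal.ofReal_eq_zero] at h1
  have h2 : 0 < (Ideal.absNorm I.1 : ℝ) := by
    have : Ideal.absNorm I.1 ≠ 0 := by
      rw [Ne, Ideal.absNorm_eq_zero_iff]
      exact nonZeroDivisors.coe_ne_zero I
    positivity
  exact absurd (Real.rpow_pos_of_pos h2 (-s)) (not_lt.2 h1)

theorem abs_sub_div_le_of_mul_eq {n m t X a Z P Q R : ℝ} (hn : 1 ≤ n) (hm : 1 ≤ m) (hmn : m ≤ n)
    (hmt : m ≤ 1 + t * (n - 1)) (ht : 0 ≤ t) (hX : X * m = a * Z) (ha : 0 < a) (hP : 0 ≤ P)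
    (hQ : 0 ≤ Q) (hR : t * P ≤ R) (h1 : X ≤ P + Q) (h2 : P ≤ X + Q) :
    |Z - P / a| ≤ (R * (n - 1) + n * Q) / a := by
  have hn' : 0 ≤ n - 1 := by linarith
  have e1 : X * m ≤ (P + Q) * m := by gcongr
  have e2 : P * m ≤ (X + Q) * m := by gcongr
  have e3 : P * m ≤ P * (1 + t * (n - 1)) := by gcongr
  have e4 : Q * m ≤ n * Q := by nlinarith
  have e5 : t * P * (n - 1) ≤ R * (n - 1) := by gcongr
  have e6 : P ≤ P * m := by nlinarith
  have e7 : 0 ≤ R * (n - 1) := (by positivity : 0 ≤ t * P * (n - 1)).trans e5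
  have e8 : Z - P / a = (X * m - P) / a := by
    rw [hX]; field_simp
  rw [e8, abs_div, abs_of_pos ha, div_le_div_iff_of_pos_right ha, abs_le]
  constructor <;> linarith

set_option maxHeartbeats 2000000 in
/-- All the partial zeta functions of the ideal classes have the same polar part at `1`. -/
theorem exists_idealClassSum_approx (K : Type*) [Field K] [NumberField K] :
    ∃ g : ℝ → ℝ, ∀ C : ClassGroup (𝓞 K), ∃ B : ℝ, ∀ s : ℝ, 1 < s → s ≤ 2 →
      idealClassSum C s ≠ ∞ ∧ |(idealClassSum C s).toReal - g s| ≤ B := by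
  set V : ℝ := (volume (unitDomain K)).toReal with hV
  have hVtop : volume (unitDomain K) ≠ ∞ :=
    (ZSpan.fundamentalDomain_isBounded _).measure_lt_top.ne
  have hV0 : 0 ≤ V := ENNReal.toReal_nonneg
  set v : ℝ := (volume (ZSpan.fundamentalDomain (latticeBasis K))).toReal with hv
  have hvtop : volume (ZSpan.fundamentalDomain (latticeBasis K)) ≠ ∞ :=
    (ZSpan.fundamentalDomain_isBounded _).measure_lt_top.ne
  have hvne : volume (ZSpan.fundamentalDomain (latticeBasis K)) ≠ 0 :=
    ZSpan.measure_fundamentalDomain_ne_zero _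
  have hv0 : 0 < v := ENNReal.toReal_pos hvne hvtop
  set κ : ℝ := ((convexBodyLTFactor K : NNReal) : ℝ) with hκ
  have hκ0 : 0 ≤ κ := NNReal.coe_nonneg _
  set w : ℝ := ((torsionOrder K : ℕ) : ℝ) with hw
  have hw0 : 0 < w := by
    have : torsionOrder K ≠ 0 := torsionOrder_ne_zero K
    positivity
  let c : ℝ → ℝ := fun s => (logGaugeIntegral K s).toReal
  refine ⟨fun s => (V * (κ * (s / (s - 1)))) / (v * w * c s), fun C => ?_⟩
  obtain ⟨J, hJ⟩ := ClassGroup.mk0_surjective C⁻¹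
  have hJ1 : C * ClassGroup.mk0 J = 1 := by rw [hJ, mul_inv_cancel]
  obtain ⟨B, hB⟩ := idealClassSum_unfolded hJ1
  set n : ℝ := (Ideal.absNorm J.1 : ℝ) with hn
  have hn1 : 1 ≤ n := by
    have : Ideal.absNorm J.1 ≠ 0 := by
      rw [Ne, Ideal.absNorm_eq_zero_iff]
      exact nonZeroDivisors.coe_ne_zero J
    rw [hn]
    exact_mod_cast Nat.one_le_iff_ne_zero.2 this
  have hn0 : 0 < n := by linarith
  have hfin : ∀ s : ℝ, 1 < s → s ≤ 2 → logGaugeIntegral K s ≠ ∞ ∧ idealClassSum C s ≠ ∞ := by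
    intro s hs hs2
    obtain ⟨h1, -⟩ := hB s hs hs2
    have h2 := ne_top_of_le_ne_top (ENNReal.add_ne_top.2
      ⟨ENNReal.mul_ne_top hVtop ENNReal.ofReal_ne_top, ENNReal.ofReal_ne_top⟩) h1
    have hz := idealClassSum_ne_zero C s
    have hc := logGaugeIntegral_ne_zero (K := K) s
    have hw' : (torsionOrder K : ℝ≥0∞) ≠ 0 := by
      exact_mod_cast torsionOrder_ne_zero K
    have hn' : ENNReal.ofReal n ≠ 0 := by
      rw [Ne, ENNReal.ofReal_eq_zero]; linarith
    have hns : ENNReal.ofReal (n ^ (-s)) ≠ 0 := by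
      rw [Ne, ENNReal.ofReal_eq_zero]
      exact not_le.2 (Real.rpow_pos_of_pos hn0 _)
    constructor
    · intro hcon
      apply h2
      rw [hcon, ENNReal.mul_top hw', ENNReal.top_mul hns, ENNReal.top_mul hz,
        ENNReal.mul_top (mul_ne_zero hn' hvne)]
    · intro hcon
      apply h2
      rw [hcon, ENNReal.mul_top (mul_ne_zero (mul_ne_zero hw' hc) hns),
        ENNReal.mul_top (mul_ne_zero hn' hvne)]
  have hc2 : 0 < c 2 := ENNReal.toReal_pos (logGaugeIntegral_ne_zero 2)
    (hfin 2 (by norm_num) le_rfl).1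
  set Q := max B 0 with hQ
  refine ⟨(V * (κ * 2) * (n - 1) + n * Q) / (v * w * c 2), fun s hs hs2 =>
    ⟨(hfin s hs hs2).2, ?_⟩⟩
  obtain ⟨h1, h2⟩ := hB s hs hs2
  obtain ⟨hcs, hZs⟩ := hfin s hs hs2
  have hcmono : c 2 ≤ c s := ENNReal.toReal_mono hcs (logGaugeIntegral_antitone hs2)
  set Z := (idealClassSum C s).toReal with hZ
  set P := V * (κ * (s / (s - 1))) with hP
  have hs1 : 0 < s - 1 := by linarith
  have hP0 : 0 ≤ P := by positivity
  set X : ℝ := n * v * (w * c s * n ^ (-s) * Z) with hX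
  have hns0 : 0 ≤ n ^ (-s) := Real.rpow_nonneg hn0.le _
  have hX0 : 0 ≤ X := by
    have := hc2.trans_le hcmono
    have : 0 ≤ Z := ENNReal.toReal_nonneg
    positivity
  have hXe : ENNReal.ofReal n * volume (ZSpan.fundamentalDomain (latticeBasis K)) *
      (torsionOrder K * logGaugeIntegral K s * ENNReal.ofReal (n ^ (-s)) * idealClassSum C s) =
      ENNReal.ofReal X := by
    have e1 : (torsionOrder K : ℝ≥0∞) = ENNReal.ofReal w := by rw [hw]; simp
    rw [e1, ← ENNReal.ofReal_toReal hvtop, ← ENNReal.ofReal_toReal hcs,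
      ← ENNReal.ofReal_toReal hZs, ← ENNReal.ofReal_mul hn0.le, ← ENNReal.ofReal_mul hw0.le,
      ← ENNReal.ofReal_mul (by positivity), ← ENNReal.ofReal_mul (by positivity),
      ← ENNReal.ofReal_mul (by positivity)]
  have hPe : volume (unitDomain K) * ENNReal.ofReal (κ * (s / (s - 1))) = ENNReal.ofReal P := by
    rw [← ENNReal.ofReal_toReal hVtop, ← ENNReal.ofReal_mul hV0]
  have hBQ : ENNReal.ofReal B = ENNReal.ofReal Q := by
    rw [hQ]
    rcases le_total B 0 with h | h
    · rw [max_eq_right h, ENNReal.ofReal_of_nonpos h]; simp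
    · rw [max_eq_left h]
  have hQ0 : 0 ≤ Q := le_max_right _ _
  rw [hXe, hPe, hBQ, ← ENNReal.ofReal_add hP0 hQ0, ENNReal.ofReal_le_ofReal_iff (by positivity)]
    at h1
  rw [hXe, hPe, hBQ, ← ENNReal.ofReal_add hX0 hQ0, ENNReal.ofReal_le_ofReal_iff (by positivity)]
    at h2
  have hcs0 : 0 < c s := hc2.trans_le hcmono
  set a := v * w * c s with ha
  have ha0 : 0 < a := by positivity
  have haa : v * w * c 2 ≤ a := by
    rw [ha]; gcongr
  set m := n ^ (s - 1) with hm
  have hm1 : 1 ≤ m := Real.one_le_rpow hn1 hs1.le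
  have hmn : m ≤ n := by
    calc m ≤ n ^ (1:ℝ) := Real.rpow_le_rpow_of_exponent_le hn1 (by linarith)
      _ = n := Real.rpow_one n
  have hmb : m ≤ 1 + (s - 1) * (n - 1) := by
    have := rpow_one_add_le_one_add_mul_self (s := n - 1) (by linarith) hs1.le
      (by linarith : s - 1 ≤ 1)
    simpa using this
  have hXm : X * m = a * Z := by
    have : n * n ^ (-s) * n ^ (s - 1) = 1 := by
      rw [← Real.rpow_one_add' hn0.le (by linarith), ← Real.rpow_add hn0]
      rw [show 1 + -s + (s - 1) = 0 by ring, Real.rpow_zero]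
    rw [hX, ha, hm]
    linear_combination (v * w * c s * Z) * this
  have hsP : (s - 1) * P ≤ V * (κ * 2) := by
    have : (s - 1) * P = V * (κ * s) := by
      rw [hP]; field_simp
    rw [this]; gcongr
  have hn1' : 0 ≤ n - 1 := by linarith
  refine (abs_sub_div_le_of_mul_eq hn1 hm1 hmn hmb hs1.le hXm ha0 hP0 hQ0 hsP h1 h2).trans ?_
  gcongr

end ClassZetaReal

section IdealEulerProduct
open Filter Topology
open scoped Classical

variable {R : Type*} [CommRing R] [IsDedekindDomain R]

/-- The nonzero ideals all of whose prime factors lie in `S`. -/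
def factoredIdeals (S : Finset (Ideal R)) : Set (Ideal R) :=
  {I | I ≠ 0 ∧ ∀ p, Prime p → p ∣ I → p ∈ S}

theorem factoredIdeals_empty : factoredIdeals (∅ : Finset (Ideal R)) = {1} := by
  ext I
  simp only [factoredIdeals, Set.mem_ofPred_eq, Finset.notMem_empty, Set.mem_singleton_iff]
  constructor
  · rintro ⟨h0, h⟩
    by_contra h1
    obtain ⟨p, hp, hpI⟩ := WfDvdMonoid.exists_irreducible_factor
      (fun hu => h1 (by rw [Ideal.isUnit_iff.1 hu, Ideal.one_eq_top])) h0
    exact h p hp.prime hpI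
  · rintro rfl
    exact ⟨one_ne_zero, fun p hp h => hp.not_isUnit (isUnit_of_dvd_one h)⟩

theorem exists_bijective_factoredIdeals_insert {S : Finset (Ideal R)} {p : Ideal R} (hp : Prime p)
    (hpS : p ∉ S) : ∃ e : ℕ × factoredIdeals S ≃ factoredIdeals (insert p S),
      ∀ x, (e x : Ideal R) = p ^ x.1 * x.2 := by
  have hmem : ∀ x : ℕ × factoredIdeals S,
      p ^ x.1 * (x.2 : Ideal R) ∈ factoredIdeals (insert p S) := by
    rintro ⟨n, J, hJ0, hJ⟩
    refine ⟨mul_ne_zero (pow_ne_zero _ hp.ne_zero) hJ0, fun q hq hqd => ?_⟩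
    rcases hq.dvd_or_dvd hqd with h | h
    · have := hq.dvd_of_dvd_pow h
      rw [Finset.mem_insert]
      left
      exact associated_iff_eq.1 ((hq.dvd_prime_iff_associated hp).1 this)
    · exact Finset.mem_insert_of_mem (hJ q hq h)
  have hnd : ∀ J ∈ factoredIdeals S, ¬ p ∣ J := fun J hJ h => hpS (hJ.2 p hp h)
  refine ⟨Equiv.ofBijective (fun x => ⟨_, hmem x⟩) ⟨?_, ?_⟩, fun x => rfl⟩
  · rintro ⟨n, J, hJ⟩ ⟨m, J', hJ'⟩ h
    simp only [Subtype.mk.injEq] at h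
    have hle : ∀ {n m : ℕ} {J J' : Ideal R}, J ∈ factoredIdeals S → J' ∈ factoredIdeals S →
        p ^ n * J = p ^ m * J' → n ≤ m := by
      intro n m J J' hJ hJ' h
      by_contra! hlt
      obtain ⟨k, rfl⟩ := Nat.exists_eq_add_of_lt hlt
      have h2 : p ^ m * (p ^ (k + 1) * J) = p ^ m * J' := by rw [← h]; ring
      have h3 := mul_left_cancel₀ (pow_ne_zero m hp.ne_zero) h2
      exact hnd J' hJ' (h3 ▸ Dvd.intro (p ^ k * J) (by ring))
    obtain rfl : n = m := le_antisymm (hle hJ hJ' h) (hle hJ' hJ h.symm)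
    have := mul_left_cancel₀ (pow_ne_zero n hp.ne_zero) h
    simp [this]
  · rintro ⟨I, hI0, hI⟩
    obtain ⟨J, h1, h2⟩ := (FiniteMultiplicity.of_not_isUnit hp.not_isUnit
      hI0).exists_eq_pow_mul_and_not_dvd
    refine ⟨⟨multiplicity p I, J, ?_, ?_⟩, Subtype.ext h1.symm⟩
    · rintro rfl; exact h2 (dvd_zero _)
    · intro q hq hqJ
      have := hI q hq (h1 ▸ hqJ.mul_left _)
      rcases Finset.mem_insert.1 this with rfl | h
      · exact absurd hqJ h2
      · exact h

variable {f : Ideal R →*₀ ℝ}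

theorem abs_lt_one_of_summable (hf : Summable fun I => ‖f I‖) {p : Ideal R} (hp : Prime p) :
    |f p| < 1 := by
  have hinj : Function.Injective fun n : ℕ => p ^ n := by
    refine (Ideal.pow_right_strictAnti p hp.ne_zero fun h => hp.not_isUnit ?_).injective
    exact Ideal.isUnit_iff.2 h
  have h1 := (hf.comp_injective hinj).tendsto_atTop_zero
  by_contra! h
  have h2 : ∀ n : ℕ, 1 ≤ ‖f (p ^ n)‖ := by
    intro n
    rw [map_pow, norm_pow]
    exact one_le_pow₀ h
  exact absurd (ge_of_tendsto' h1 h2) (by norm_num)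

theorem summable_hasSum_factoredIdeals (hf : Summable fun I => ‖f I‖) (S : Finset (Ideal R))
    (hS : ∀ p ∈ S, Prime p) :
    HasSum (fun I : factoredIdeals S => f I) (∏ p ∈ S, (1 - f p)⁻¹) := by
  induction S using Finset.induction_on with
  | empty =>
    rw [factoredIdeals_empty, Finset.prod_empty]
    have := hasSum_unique (fun I : ({1} : Set (Ideal R)) => f I)
    convert this
    exact (map_one f).symm
  | insert p S hpS ih =>
    have hp := hS p (Finset.mem_insert_self p S)
    obtain ⟨e, he⟩ := exists_bijective_factoredIdeals_insert hp hpS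
    have ih' := ih fun q hq => hS q (Finset.mem_insert_of_mem hq)
    rw [Finset.prod_insert hpS, ← e.hasSum_iff]
    have h1 : HasSum (fun n : ℕ => f p ^ n) (1 - f p)⁻¹ :=
      hasSum_geometric_of_abs_lt_one (abs_lt_one_of_summable hf hp)
    have h2 : Summable fun x : ℕ × factoredIdeals S => f p ^ x.1 * f x.2 := by
      refine summable_mul_of_summable_norm ?_ (hf.subtype _)
      simp_rw [norm_pow]
      exact summable_geometric_of_lt_one (norm_nonneg _) (abs_lt_one_of_summable hf hp)
    have h3 := h1.mul ih' h2
    have h4 : ((fun I : factoredIdeals (insert p S) => f I) ∘ e) =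
        fun x : ℕ × factoredIdeals S => f p ^ x.1 * f x.2 := by
      ext x
      rw [Function.comp_apply, he, map_mul, map_pow]
    rw [h4]
    exact h3

theorem tendsto_eulerProduct_ideal (hf : Summable fun I => ‖f I‖) :
    Tendsto (fun S : Finset {p : Ideal R // Prime p} => ∏ p ∈ S, (1 - f p)⁻¹) atTop
      (𝓝 (∑' I, f I)) := by
  have h1 : ∀ S : Finset {p : Ideal R // Prime p}, ∏ p ∈ S, (1 - f p)⁻¹ =
      ∑' I, (factoredIdeals (S.map (Function.Embedding.subtype _))).indicator f I := by
    intro S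
    rw [← tsum_subtype]
    have := (summable_hasSum_factoredIdeals hf (S.map (Function.Embedding.subtype _)) (by
      intro p hp
      obtain ⟨q, -, rfl⟩ := Finset.mem_map.1 hp
      exact q.2)).tsum_eq
    rw [this, Finset.prod_map]
    rfl
  simp_rw [h1]
  refine tendsto_tsum_of_dominated_convergence hf (fun I => ?_)
    (Eventually.of_forall fun S I => ?_)
  · by_cases hI : I = 0
    · subst hI
      have : ∀ S : Set (Ideal R), S.indicator f 0 = 0 := fun S => by
        rw [Set.indicator_apply, map_zero, ite_self]
      simp only [this, map_zero]
      exact tendsto_const_nhds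
    · have hfin : {p : {p : Ideal R // Prime p} | (p : Ideal R) ∣ I}.Finite := by
        have : Finite {J : Ideal R // J ∣ I} :=
          @Finite.of_fintype _ (UniqueFactorizationMonoid.fintypeSubtypeDvd I hI)
        rw [← Set.finite_coe_iff]
        exact Finite.of_injective (β := {J : Ideal R // J ∣ I}) (fun v => ⟨v.1.1, v.2⟩)
          fun v w h => Subtype.ext (Subtype.ext (by simpa using h))
      refine tendsto_const_nhds.congr' ?_
      filter_upwards [eventually_ge_atTop hfin.toFinset] with S hS
      rw [Set.indicator_of_mem]
      refine ⟨hI, fun p hp hd => Finset.mem_map.2 ⟨⟨p, hp⟩, hS (by simpa using hd), rfl⟩⟩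
  · rw [Set.indicator_apply]
    split_ifs <;> simp

end IdealEulerProduct

section ClassCharacterLSeries
open Filter Topology NumberField
open scoped Classical

variable {K : Type*} [Field K] [NumberField K]

/-- The completely multiplicative weight `I ↦ χ(I) N(I)^{-s}` of a quadratic class character. -/
def classCharWeight (χ : ClassGroup (𝓞 K) →* ℤˣ) (s : ℝ) : Ideal (𝓞 K) →*₀ ℝ where
  toFun I := if h : I = 0 then 0 else
    ((χ (ClassGroup.mk0 ⟨I, mem_nonZeroDivisors_of_ne_zero h⟩) : ℤ) : ℝ) *
      (Ideal.absNorm I : ℝ) ^ (-s)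
  map_zero' := by simp
  map_one' := by
    rw [dif_neg one_ne_zero]
    have : (⟨1, mem_nonZeroDivisors_of_ne_zero one_ne_zero⟩ : nonZeroDivisors (Ideal (𝓞 K))) = 1 :=
      rfl
    rw [this, map_one, map_one]
    simp
  map_mul' I J := by
    by_cases hI : I = 0
    · simp [hI]
    by_cases hJ : J = 0
    · simp [hJ]
    rw [dif_neg hI, dif_neg hJ, dif_neg (mul_ne_zero hI hJ)]
    have : (⟨I * J, mem_nonZeroDivisors_of_ne_zero (mul_ne_zero hI hJ)⟩ :
        nonZeroDivisors (Ideal (𝓞 K))) = ⟨I, mem_nonZeroDivisors_of_ne_zero hI⟩ *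
          ⟨J, mem_nonZeroDivisors_of_ne_zero hJ⟩ := rfl
    rw [this, map_mul, map_mul, map_mul, Units.val_mul]
    push_cast
    rw [Real.mul_rpow (by positivity) (by positivity)]
    ring

theorem classCharWeight_apply (χ : ClassGroup (𝓞 K) →* ℤˣ) (s : ℝ)
    (I : nonZeroDivisors (Ideal (𝓞 K))) :
    classCharWeight χ s I =
      ((χ (ClassGroup.mk0 I) : ℤ) : ℝ) * (Ideal.absNorm I.1 : ℝ) ^ (-s) := by
  have h : I.1 ≠ 0 := nonZeroDivisors.coe_ne_zero I
  change dite _ _ _ = _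
  rw [dif_neg h]

theorem abs_intUnit_cast (u : ℤˣ) : |((u : ℤ) : ℝ)| = 1 := by
  rcases Int.units_eq_one_or u with h | h <;> simp [h]

theorem abs_classCharWeight (χ : ClassGroup (𝓞 K) →* ℤˣ) (s : ℝ)
    (I : nonZeroDivisors (Ideal (𝓞 K))) :
    ‖classCharWeight χ s I‖ = (Ideal.absNorm I.1 : ℝ) ^ (-s) := by
  rw [classCharWeight_apply, Real.norm_eq_abs, abs_mul, abs_intUnit_cast, one_mul,
    abs_of_nonneg (by positivity)]

theorem one_le_absNorm (I : nonZeroDivisors (Ideal (𝓞 K))) : (1:ℝ) ≤ (Ideal.absNorm I.1 : ℝ) := by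
  have : Ideal.absNorm I.1 ≠ 0 := by
    rw [Ne, Ideal.absNorm_eq_zero_iff]
    exact nonZeroDivisors.coe_ne_zero I
  exact_mod_cast Nat.one_le_iff_ne_zero.2 this

theorem sum_mul_idealClassSum (χ : ClassGroup (𝓞 K) →* ℤˣ) {s : ℝ} (hs : 1 < s) (hs2 : s ≤ 2) :
    HasSum (fun I : nonZeroDivisors (Ideal (𝓞 K)) => classCharWeight χ s I)
      (∑ C, ((χ C : ℤ) : ℝ) * (idealClassSum C s).toReal) := by
  obtain ⟨g, hg⟩ := exists_idealClassSum_approx K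
  have h1 : ∀ C : ClassGroup (𝓞 K), HasSum
      (fun I : {I : nonZeroDivisors (Ideal (𝓞 K)) // ClassGroup.mk0 I = C} =>
        (Ideal.absNorm I.1.1 : ℝ) ^ (-s)) (idealClassSum C s).toReal := by
    intro C
    obtain ⟨B, hB⟩ := hg C
    have h2 := (hB s hs hs2).1
    unfold idealClassSum at h2 ⊢
    have h3 := ENNReal.hasSum_toReal h2
    rw [ENNReal.tsum_toReal_eq (fun _ => ENNReal.ofReal_ne_top)]
    convert h3 using 2 with I
    rw [ENNReal.toReal_ofReal (by positivity)]
  have h2 : ∀ C : ClassGroup (𝓞 K), HasSum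
      (fun I : {I : nonZeroDivisors (Ideal (𝓞 K)) // ClassGroup.mk0 I = C} =>
        classCharWeight χ s I.1) (((χ C : ℤ) : ℝ) * (idealClassSum C s).toReal) := by
    intro C
    have h3 := (h1 C).mul_left ((χ C : ℤ) : ℝ)
    simp_rw [classCharWeight_apply, fun I : {I : nonZeroDivisors (Ideal (𝓞 K)) //
      ClassGroup.mk0 I = C} => I.2]
    exact h3
  rw [← (Equiv.sigmaFiberEquiv (ClassGroup.mk0 (R := 𝓞 K))).hasSum_iff]
  have h3 : Summable (fun x : Σ C, {I : nonZeroDivisors (Ideal (𝓞 K)) // ClassGroup.mk0 I = C} =>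
      classCharWeight χ s x.2.1) := by
    rw [← summable_norm_iff, summable_sigma_of_nonneg (fun _ => norm_nonneg _)]
    exact ⟨fun C => (h2 C).summable.norm, Summable.of_finite⟩
  have h4 := h3.hasSum
  have h5 := h4.sigma h2
  have h6 := h5.unique (hasSum_fintype _)
  rw [← h6]
  exact h4

theorem hasSum_ideal_iff {f : Ideal (𝓞 K) → ℝ} (h0 : f 0 = 0) {a : ℝ} :
    HasSum (fun I : nonZeroDivisors (Ideal (𝓞 K)) => f I) a ↔ HasSum f a := by
  refine Function.Injective.hasSum_iff (f := f) Subtype.val_injective fun I hI => ?_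
  by_contra hne
  refine hI ⟨⟨I, mem_nonZeroDivisors_of_ne_zero ?_⟩, rfl⟩
  rintro rfl
  exact hne h0

theorem summable_classCharWeight (χ : ClassGroup (𝓞 K) →* ℤˣ) {s : ℝ} (hs : 1 < s) :
    Summable fun I => ‖classCharWeight χ s I‖ := by
  have h1 : Summable fun I : nonZeroDivisors (Ideal (𝓞 K)) => ‖classCharWeight χ s I‖ := by
    have hm : 1 < min s 2 := lt_min hs (by norm_num)
    refine Summable.of_nonneg_of_le (fun _ => norm_nonneg _) (fun I => ?_)
      (sum_mul_idealClassSum χ hm (min_le_right _ _)).summable.norm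
    rw [abs_classCharWeight, abs_classCharWeight]
    exact Real.rpow_le_rpow_of_exponent_le (one_le_absNorm I) (neg_le_neg (min_le_left _ _))
  obtain ⟨a, ha⟩ := h1
  exact ⟨a, (hasSum_ideal_iff (f := fun I => ‖classCharWeight χ s I‖)
    (by rw [map_zero, norm_zero])).1 ha⟩

/-- The `L`-series of a quadratic class character. -/
def classLSeries (χ : ClassGroup (𝓞 K) →* ℤˣ) (s : ℝ) : ℝ := ∑' I, classCharWeight χ s I

theorem exists_abs_classLSeries_le {χ : ClassGroup (𝓞 K) →* ℤˣ} (hχ : χ ≠ 1) :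
    ∃ B : ℝ, ∀ s : ℝ, 1 < s → s ≤ 2 → |classLSeries χ s| ≤ B := by
  obtain ⟨g, hg⟩ := exists_idealClassSum_approx K
  choose B hB using hg
  refine ⟨∑ C, B C, fun s hs hs2 => ?_⟩
  have h1 : classLSeries χ s = ∑ C, ((χ C : ℤ) : ℝ) * (idealClassSum C s).toReal :=
    ((hasSum_ideal_iff (map_zero _)).1 (sum_mul_idealClassSum χ hs hs2)).tsum_eq
  have h2 : ∑ C, ((χ C : ℤ) : ℝ) = 0 := by
    obtain ⟨D, hD⟩ : ∃ D, χ D ≠ 1 := by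
      by_contra! h
      exact hχ (MonoidHom.ext h)
    have hD' : χ D = -1 := (Int.units_eq_one_or _).resolve_left hD
    have h3 : ∑ C, ((χ C : ℤ) : ℝ) = ∑ C, ((χ (D * C) : ℤ) : ℝ) :=
      (Equiv.sum_comp (Equiv.mulLeft D) fun C => ((χ C : ℤ) : ℝ)).symm
    simp_rw [map_mul, hD'] at h3
    simp only [neg_mul, one_mul, Units.val_neg, Int.cast_neg, Finset.sum_neg_distrib] at h3
    linarith
  have h3 : classLSeries χ s = ∑ C, ((χ C : ℤ) : ℝ) * ((idealClassSum C s).toReal - g s) := by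
    simp_rw [mul_sub, Finset.sum_sub_distrib, ← Finset.sum_mul, h2, h1]
    ring
  rw [h3]
  refine (Finset.abs_sum_le_sum_abs _ _).trans (Finset.sum_le_sum fun C _ => ?_)
  rw [abs_mul, abs_intUnit_cast, one_mul]
  exact (hB C s hs hs2).2

theorem classLSeries_one_eq {s : ℝ} (hs : 1 < s) :
    ((classLSeries (1 : ClassGroup (𝓞 K) →* ℤˣ) s : ℝ) : ℂ) = dedekindZeta K s := by
  have h1 : Summable (classCharWeight (1 : ClassGroup (𝓞 K) →* ℤˣ) s) :=
    (summable_classCharWeight 1 hs).of_norm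
  have h2 := h1.hasSum
  rw [← (Equiv.sigmaFiberEquiv (Ideal.absNorm (S := 𝓞 K))).hasSum_iff] at h2
  have h3 : ∀ n : ℕ, HasSum (fun I : {I : Ideal (𝓞 K) // Ideal.absNorm I = n} =>
      classCharWeight (1 : ClassGroup (𝓞 K) →* ℤˣ) s I)
      (if n = 0 then 0 else (Nat.card {I : Ideal (𝓞 K) // Ideal.absNorm I = n} : ℝ) *
        (n : ℝ) ^ (-s)) := by
    intro n
    split_ifs with hn
    · convert hasSum_zero with I
      have h0 : I.1 = 0 := by
        rw [Ideal.zero_eq_bot, ← Ideal.absNorm_eq_zero_iff, I.2, hn]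
      rw [h0, map_zero]
    · have : Finite {I : Ideal (𝓞 K) // Ideal.absNorm I = n} :=
        Ideal.finite_setOfPred_absNorm_eq n
      have := Fintype.ofFinite {I : Ideal (𝓞 K) // Ideal.absNorm I = n}
      have h4 : ∀ I : {I : Ideal (𝓞 K) // Ideal.absNorm I = n},
          classCharWeight (1 : ClassGroup (𝓞 K) →* ℤˣ) s I = (n : ℝ) ^ (-s) := by
        intro I
        have hI : I.1 ≠ 0 := by
          rw [Ne, Ideal.zero_eq_bot, ← Ideal.absNorm_eq_zero_iff, I.2]; exact hn
        have := classCharWeight_apply (1 : ClassGroup (𝓞 K) →* ℤˣ) s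
          ⟨I.1, mem_nonZeroDivisors_of_ne_zero hI⟩
        simpa [I.2] using this
      simp_rw [h4]
      convert hasSum_fintype (fun _ : {I : Ideal (𝓞 K) // Ideal.absNorm I = n} =>
        (n : ℝ) ^ (-s))
      simp
  have h4 := h2.sigma h3
  have h5 := h4.mapL Complex.ofRealCLM
  simp only [Complex.ofRealCLM_apply] at h5
  rw [classLSeries, ← h5.tsum_eq, dedekindZeta, LSeries]
  congr 1
  ext n
  rw [LSeries.term_def]
  split_ifs with hn
  · simp
  · rw [Complex.ofReal_mul, Complex.ofReal_cpow (by positivity), div_eq_mul_inv,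
      Complex.ofReal_neg, Complex.cpow_neg]
    simp

theorem tendsto_sub_one_mul_classLSeries_one :
    Tendsto (fun s : ℝ => (s - 1) * classLSeries (1 : ClassGroup (𝓞 K) →* ℤˣ) s) (𝓝[>] 1)
      (𝓝 (dedekindZeta_residue K)) := by
  have h := tendsto_sub_one_mul_dedekindZeta_nhdsGT (K := K)
  have h2 := (Complex.continuous_re.tendsto _).comp h
  rw [Complex.ofReal_re] at h2
  refine h2.congr' ?_
  filter_upwards [self_mem_nhdsWithin] with s hs
  rw [Function.comp_apply, ← classLSeries_one_eq hs, ← Complex.ofReal_one, ← Complex.ofReal_sub,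
    ← Complex.ofReal_mul, Complex.ofReal_re]

end ClassCharacterLSeries

section SecondInequality
open Filter Topology NumberField
open scoped Classical

variable {L E : Type*} [Field L] [NumberField L] [Field E] [NumberField E] [Algebra L E]

theorem finrank_ringOfIntegers : Module.finrank (𝓞 L) (𝓞 E) = Module.finrank L E :=
  (IsFractionRing.finrank_eq (𝓞 L) L (𝓞 E) E).symm

theorem exists_relNorm_eq_pow_sum_le (h2 : Module.finrank L E = 2) {p : Ideal (𝓞 L)}
    (hp : Prime p) (T : Finset (Ideal (𝓞 E))) (hT : ∀ P ∈ T, Prime P ∧ P.under (𝓞 L) = p) :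
    ∃ e : Ideal (𝓞 E) → ℕ, (∀ P ∈ T, 1 ≤ e P ∧ Ideal.relNorm (𝓞 L) P = p ^ e P) ∧
      ∑ P ∈ T, e P ≤ 2 := by
  have hpp : p.IsPrime := Ideal.isPrime_of_prime hp
  have hptop : p ≠ ⊤ := hpp.ne_top
  have h1 : ∀ P ∈ T, ∃ e, 1 ≤ e ∧ Ideal.relNorm (𝓞 L) P = p ^ e := by
    intro P hP
    obtain ⟨hP1, hP2⟩ := hT P hP
    have : P.LiesOver p := ⟨hP2.symm⟩
    have : P.IsPrime := Ideal.isPrime_of_prime hP1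
    obtain ⟨e, he⟩ := Ideal.exists_relNorm_eq_pow_of_isPrime P p
    refine ⟨e, Nat.one_le_iff_ne_zero.2 ?_, he⟩
    rintro rfl
    have h3 := Ideal.relNorm_le_comap (𝓞 L) P
    rw [he, pow_zero, Ideal.one_eq_top, top_le_iff] at h3
    exact hptop (hP2 ▸ h3)
  choose! e he using h1
  refine ⟨e, he, ?_⟩
  have h3 : ∏ P ∈ T, P ∣ p.map (algebraMap (𝓞 L) (𝓞 E)) := by
    refine Finset.prod_dvd_of_coprime ?_ ?_
    · intro P hP Q hQ hne
      have hPm : P.IsMaximal := (Ideal.isPrime_of_prime (hT P hP).1).isMaximal (hT P hP).1.ne_zero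
      have hQm : Q.IsMaximal := (Ideal.isPrime_of_prime (hT Q hQ).1).isMaximal (hT Q hQ).1.ne_zero
      exact (Ideal.isCoprime_iff_sup_eq.2 (hPm.coprime_of_ne hQm hne))
    · intro P hP
      rw [Ideal.dvd_iff_le, Ideal.map_le_iff_le_comap]
      exact (hT P hP).2.ge
  have h4 := map_dvd (Ideal.relNorm (𝓞 L)) h3
  rw [Ideal.relNorm_algebraMap, finrank_ringOfIntegers, h2, map_prod,
    Finset.prod_congr rfl fun P hP => (he P hP).2, Finset.prod_pow_eq_pow_sum] at h4
  exact (pow_dvd_pow_iff hp.ne_zero hp.not_isUnit).1 h4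

theorem one_le_prod_inv_of_sq_eq_one {x a b : ℝ} (hx : 0 ≤ x) (hx1 : x < 1) (ha : a = 1 ∨ a = -1)
    (hb : b = 1 ∨ b = -1) :
    1 ≤ (1 - x)⁻¹ * (1 - a * x)⁻¹ * (1 - b * x)⁻¹ * (1 - a * b * x)⁻¹ := by
  have h1 : 0 < 1 - x := by linarith
  have h2 : 0 < 1 + x := by linarith
  rw [← mul_inv, ← mul_inv, ← mul_inv]
  have e1 : 0 < (1 - x) ^ 4 ∧ (1 - x) ^ 4 ≤ 1 :=
    ⟨by positivity, pow_le_one₀ h1.le (by linarith)⟩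
  have e2 : 0 < (1 - x ^ 2) ^ 2 ∧ (1 - x ^ 2) ^ 2 ≤ 1 := by
    have : 0 < 1 - x ^ 2 := by nlinarith
    exact ⟨by positivity, pow_le_one₀ this.le (by nlinarith)⟩
  have key : (1 - x) * (1 - a * x) * (1 - b * x) * (1 - a * b * x) = (1 - x) ^ 4 ∨
      (1 - x) * (1 - a * x) * (1 - b * x) * (1 - a * b * x) = (1 - x ^ 2) ^ 2 := by
    rcases ha with rfl | rfl <;> rcases hb with rfl | rfl
    · left; ring
    all_goals right; ring
  rcases key with h | h <;> rw [h]
  · exact (one_le_inv₀ e1.1).2 e1.2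
  · exact (one_le_inv₀ e2.1).2 e2.2

theorem sq_prod_le_of_sum_le_two {ι : Type*} (T : Finset ι) (e : ι → ℕ) (he : ∀ i ∈ T, 1 ≤ e i)
    (hsum : ∑ i ∈ T, e i ≤ 2) {x a b : ℝ} (hx : 0 ≤ x) (hx1 : x < 1) (ha : a = 1 ∨ a = -1)
    (hb : b = 1 ∨ b = -1) (h1 : ∀ i ∈ T, e i = 1 → a = 1 ∧ b = 1) :
    (∏ i ∈ T, (1 - x ^ e i)⁻¹) ^ 2 ≤
      ((1 - x)⁻¹ * (1 - a * x)⁻¹ * (1 - b * x)⁻¹ * (1 - a * b * x)⁻¹) * ((1 - x ^ 2)⁻¹) ^ 2 := by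
  have hx' : 0 < 1 - x := by linarith
  have hx2 : x ^ 2 < 1 := by nlinarith
  have hx2' : 0 < 1 - x ^ 2 := by linarith
  have hi2 : 1 ≤ (1 - x ^ 2)⁻¹ := (one_le_inv₀ hx2').2 (by nlinarith)
  have hi1 : 1 ≤ (1 - x)⁻¹ := (one_le_inv₀ hx').2 (by linarith)
  by_cases hsp : ∃ i ∈ T, e i = 1
  · obtain ⟨i, hi, hei⟩ := hsp
    obtain ⟨rfl, rfl⟩ := h1 i hi hei
    have hcard : T.card ≤ 2 := by
      refine le_trans ?_ hsum
      have := Finset.card_nsmul_le_sum T e 1 he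
      simpa using this
    have hle : ∏ i ∈ T, (1 - x ^ e i)⁻¹ ≤ ((1 - x)⁻¹) ^ 2 := by
      calc ∏ i ∈ T, (1 - x ^ e i)⁻¹ ≤ ∏ _i ∈ T, (1 - x)⁻¹ := by
            refine Finset.prod_le_prod (fun i hi => ?_) fun i hi => ?_
            · have : x ^ e i ≤ 1 := pow_le_one₀ hx hx1.le
              exact inv_nonneg.2 (by linarith)
            · have : x ^ e i ≤ x := pow_le_of_le_one hx hx1.le (by have := he i hi; omega)
              exact inv_anti₀ hx' (by linarith)
        _ = ((1 - x)⁻¹) ^ T.card := by simp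
        _ ≤ _ := pow_le_pow_right₀ hi1 hcard
    have h0 : 0 ≤ ∏ i ∈ T, (1 - x ^ e i)⁻¹ := Finset.prod_nonneg fun i hi => by
      have : x ^ e i ≤ 1 := pow_le_one₀ hx hx1.le
      exact inv_nonneg.2 (by linarith)
    calc (∏ i ∈ T, (1 - x ^ e i)⁻¹) ^ 2 ≤ (((1 - x)⁻¹) ^ 2) ^ 2 := by gcongr
      _ = ((1 - x)⁻¹ * (1 - 1 * x)⁻¹ * (1 - 1 * x)⁻¹ * (1 - 1 * 1 * x)⁻¹) * 1 := by ring
      _ ≤ _ := by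
        gcongr
        · simp only [one_mul]; positivity
        · exact one_le_pow₀ hi2
  · push Not at hsp
    have h2 : ∀ i ∈ T, 2 ≤ e i := fun i hi => by
      have := he i hi; have := hsp i hi; omega
    have hcard : T.card ≤ 1 := by
      have := Finset.card_nsmul_le_sum T e 2 h2
      have := this.trans hsum
      simp only [smul_eq_mul] at this
      omega
    have h0 : 0 ≤ ∏ i ∈ T, (1 - x ^ e i)⁻¹ := Finset.prod_nonneg fun i hi => by
      have : x ^ e i ≤ 1 := pow_le_one₀ hx hx1.le
      exact inv_nonneg.2 (by linarith)
    have hle : ∏ i ∈ T, (1 - x ^ e i)⁻¹ ≤ (1 - x ^ 2)⁻¹ := by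
      calc ∏ i ∈ T, (1 - x ^ e i)⁻¹ ≤ ∏ _i ∈ T, (1 - x ^ 2)⁻¹ := by
            refine Finset.prod_le_prod (fun i hi => ?_) fun i hi => ?_
            · have : x ^ e i ≤ 1 := pow_le_one₀ hx hx1.le
              exact inv_nonneg.2 (by linarith)
            · have : x ^ e i ≤ x ^ 2 := pow_le_pow_of_le_one hx hx1.le (h2 i hi)
              exact inv_anti₀ hx2' (by linarith)
        _ = ((1 - x ^ 2)⁻¹) ^ T.card := by simp
        _ ≤ ((1 - x ^ 2)⁻¹) ^ 1 := pow_le_pow_right₀ hi2 hcard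
        _ = _ := pow_one _
    calc (∏ i ∈ T, (1 - x ^ e i)⁻¹) ^ 2 ≤ 1 * ((1 - x ^ 2)⁻¹) ^ 2 := by rw [one_mul]; gcongr
      _ ≤ _ := by
        gcongr
        exact one_le_prod_inv_of_sq_eq_one hx hx1 ha hb


theorem absNorm_relNorm_ringOfIntegers (I : Ideal (𝓞 E)) :
    Ideal.absNorm (Ideal.relNorm (𝓞 L) I) = Ideal.absNorm I :=
  Ideal.absNorm_relNorm (𝓞 L) (𝓞 E) I

theorem classCharWeight_prime (χ : ClassGroup (𝓞 L) →* ℤˣ) (s : ℝ) {p : Ideal (𝓞 L)}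
    (hp : Prime p) : classCharWeight χ s p =
      ((χ (ClassGroup.mk0 ⟨p, mem_nonZeroDivisors_of_ne_zero hp.ne_zero⟩) : ℤ) : ℝ) *
        (Ideal.absNorm p : ℝ) ^ (-s) :=
  classCharWeight_apply χ s ⟨p, mem_nonZeroDivisors_of_ne_zero hp.ne_zero⟩

theorem intUnit_cast_eq (u : ℤˣ) : ((u : ℤ) : ℝ) = 1 ∨ ((u : ℤ) : ℝ) = -1 := by
  rcases Int.units_eq_one_or u with h | h <;> simp [h]

theorem classLSeries_sq_le (h2 : Module.finrank L E = 2) (χ ψ : ClassGroup (𝓞 L) →* ℤˣ)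
    (hχ : ∀ (I : nonZeroDivisors (Ideal (𝓞 E))) (J : nonZeroDivisors (Ideal (𝓞 L))),
      Ideal.relNorm (𝓞 L) I.1 = J.1 →
      χ (ClassGroup.mk0 J) = 1)
    (hψ : ∀ (I : nonZeroDivisors (Ideal (𝓞 E))) (J : nonZeroDivisors (Ideal (𝓞 L))),
      Ideal.relNorm (𝓞 L) I.1 = J.1 →
      ψ (ClassGroup.mk0 J) = 1) {s : ℝ} (hs : 1 < s) :
    (classLSeries (1 : ClassGroup (𝓞 E) →* ℤˣ) s) ^ 2 ≤
      (classLSeries (1 : ClassGroup (𝓞 L) →* ℤˣ) s * classLSeries χ s * classLSeries ψ s *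
        classLSeries (χ * ψ) s) * (classLSeries (1 : ClassGroup (𝓞 L) →* ℤˣ) (2 * s)) ^ 2 := by
  have hs' : 1 < 2 * s := by linarith
  have tE := tendsto_eulerProduct_ideal
    (summable_classCharWeight (1 : ClassGroup (𝓞 E) →* ℤˣ) hs)
  have t1 := tendsto_eulerProduct_ideal
    (summable_classCharWeight (1 : ClassGroup (𝓞 L) →* ℤˣ) hs)
  have tχ := tendsto_eulerProduct_ideal (summable_classCharWeight χ hs)
  have tψ := tendsto_eulerProduct_ideal (summable_classCharWeight ψ hs)
  have tχψ := tendsto_eulerProduct_ideal (summable_classCharWeight (χ * ψ) hs)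
  have t2 := tendsto_eulerProduct_ideal
    (summable_classCharWeight (1 : ClassGroup (𝓞 L) →* ℤˣ) hs')
  refine le_of_tendsto (tE.pow 2) (Eventually.of_forall fun T => ?_)
  have tR := (((t1.mul tχ).mul tψ).mul tχψ).mul (t2.pow 2)
  let u : {P : Ideal (𝓞 E) // Prime P} → {p : Ideal (𝓞 L) // Prime p} := fun P =>
    ⟨P.1.under (𝓞 L), by
      have hP : P.1.IsPrime := Ideal.isPrime_of_prime P.2
      exact Ideal.prime_of_isPrime (Ideal.under_ne_bot (𝓞 L) P.2.ne_zero) inferInstance⟩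
  refine ge_of_tendsto tR ?_
  filter_upwards [eventually_ge_atTop (T.image u)] with S hS
  have hmaps : ∀ P ∈ T, u P ∈ S := fun P hP => hS (Finset.mem_image_of_mem u hP)
  rw [← Finset.prod_fiberwise_of_maps_to hmaps, ← Finset.prod_pow, ← Finset.prod_pow,
    ← Finset.prod_mul_distrib, ← Finset.prod_mul_distrib, ← Finset.prod_mul_distrib,
    ← Finset.prod_mul_distrib]
  refine Finset.prod_le_prod (fun _ _ => sq_nonneg _) fun p _ => ?_
  set x : ℝ := (Ideal.absNorm p.1 : ℝ) ^ (-s) with hx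
  have hx0 : 0 ≤ x := by positivity
  have hw1 : classCharWeight (1 : ClassGroup (𝓞 L) →* ℤˣ) s p = x := by
    rw [classCharWeight_prime _ _ p.2]; simp [hx]
  have hx1 : x < 1 := by
    have := abs_lt_one_of_summable
      (summable_classCharWeight (1 : ClassGroup (𝓞 L) →* ℤˣ) hs) p.2
    rw [hw1] at this
    exact (abs_lt.1 this).2
  have hw2 : classCharWeight (1 : ClassGroup (𝓞 L) →* ℤˣ) (2 * s) p = x ^ 2 := by
    rw [classCharWeight_prime _ _ p.2, hx, ← Real.rpow_natCast, ← Real.rpow_mul (by positivity)]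
    simp [mul_comm]
  set T' := {P ∈ T | u P = p} with hT'
  obtain ⟨e, he, hsum⟩ := exists_relNorm_eq_pow_sum_le h2 p.2
    (T'.map (Function.Embedding.subtype _)) (by
      intro P hP
      obtain ⟨Q, hQ, rfl⟩ := Finset.mem_map.1 hP
      exact ⟨Q.2, congrArg Subtype.val (Finset.mem_filter.1 hQ).2⟩)
  rw [Finset.sum_map] at hsum
  have he' : ∀ P ∈ T', 1 ≤ e P.1 ∧ Ideal.relNorm (𝓞 L) P.1 = p.1 ^ e P.1 := fun P hP =>
    he P.1 (Finset.mem_map_of_mem _ hP)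
  have hwE : ∀ P ∈ T', classCharWeight (1 : ClassGroup (𝓞 E) →* ℤˣ) s P = x ^ e P.1 := by
    intro P hP
    rw [classCharWeight_prime _ _ P.2, ← absNorm_relNorm_ringOfIntegers (L := L), (he' P hP).2,
      map_pow, Nat.cast_pow, hx, ← Real.rpow_natCast, ← Real.rpow_natCast, ← Real.rpow_mul
      (by positivity), ← Real.rpow_mul (by positivity), mul_comm (-s)]
    simp
  rw [Finset.prod_congr rfl fun P hP => by rw [hwE P hP], hw1, hw2, classCharWeight_prime _ _ p.2,
    classCharWeight_prime _ _ p.2, classCharWeight_prime _ _ p.2, ← hx, MonoidHom.mul_apply,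
    Units.val_mul, Int.cast_mul]
  refine sq_prod_le_of_sum_le_two T' (fun P => e P.1) (fun P hP => (he' P hP).1) hsum hx0 hx1
    (intUnit_cast_eq _) (intUnit_cast_eq _) fun P hP h1 => ?_
  have h3 := (he' P hP).2
  rw [h1, pow_one] at h3
  rw [hχ ⟨P.1, mem_nonZeroDivisors_of_ne_zero P.2.ne_zero⟩ _ h3,
    hψ ⟨P.1, mem_nonZeroDivisors_of_ne_zero P.2.ne_zero⟩ _ h3]
  simp

theorem classLSeries_one_le {s : ℝ} (hs : 2 ≤ s) :
    0 ≤ classLSeries (1 : ClassGroup (𝓞 L) →* ℤˣ) s ∧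
    classLSeries (1 : ClassGroup (𝓞 L) →* ℤˣ) s ≤
      classLSeries (1 : ClassGroup (𝓞 L) →* ℤˣ) 2 := by
  have h0 : ∀ t : ℝ, ∀ I, 0 ≤ classCharWeight (1 : ClassGroup (𝓞 L) →* ℤˣ) t I := by
    intro t I
    by_cases hI : I = 0
    · rw [hI, map_zero]
    · have := classCharWeight_apply (1 : ClassGroup (𝓞 L) →* ℤˣ) t
        ⟨I, mem_nonZeroDivisors_of_ne_zero hI⟩
      rw [this]
      simp only [MonoidHom.one_apply, Units.val_one, Int.cast_one, one_mul]
      positivity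
  refine ⟨tsum_nonneg (h0 s), ?_⟩
  refine Summable.tsum_le_tsum (fun I => ?_)
    (summable_classCharWeight (1 : ClassGroup (𝓞 L) →* ℤˣ) (by linarith)).of_norm
    (summable_classCharWeight (1 : ClassGroup (𝓞 L) →* ℤˣ) (by norm_num)).of_norm
  by_cases hI : I = 0
  · rw [hI, map_zero, map_zero]
  · have := fun t => classCharWeight_apply (1 : ClassGroup (𝓞 L) →* ℤˣ) t
        ⟨I, mem_nonZeroDivisors_of_ne_zero hI⟩
    rw [this, this]
    simp only [MonoidHom.one_apply, Units.val_one, Int.cast_one, one_mul]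
    exact Real.rpow_le_rpow_of_exponent_le
      (one_le_absNorm ⟨I, mem_nonZeroDivisors_of_ne_zero hI⟩) (by linarith)

/-- At most one nontrivial quadratic class character of `L` is trivial on the norms of ideals
of a quadratic extension. -/
theorem eq_one_or_eq_one_or_eq_of_trivial_on_norms (h2 : Module.finrank L E = 2)
    (χ ψ : ClassGroup (𝓞 L) →* ℤˣ)
    (hχ : ∀ (I : nonZeroDivisors (Ideal (𝓞 E))) (J : nonZeroDivisors (Ideal (𝓞 L))),
      Ideal.relNorm (𝓞 L) I.1 = J.1 →
      χ (ClassGroup.mk0 J) = 1)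
    (hψ : ∀ (I : nonZeroDivisors (Ideal (𝓞 E))) (J : nonZeroDivisors (Ideal (𝓞 L))),
      Ideal.relNorm (𝓞 L) I.1 = J.1 →
      ψ (ClassGroup.mk0 J) = 1) : χ = 1 ∨ ψ = 1 ∨ χ * ψ = 1 := by
  by_contra! h
  obtain ⟨h1, h2', h3⟩ := h
  obtain ⟨B₁, hB₁⟩ := exists_abs_classLSeries_le h1
  obtain ⟨B₂, hB₂⟩ := exists_abs_classLSeries_le h2'
  obtain ⟨B₃, hB₃⟩ := exists_abs_classLSeries_le h3
  have tE := (tendsto_sub_one_mul_classLSeries_one (K := E)).pow 2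
  have tL := tendsto_sub_one_mul_classLSeries_one (K := L)
  set Z := classLSeries (1 : ClassGroup (𝓞 L) →* ℤˣ) 2
  have hlin : Tendsto (fun s : ℝ => s - 1) (𝓝[>] 1) (𝓝 0) := by
    have : Tendsto (fun s : ℝ => s - 1) (𝓝 1) (𝓝 (1 - 1)) := tendsto_id.sub_const 1
    rw [sub_self] at this
    exact this.mono_left nhdsWithin_le_nhds
  have tR := ((hlin.mul tL.abs).mul_const (B₁ * B₂ * B₃ * Z ^ 2))
  rw [zero_mul, zero_mul] at tR
  have hle := le_of_tendsto_of_tendsto tE tR (by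
    filter_upwards [Ioc_mem_nhdsGT (show (1:ℝ) < 2 by norm_num)] with s hs
    have hs1 := hs.1
    have hmain := classLSeries_sq_le h2 χ ψ hχ hψ hs1
    have hz := classLSeries_one_le (L := L) (s := 2 * s) (by linarith)
    have b1 := hB₁ s hs1 hs.2
    have b2 := hB₂ s hs1 hs.2
    have b3 := hB₃ s hs1 hs.2
    have n1 := (abs_nonneg _).trans b1
    have n2 := (abs_nonneg _).trans b2
    have n3 := (abs_nonneg _).trans b3
    have hs0 : 0 < s - 1 := by linarith
    calc ((s - 1) * classLSeries (1 : ClassGroup (𝓞 E) →* ℤˣ) s) ^ 2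
        = (s - 1) ^ 2 * (classLSeries (1 : ClassGroup (𝓞 E) →* ℤˣ) s) ^ 2 := by ring
      _ ≤ (s - 1) ^ 2 * |(classLSeries (1 : ClassGroup (𝓞 L) →* ℤˣ) s * classLSeries χ s *
          classLSeries ψ s * classLSeries (χ * ψ) s) *
          (classLSeries (1 : ClassGroup (𝓞 L) →* ℤˣ) (2 * s)) ^ 2| := by
        gcongr
        exact hmain.trans (le_abs_self _)
      _ = (s - 1) * |(s - 1) * classLSeries (1 : ClassGroup (𝓞 L) →* ℤˣ) s| *
          (|classLSeries χ s| * |classLSeries ψ s| * |classLSeries (χ * ψ) s| *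
            (classLSeries (1 : ClassGroup (𝓞 L) →* ℤˣ) (2 * s)) ^ 2) := by
        simp only [abs_mul, abs_pow, abs_of_pos hs0, abs_of_nonneg hz.1]
        ring
      _ ≤ _ := by
        gcongr
        · exact hz.1
        · exact hz.2)
  have := dedekindZeta_residue_pos E
  have : 0 < dedekindZeta_residue E ^ 2 := by positivity
  linarith

end SecondInequality

section UnitSquareIndex
open NumberField NumberField.Units

/-- The subgroup of squares. -/
abbrev squares (G : Type*) [CommGroup G] : Subgroup G := (powMonoidHom 2 : G →* G).range

theorem mem_squares {G : Type*} [CommGroup G] {g : G} : g ∈ squares G ↔ ∃ h, h ^ 2 = g := Iff.rfl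

theorem index_squares_eq {G H : Type*} [CommGroup G] [CommGroup H] (e : G ≃* H) :
    (squares G).index = (squares H).index := by
  have : squares G = (squares H).comap e.toMonoidHom := by
    ext g
    simp only [mem_squares, Subgroup.mem_comap]
    constructor
    · rintro ⟨h, rfl⟩; exact ⟨e h, by simp⟩
    · rintro ⟨h, hh⟩
      exact ⟨e.symm h, e.injective (by simpa using hh)⟩
  rw [this, Subgroup.index_comap_of_surjective _ e.surjective]

theorem index_squares_prod_int {T : Type*} [CommGroup T] [Finite T] [IsCyclic T]
    (hT : Even (Nat.card T)) (r : ℕ) :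
    (squares (T × Multiplicative (Fin r → ℤ))).index = 2 ^ (r + 1) := by
  let f : T →* T ⧸ squares T := QuotientGroup.mk' _
  let g : Multiplicative (Fin r → ℤ) →* Multiplicative (Fin r → ZMod 2) :=
    AddMonoidHom.toMultiplicative (AddMonoidHom.pi fun i =>
      (Int.castAddHom (ZMod 2)).comp (Pi.evalAddMonoidHom _ i))
  have hg : ∀ x i, (g x).toAdd i = ((x.toAdd i : ℤ) : ZMod 2) := fun x i => rfl
  have hgs : Function.Surjective g := by
    intro y
    choose z hz using fun i => ZMod.intCast_surjective (y.toAdd i)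
    exact ⟨Multiplicative.ofAdd z, Multiplicative.toAdd.injective (funext hz)⟩
  have hfs : Function.Surjective f := QuotientGroup.mk'_surjective _
  have hker : squares (T × Multiplicative (Fin r → ℤ)) = (f.prodMap g).ker := by
    ext ⟨t, x⟩
    rw [mem_squares, MonoidHom.mem_ker, MonoidHom.prodMap_def]
    constructor
    · rintro ⟨⟨t', x'⟩, h⟩
      rw [← h]
      refine Prod.ext ?_ ?_
      · exact (QuotientGroup.eq_one_iff _).2 ⟨t', rfl⟩
      · refine Multiplicative.toAdd.injective (funext fun i => ?_)
        change (g (x' ^ 2)).toAdd i = 0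
        rw [hg]
        simp only [toAdd_pow, Pi.smul_apply, nsmul_eq_mul]
        push_cast
        have : (2 : ZMod 2) = 0 := rfl
        rw [this, zero_mul]
    · intro h
      obtain ⟨h1, h2⟩ := Prod.ext_iff.1 h
      obtain ⟨t', ht'⟩ := (QuotientGroup.eq_one_iff _).1 (show f t = 1 from h1)
      have h3 : ∀ i, ∃ k : ℤ, 2 * k = x.toAdd i := by
        intro i
        have h4 : (g x).toAdd i = 0 := by
          have : g x = 1 := h2
          rw [this]; rfl
        rw [hg, ZMod.intCast_zmod_eq_zero_iff_dvd] at h4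
        obtain ⟨k, hk⟩ := h4
        exact ⟨k, hk.symm⟩
      choose k hk using h3
      refine ⟨⟨t', Multiplicative.ofAdd k⟩, Prod.ext ht' (Multiplicative.toAdd.injective
        (funext fun i => ?_))⟩
      rw [← hk i]
      simp [toAdd_pow, two_mul]
  rw [hker, Subgroup.index_ker, MonoidHom.range_eq_top.2 (Prod.map_surjective.2 ⟨hfs, hgs⟩ :
    Function.Surjective (f.prodMap g))]
  have h1 : Nat.card (T ⧸ squares T) = 2 := by
    change (squares T).index = 2
    rw [IsCyclic.index_powMonoidHom_range, Nat.gcd_eq_right hT.two_dvd]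
  have h2 : Nat.card (Multiplicative (Fin r → ZMod 2)) = 2 ^ r := by
    change Nat.card (Fin r → ZMod 2) = _
    simp
  rw [Subgroup.card_top, Nat.card_prod, h1, h2, pow_succ, mul_comm]

theorem index_squares_units (K : Type*) [Field K] [NumberField K] :
    (squares (𝓞 K)ˣ).index = 2 ^ (rank K + 1) := by
  let F : torsion K × Multiplicative (Fin (rank K) → ℤ) →* (𝓞 K)ˣ :=
    { toFun := fun x => x.1 * ∏ i, (fundSystem K i) ^ (x.2.toAdd i)
      map_one' := by simp
      map_mul' := fun x y => by
        simp only [Prod.fst_mul, Prod.snd_mul, toAdd_mul, Pi.add_apply, zpow_add,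
          Finset.prod_mul_distrib, Subgroup.coe_mul]
        exact mul_mul_mul_comm _ _ _ _ }
  have hF : Function.Bijective F := by
    rw [Function.bijective_iff_existsUnique]
    intro x
    obtain ⟨y, hy, hu⟩ := exist_unique_eq_mul_prod K x
    exact ⟨(y.1, Multiplicative.ofAdd y.2), hy.symm, fun z hz => hu (z.1, z.2.toAdd) hz.symm⟩
  rw [← index_squares_eq (MulEquiv.ofBijective F hF), index_squares_prod_int]
  exact even_torsionOrder K

end UnitSquareIndex

section QuadraticCharacters

theorem exists_quadraticChar_ne_one {Q : Type*} [CommGroup Q] [Finite Q] (hQ : ∀ q : Q, q ^ 2 = 1)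
    {q : Q} (hq : q ≠ 1) : ∃ χ : Q →* ℤˣ, χ q ≠ 1 := by
  have hexp : Monoid.exponent Q = 2 := by
    have h1 : Monoid.exponent Q ∣ 2 := Monoid.exponent_dvd_of_forall_pow_eq_one hQ
    rcases (Nat.dvd_prime Nat.prime_two).1 h1 with h | h
    · have := Monoid.pow_exponent_eq_one q
      rw [h, pow_one] at this
      exact absurd this hq
    · exact h
  have : HasEnoughRootsOfUnity ℤ (Monoid.exponent Q) := by
    rw [hexp]
    refine ⟨⟨-1, ?_⟩, inferInstance⟩
    exact IsPrimitiveRoot.neg_one 0 (by norm_num)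
  exact CommGroup.exists_apply_ne_one_of_hasEnoughRootsOfUnity Q ℤ hq

theorem exists_two_quadraticChar {Q : Type*} [CommGroup Q] [Finite Q] (hQ : ∀ q : Q, q ^ 2 = 1)
    (hcard : 2 < Nat.card Q) : ∃ χ ψ : Q →* ℤˣ, χ ≠ 1 ∧ ψ ≠ 1 ∧ χ * ψ ≠ 1 := by
  have : Nontrivial Q := by
    rw [← Finite.one_lt_card_iff_nontrivial]; omega
  obtain ⟨q, hq⟩ := exists_ne (1 : Q)
  obtain ⟨χ, hχ⟩ := exists_quadraticChar_ne_one hQ hq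
  have h1 : χ.ker ≠ ⊥ := by
    intro h
    have hinj := (MonoidHom.ker_eq_bot_iff χ).1 h
    have := Nat.card_le_card_of_injective χ hinj
    have h2 : Nat.card ℤˣ = 2 := by simp
    omega
  obtain ⟨⟨a, ha⟩, ha1⟩ := Subgroup.ne_bot_iff_exists_ne_one.1 h1
  replace ha1 : a ≠ 1 := fun h => ha1 (Subtype.ext h)
  obtain ⟨ψ, hψ⟩ := exists_quadraticChar_ne_one hQ ha1
  refine ⟨χ, ψ, fun h => hχ (by simp [h]), fun h => hψ (by simp [h]), fun h => hψ ?_⟩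
  have := DFunLike.congr_fun h a
  rwa [MonoidHom.mul_apply, MonoidHom.mem_ker.1 ha, one_mul] at this

end QuadraticCharacters

section InvolutionIndex

/-- The norm `u * τ u` attached to an endomorphism `τ` of a commutative group. -/
def involNorm {G : Type*} [CommGroup G] (τ : G →* G) : G →* G := MonoidHom.id G * τ

/-- The map `u ↦ τ u / u`. -/
def involTwist {G : Type*} [CommGroup G] (τ : G →* G) : G →* G := τ / MonoidHom.id G

theorem involNorm_apply {G : Type*} [CommGroup G] (τ : G →* G) (u : G) :
    involNorm τ u = u * τ u := rfl

theorem involTwist_apply {G : Type*} [CommGroup G] (τ : G →* G) (u : G) :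
    involTwist τ u = τ u / u := rfl

theorem involTwist_range_le {G : Type*} [CommGroup G] {τ : G →* G} (hτ : ∀ u, τ (τ u) = u) :
    (involTwist τ).range ≤ (involNorm τ).ker := by
  rintro _ ⟨u, rfl⟩
  rw [MonoidHom.mem_ker, involNorm_apply, involTwist_apply, _root_.map_div, hτ]
  simp

theorem involNorm_range_le {G : Type*} [CommGroup G] {τ : G →* G} (hτ : ∀ u, τ (τ u) = u) :
    (involNorm τ).range ≤ (involTwist τ).ker := by
  rintro _ ⟨u, rfl⟩
  rw [MonoidHom.mem_ker, involNorm_apply, involTwist_apply, map_mul, hτ, mul_comm, div_self']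

/-- The Herbrand quotient inequality for the units of a quadratic extension in which a square
root of `1` is not the norm of a unit. -/
theorem two_mul_relIndex_le {G : Type*} [CommGroup G] {τ : G →* G} (hτ : ∀ u, τ (τ u) = u)
    {m : G} (hm : ∀ u : G, u ^ 2 = 1 ↔ u = 1 ∨ u = m) (hmτ : τ m = m)
    (hmN : m ∉ (involNorm τ).range) {n : ℕ} (hG : (squares G).index = 2 ^ (2 * n))
    (hH : (squares (involTwist τ).ker).index = 2 ^ n)
    (hD : (involTwist τ).range.relIndex (involNorm τ).ker ≠ 0) :
    2 * (involNorm τ).range.relIndex (involTwist τ).ker ≤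
      (involTwist τ).range.relIndex (involNorm τ).ker := by
  set H := (involTwist τ).ker with hHdef
  set V := (involNorm τ).ker with hVdef
  set W := (involNorm τ).range with hWdef
  set D := (involTwist τ).range with hDdef
  let sq : G →* G := powMonoidHom 2
  have hsq : ∀ g, sq g = g ^ 2 := fun g => rfl
  have hWH : W ≤ H := involNorm_range_le hτ
  have hDV : D ≤ V := involTwist_range_le hτ
  have hm2 : m ^ 2 = 1 := (hm m).2 (Or.inr rfl)
  have hmH : m ∈ H := by
    rw [hHdef, MonoidHom.mem_ker, involTwist_apply, hmτ, div_self']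
  have hfixH : ∀ {g}, g ∈ H ↔ τ g = g := by
    intro g
    rw [hHdef, MonoidHom.mem_ker, involTwist_apply, div_eq_one]
  have hH2 : (H.map sq).relIndex H = 2 ^ n := by
    rw [← hH, Subgroup.relIndex]
    congr 1
    ext ⟨g, hg⟩
    simp only [Subgroup.mem_subgroupOf, Subgroup.mem_map, mem_squares]
    constructor
    · rintro ⟨h, hh, e⟩; exact ⟨⟨h, hh⟩, Subtype.ext e⟩
    · rintro ⟨h, e⟩; exact ⟨h.1, h.2, congrArg Subtype.val e⟩
  have hker : sq.ker ≤ H := by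
    intro u hu
    rcases (hm u).1 hu with rfl | rfl
    · exact one_mem _
    · exact hmH
  have hW2W : W.map sq ≤ W := by
    rintro _ ⟨w, hw, rfl⟩; exact pow_mem hw 2
  have hH2H : H.map sq ≤ H := by
    rintro _ ⟨w, hw, rfl⟩; exact pow_mem hw 2
  have hH2W : H.map sq ≤ W := by
    rintro _ ⟨w, hw, rfl⟩
    exact ⟨w, by rw [involNorm_apply, hfixH.1 hw, hsq, pow_two]⟩
  have hH2ne : (H.map sq).relIndex H ≠ 0 := by rw [hH2]; positivity
  have hHW := Subgroup.relIndex_mul_relIndex _ _ _ hH2W hWH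
  have hWHne : W.relIndex H ≠ 0 := fun h => hH2ne (by rw [← hHW, h, mul_zero])
  have hWH2ne : (H.map sq).relIndex W ≠ 0 := fun h => hH2ne (by rw [← hHW, h, zero_mul])
  have e1 : 2 * (W.map sq).relIndex W = 2 ^ n := by
    have a1 := Subgroup.relIndex_mul_relIndex _ _ _ hW2W hWH
    have a2 := Subgroup.relIndex_mul_relIndex _ _ _ (Subgroup.map_mono (f := sq) hWH) hH2H
    have a3 : (W.map sq).relIndex (H.map sq) = (W ⊔ sq.ker).relIndex H := by
      rw [Subgroup.relIndex_map_map, sup_eq_left.2 hker]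
    have a4 := Subgroup.relIndex_mul_relIndex W (W ⊔ sq.ker) H le_sup_left (sup_le hWH hker)
    have a5 : W.relIndex (W ⊔ sq.ker) = 2 := by
      rw [sup_comm, Subgroup.relIndex_sup_right, Subgroup.relIndex, Subgroup.index_eq_two_iff]
      refine ⟨⟨m, hm2⟩, fun b => ?_⟩
      simp only [Subgroup.mem_subgroupOf, Subgroup.coe_mul]
      rcases (hm b).1 b.2 with h | h
      · rw [h, one_mul]
        exact Or.inr ⟨one_mem _, hmN⟩
      · rw [h, ← pow_two, hm2]
        exact Or.inl ⟨one_mem _, hmN⟩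
    have a6 : (W ⊔ sq.ker).relIndex H ≠ 0 := fun h => hWHne (by rw [← a4, h, mul_zero])
    rw [a5] at a4
    rw [a3] at a2
    rw [← hH2]
    refine Nat.eq_of_mul_eq_mul_left (Nat.pos_of_ne_zero a6) ?_
    rw [a2, ← a1, ← a4]
    ring
  have e2 : (squares G).index = (W.map sq).relIndex W * (squares G).relIndex V := by
    have a1 : (W.map sq).relIndex W = (squares G ⊔ V).index := by
      have : W.map sq = (squares G).map (involNorm τ) := by
        rw [hWdef, squares, MonoidHom.range_eq_map, MonoidHom.range_eq_map, Subgroup.map_map,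
          Subgroup.map_map]
        congr 1
        ext g
        simp [sq, map_pow]
      rw [this, hWdef, MonoidHom.range_eq_map, Subgroup.relIndex_map_map, ← hVdef, top_sup_eq,
        Subgroup.relIndex_top_right]
    have a2 := Subgroup.relIndex_mul_index (show squares G ≤ squares G ⊔ V from le_sup_left)
    rw [Subgroup.relIndex_sup_left] at a2
    rw [a1, ← a2, mul_comm]
  have e3 : (V.map sq).relIndex D = (H.map sq).relIndex W := by
    have a1 : V.map sq = V.map (involTwist τ) := by
      have key : ∀ v ∈ V, involTwist τ v = (sq v)⁻¹ := by
        intro v hv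
        rw [hVdef, MonoidHom.mem_ker, involNorm_apply, mul_comm] at hv
        rw [involTwist_apply, eq_inv_of_mul_eq_one_left hv, hsq, pow_two, mul_inv, div_eq_mul_inv]
      apply le_antisymm
      · rintro _ ⟨v, hv, rfl⟩
        exact ⟨v⁻¹, inv_mem hv, by rw [map_inv, key v hv, inv_inv]⟩
      · rintro _ ⟨v, hv, rfl⟩
        exact ⟨v⁻¹, inv_mem hv, by rw [map_inv, key v hv]⟩
    have a2 : H.map sq = H.map (involNorm τ) := by
      have key : ∀ v ∈ H, involNorm τ v = sq v := by
        intro v hv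
        rw [involNorm_apply, hfixH.1 hv, hsq, pow_two]
      apply le_antisymm
      · rintro _ ⟨v, hv, rfl⟩; exact ⟨v, hv, key v hv⟩
      · rintro _ ⟨v, hv, rfl⟩; exact ⟨v, hv, (key v hv).symm⟩
    rw [a1, a2, hDdef, hWdef, MonoidHom.range_eq_map, MonoidHom.range_eq_map,
      Subgroup.relIndex_map_map, Subgroup.relIndex_map_map, ← hHdef, ← hVdef, top_sup_eq,
      top_sup_eq, sup_comm]
  have hV2D : V.map sq ≤ D := by
    rintro _ ⟨v, hv, rfl⟩
    refine ⟨v⁻¹, ?_⟩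
    rw [SetLike.mem_coe, hVdef, MonoidHom.mem_ker, involNorm_apply, mul_comm] at hv
    rw [map_inv, involTwist_apply, eq_inv_of_mul_eq_one_left hv, hsq, pow_two, div_eq_mul_inv,
      mul_inv, inv_inv]
  have e4 := Subgroup.relIndex_mul_relIndex _ _ _ hV2D hDV
  have e5 : (squares G).relIndex V ≤ (V.map sq).relIndex V := by
    refine Subgroup.relIndex_le_of_le_left ?_ ?_
    · rintro _ ⟨v, -, rfl⟩; exact ⟨v, rfl⟩
    · rw [← e4, e3]; exact mul_ne_zero hWH2ne hD
  rw [← e4, e3] at e5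
  rw [hG] at e2
  rw [hH2] at hHW
  set a := (W.map sq).relIndex W
  set b := (squares G).relIndex V
  set c := (H.map sq).relIndex W
  set d := D.relIndex V
  set w := W.relIndex H
  have hpos : 0 < 2 ^ n := by positivity
  have e6 : b = 2 * 2 ^ n := by
    refine Nat.eq_of_mul_eq_mul_left hpos ?_
    calc 2 ^ n * b = 2 * (a * b) := by rw [← e1]; ring
      _ = 2 * 2 ^ (2 * n) := by rw [e2]
      _ = 2 ^ n * (2 * 2 ^ n) := by ring
  refine Nat.le_of_mul_le_mul_left (c := c) ?_ (Nat.pos_of_ne_zero hWH2ne)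
  calc c * (2 * w) = 2 * (c * w) := by ring
    _ = b := by rw [hHW, e6]
    _ ≤ c * d := e5

end InvolutionIndex

section InvolutionClassGroup
open nonZeroDivisors

variable {A B : Type*} [CommRing A] [IsDedekindDomain A] [CommRing B] [IsDedekindDomain B]
  [Algebra A B] {σ : B ≃ₐ[A] B}

theorem map_comap_of_involution_stable (hσ : ∀ x, σ (σ x) = x)
    (hfix : ∀ x, σ x = x → ∃ a, algebraMap A B a = x)
    (hspan : Ideal.span (Set.range fun x => σ x - x) = ⊤) {J : Ideal B} (hJ : J.map σ = J) :
    (J.comap (algebraMap A B)).map (algebraMap A B) = J := by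
  refine le_antisymm Ideal.map_comap_le fun j hj => ?_
  have hJ' : ∀ j ∈ J, σ j ∈ J := fun j hj => hJ ▸ Ideal.mem_map_of_mem σ hj
  have htr : ∀ j ∈ J, j + σ j ∈ (J.comap (algebraMap A B)).map (algebraMap A B) := by
    intro j hj
    obtain ⟨a, ha⟩ := hfix (j + σ j) (by rw [map_add, hσ, add_comm])
    rw [← ha]
    refine Ideal.mem_map_of_mem _ ?_
    rw [Ideal.mem_comap, ha]
    exact add_mem hj (hJ' j hj)
  have h1 : Ideal.span (Set.range fun x => σ x - x) ≤
      Submodule.colon ((J.comap (algebraMap A B)).map (algebraMap A B)) {j} := by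
    rw [Ideal.span_le]
    rintro _ ⟨x, rfl⟩
    rw [SetLike.mem_coe, Submodule.mem_colon_singleton, smul_eq_mul]
    have : (σ x - x) * j = σ x * (j + σ j) - (x * j + σ (x * j)) := by
      rw [map_mul]; ring
    simp only [this]
    exact sub_mem (Ideal.mul_mem_left _ _ (htr j hj)) (htr _ (Ideal.mul_mem_left _ _ hj))
  have h2 : (1 : B) ∈ Submodule.colon ((J.comap (algebraMap A B)).map (algebraMap A B)) {j} :=
    h1 (hspan ▸ Submodule.mem_top)
  rw [Submodule.mem_colon_singleton, one_smul] at h2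
  exact h2

theorem exists_mul_apply_eq_of_norm_eq (hσ : ∀ x, σ (σ x) = x)
    (hne : ∃ x, σ x ≠ x) {x y : B} (hx : x ≠ 0)
    (hN : y * σ y = x * σ x) : ∃ z, z ≠ 0 ∧ y * σ z = x * z := by
  have hσx : σ x ≠ 0 := (map_ne_zero_iff σ σ.injective).2 hx
  have key : ∀ θ, y * σ (σ x * (x * θ + y * σ θ)) = x * (σ x * (x * θ + y * σ θ)) := by
    intro θ
    simp only [map_mul, map_add, hσ]
    linear_combination (x * θ) * hN
  by_cases h : x + y = 0
  · obtain ⟨θ, hθ⟩ := hne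
    refine ⟨_, mul_ne_zero hσx ?_, key θ⟩
    rw [eq_neg_of_add_eq_zero_right h]
    have : x * θ + -x * σ θ = x * (θ - σ θ) := by ring
    rw [this]
    exact mul_ne_zero hx (sub_ne_zero.2 hθ.symm)
  · refine ⟨_, mul_ne_zero hσx ?_, key 1⟩
    simpa using h

/-- The homomorphism of class groups induced by a homomorphism between monoids of ideals. -/
theorem exists_classGroupHom {R S : Type*} [CommRing R] [IsDedekindDomain R] [CommRing S]
    [IsDedekindDomain S] (g : Ideal R →* Ideal S) (hg : ∀ I, I ≠ ⊥ → g I ≠ ⊥)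
    (hp : ∀ x, ∃ y, g (Ideal.span {x}) = Ideal.span {y}) :
    ∃ f : ClassGroup R →* ClassGroup S, ∀ (I : (Ideal R)⁰) (J : (Ideal S)⁰), g I.1 = J.1 →
      f (ClassGroup.mk0 I) = ClassGroup.mk0 J := by
  let g' : (Ideal R)⁰ → (Ideal S)⁰ := fun I =>
    ⟨g I.1, mem_nonZeroDivisors_of_ne_zero (hg _ (nonZeroDivisors.coe_ne_zero I))⟩
  have hmul : ∀ I J, g' (I * J) = g' I * g' J := fun I J => Subtype.ext (map_mul g _ _)
  have hprin : ∀ I J, ClassGroup.mk0 I = (ClassGroup.mk0 J)⁻¹ →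
      ClassGroup.mk0 (g' I) = (ClassGroup.mk0 (g' J))⁻¹ := by
    intro I J h
    obtain ⟨x, -, hx⟩ := ClassGroup.mk0_eq_mk0_inv_iff.1 h
    obtain ⟨y, hy⟩ := hp x
    have h1 : (g' (I * J)).1 = Ideal.span {y} := by
      change g (I.1 * J.1) = _
      rw [hx, hy]
    rw [eq_inv_iff_mul_eq_one, ← map_mul, ← hmul]
    have := (ClassGroup.mk0_eq_one_iff (g' (I * J)).2).2 ⟨⟨y, h1⟩⟩
    simpa using this
  have hwd : ∀ I J, ClassGroup.mk0 I = ClassGroup.mk0 J →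
      ClassGroup.mk0 (g' I) = ClassGroup.mk0 (g' J) := by
    intro I J h
    obtain ⟨K, hK⟩ := ClassGroup.mk0_surjective (ClassGroup.mk0 J)⁻¹
    rw [← inv_inv (ClassGroup.mk0 (g' J)), ← hprin K J hK]
    exact hprin I K (by rw [hK, inv_inv, h])
  choose r hr using (ClassGroup.mk0_surjective (R := R))
  let f : ClassGroup R →* ClassGroup S := MonoidHom.mk' (fun c => ClassGroup.mk0 (g' (r c))) (by
    intro a b
    rw [← map_mul, ← hmul]
    exact hwd _ _ (by rw [hr, map_mul, hr, hr]))
  refine ⟨f, fun I J h => ?_⟩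
  have : J = g' I := Subtype.ext h.symm
  rw [this]
  exact hwd _ _ (hr _)

/-- Ideals `I` in the class `c` with `x σ(I) = y I` and `N(y) = u N(x)`. -/
def NormRel (σ : B ≃ₐ[A] B) (c : ClassGroup B) (u : B) : Prop :=
  ∃ (I : (Ideal B)⁰) (x y : B), ClassGroup.mk0 I = c ∧ x ≠ 0 ∧ y ≠ 0 ∧
    Ideal.span {x} * I.1.map σ = Ideal.span {y} * I.1 ∧ y * σ y = u * (x * σ x)

theorem NormRel.mul {c c' : ClassGroup B} {u u' : B} (h : NormRel σ c u) (h' : NormRel σ c' u') :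
    NormRel σ (c * c') (u * u') := by
  obtain ⟨I, x, y, hc, hx, hy, hI, hN⟩ := h
  obtain ⟨I', x', y', hc', hx', hy', hI', hN'⟩ := h'
  refine ⟨I * I', x * x', y * y', by rw [map_mul, hc, hc'], mul_ne_zero hx hx',
    mul_ne_zero hy hy', ?_, ?_⟩
  · rw [Submonoid.coe_mul, Ideal.map_mul, ← Ideal.span_singleton_mul_span_singleton,
      ← Ideal.span_singleton_mul_span_singleton, mul_mul_mul_comm, hI, hI', mul_mul_mul_comm]
  · simp only [map_mul]
    linear_combination (y' * σ y') * hN + u * (x * σ x) * hN'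

theorem NormRel.inv (hσ : ∀ x, σ (σ x) = x) {c : ClassGroup B} {u v : B} (huv : u * v = 1)
    (h : NormRel σ c u) :
    NormRel σ c⁻¹ v := by
  obtain ⟨I, x, y, hc, hx, hy, hI, hN⟩ := h
  obtain ⟨I', hI'⟩ := ClassGroup.mk0_surjective c⁻¹
  obtain ⟨w, hw0, hw⟩ := ClassGroup.mk0_eq_mk0_inv_iff.1 (hc.symm ▸ hI')
  have hσ0 : ∀ {z : B}, z ≠ 0 → σ z ≠ 0 := fun hz => (map_ne_zero_iff σ σ.injective).2 hz
  have hI0 : I.1 * I.1.map σ ≠ ⊥ := by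
    refine mul_ne_zero (nonZeroDivisors.coe_ne_zero I) ?_
    rw [Ideal.zero_eq_bot, Ne, Ideal.map_eq_bot_iff_of_injective σ.injective]
    exact nonZeroDivisors.coe_ne_zero I
  refine ⟨I', y * w, x * σ w, hI', mul_ne_zero hy hw0, mul_ne_zero hx (hσ0 hw0), ?_, ?_⟩
  · refine mul_left_cancel₀ hI0 ?_
    have e1 : I'.1.map σ * I.1.map σ = Ideal.span {σ w} := by
      rw [← Ideal.map_mul, hw, Ideal.map_span, Set.image_singleton]
    rw [← Ideal.span_singleton_mul_span_singleton, ← Ideal.span_singleton_mul_span_singleton]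
    calc I.1 * I.1.map σ * (Ideal.span {y} * Ideal.span {w} * I'.1.map σ)
        = (I'.1.map σ * I.1.map σ) * Ideal.span {w} * (Ideal.span {y} * I.1) := by ring
      _ = Ideal.span {σ w} * (I'.1 * I.1) * (Ideal.span {x} * I.1.map σ) := by rw [e1, hw, hI]
      _ = _ := by ring
  · simp only [map_mul, hσ]
    linear_combination (- v * w * σ w) * hN - (x * σ x * w * σ w) * huv

theorem NormRel.exists_ideal (hσ : ∀ x, σ (σ x) = x) (hne : ∃ x, σ x ≠ x)
    (hfix : ∀ x, σ x = x → ∃ a, algebraMap A B a = x)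
    (hspan : Ideal.span (Set.range fun x => σ x - x) = ⊤) {c : ClassGroup B} {ε : B}
    (hε : IsUnit ε) (h : NormRel σ c (ε * σ ε)) :
    ∃ (J : (Ideal B)⁰) (𝔞 : Ideal A), ClassGroup.mk0 J = c ∧ 𝔞.map (algebraMap A B) = J.1 := by
  obtain ⟨I, x, y, hc, hx, hy, hI, hN⟩ := h
  obtain ⟨z, hz, hyz⟩ := exists_mul_apply_eq_of_norm_eq (σ := σ) hσ hne (x := ε * x) (y := y)
    (mul_ne_zero hε.ne_zero hx) (by rw [hN, map_mul]; ring)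
  have hz1 : Ideal.span {z} ≠ ⊥ := by simpa using hz
  let Z : (Ideal B)⁰ := ⟨Ideal.span {z}, mem_nonZeroDivisors_of_ne_zero hz1⟩
  refine ⟨Z * I, _, ?_, map_comap_of_involution_stable hσ hfix hspan ?_⟩
  · rw [map_mul, hc, (ClassGroup.mk0_eq_one_iff Z.2).2 ⟨⟨z, rfl⟩⟩, one_mul]
  · have e0 : Ideal.span {y} * Ideal.span {σ z} = Ideal.span {x} * Ideal.span {z} := by
      rw [Ideal.span_singleton_mul_span_singleton, hyz, mul_assoc,
        Ideal.span_singleton_mul_left_unit hε, Ideal.span_singleton_mul_span_singleton]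
    rw [Submonoid.coe_mul, Ideal.map_mul]
    change (Ideal.span {z}).map σ * _ = Ideal.span {z} * _
    rw [Ideal.map_span, Set.image_singleton]
    refine mul_left_cancel₀ (show Ideal.span {x} ≠ 0 by simpa using hx) ?_
    calc Ideal.span {x} * (Ideal.span {σ z} * I.1.map σ)
        = Ideal.span {σ z} * (Ideal.span {x} * I.1.map σ) := by ring
      _ = (Ideal.span {y} * Ideal.span {σ z}) * I.1 := by rw [hI]; ring
      _ = _ := by rw [e0, mul_assoc]

end InvolutionClassGroup

section AmbiguousClasses
open nonZeroDivisors

theorem relIndex_le_relIndex_of_div_mem {G G' : Type*} [CommGroup G] [CommGroup G']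
    {H K : Subgroup G} {H' K' : Subgroup G'} (f : G → G') (hf : ∀ a ∈ K, f a ∈ K')
    (hd : ∀ a ∈ K, ∀ b ∈ K, f a / f b ∈ H' → a / b ∈ H) (hfin : H'.relIndex K' ≠ 0) :
    H.relIndex K ≤ H'.relIndex K' ∧ H.relIndex K ≠ 0 := by
  have : Finite (K' ⧸ H'.subgroupOf K') := Nat.finite_of_card_ne_zero hfin
  let g : K ⧸ H.subgroupOf K → K' ⧸ H'.subgroupOf K' := fun q =>
    QuotientGroup.mk ⟨f q.out.1, hf _ q.out.2⟩
  have hg : Function.Injective g := by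
    intro p q h
    have h1 := QuotientGroup.eq.1 h
    rw [Subgroup.mem_subgroupOf] at h1
    have h2 : f q.out.1 / f p.out.1 ∈ H' := by
      simpa [div_eq_inv_mul] using h1
    rw [← p.out_eq', ← q.out_eq']
    refine QuotientGroup.eq.2 ?_
    rw [Subgroup.mem_subgroupOf]
    simpa [div_eq_inv_mul] using hd _ q.out.2 _ p.out.2 h2
  refine ⟨Nat.card_le_card_of_injective g hg, ?_⟩
  have : Finite (K ⧸ H.subgroupOf K) := Finite.of_injective g hg
  exact Nat.card_pos.ne'

variable {A B : Type*} [CommRing A] [IsDedekindDomain A] [CommRing B] [IsDedekindDomain B]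
  [Algebra A B] [FaithfulSMul A B]

/-- The action on units of an automorphism. -/
def unitAut (σ : B ≃ₐ[A] B) : Bˣ →* Bˣ := Units.map (σ : B →* B)

theorem coe_unitAut (σ : B ≃ₐ[A] B) (u : Bˣ) : (unitAut σ u : B) = σ u := rfl

/-- The fixed units which are relative norms from the fraction field. -/
def normUnits (σ : B ≃ₐ[A] B) : Subgroup Bˣ where
  carrier := {u | unitAut σ u = u ∧ ∃ x y : B, x ≠ 0 ∧ y ≠ 0 ∧ y * σ y = u * (x * σ x)}
  one_mem' := ⟨map_one _, 1, 1, one_ne_zero, one_ne_zero, by simp⟩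
  mul_mem' := by
    rintro u v ⟨hu, x, y, hx, hy, h⟩ ⟨hv, x', y', hx', hy', h'⟩
    refine ⟨by rw [map_mul, hu, hv], x * x', y * y', mul_ne_zero hx hx', mul_ne_zero hy hy', ?_⟩
    simp only [map_mul, Units.val_mul]
    linear_combination (y' * σ y') * h + u * (x * σ x) * h'
  inv_mem' := by
    rintro u ⟨hu, x, y, hx, hy, h⟩
    refine ⟨by rw [map_inv, hu], y, x, hy, hx, ?_⟩
    rw [h, ← mul_assoc, Units.inv_mul, one_mul]

variable {σ : B ≃ₐ[A] B}

theorem unitAut_unitAut (hσ : ∀ x, σ (σ x) = x) (u : Bˣ) : unitAut σ (unitAut σ u) = u :=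
  Units.ext (hσ u)

theorem mem_involTwist_ker {G : Type*} [CommGroup G] {τ : G →* G} {g : G} :
    g ∈ (involTwist τ).ker ↔ τ g = g := by
  rw [MonoidHom.mem_ker, involTwist_apply, div_eq_one]

theorem relIndex_ambiguous_le [Finite (ClassGroup B)] (hσ : ∀ x, σ (σ x) = x)
    (hne : ∃ x, σ x ≠ x) (hfix : ∀ x, σ x = x → ∃ a, algebraMap A B a = x)
    (hspan : Ideal.span (Set.range fun x => σ x - x) = ⊤)
    {ι : ClassGroup A →* ClassGroup B}
    (hι : ∀ (I : (Ideal A)⁰) (J : (Ideal B)⁰), I.1.map (algebraMap A B) = J.1 →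
      ι (ClassGroup.mk0 I) = ClassGroup.mk0 J)
    {s : ClassGroup B →* ClassGroup B}
    (hs : ∀ (I : (Ideal B)⁰) (J : (Ideal B)⁰), I.1.map σ = J.1 →
      s (ClassGroup.mk0 I) = ClassGroup.mk0 J)
    (hfin : (involNorm (unitAut σ)).range.relIndex (normUnits σ) ≠ 0) :
    ι.range.relIndex (involTwist s).ker ≤
      (involNorm (unitAut σ)).range.relIndex (normUnits σ) := by
  have key : ∀ c ∈ (involTwist s).ker, ∃ u : Bˣ, u ∈ normUnits σ ∧ NormRel σ c u := by
    intro c hc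
    rw [mem_involTwist_ker] at hc
    obtain ⟨I, rfl⟩ := ClassGroup.mk0_surjective c
    have h1 : I.1.map σ ≠ ⊥ := by
      rw [Ne, Ideal.map_eq_bot_iff_of_injective σ.injective]
      exact nonZeroDivisors.coe_ne_zero I
    rw [hs I ⟨_, mem_nonZeroDivisors_of_ne_zero h1⟩ rfl, ClassGroup.mk0_eq_mk0_iff] at hc
    obtain ⟨x, y, hx, hy, h⟩ := hc
    have h2 : Ideal.span {σ x} * I.1 = Ideal.span {σ y} * I.1.map σ := by
      have := congrArg (Ideal.map σ) h
      have hσσ : (I.1.map σ).map σ = I.1 := by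
        have h0 : (I.1.map (σ : B →+* B)).map (σ : B →+* B) = I.1 := by
          rw [Ideal.map_map, show (σ : B →+* B).comp (σ : B →+* B) = RingHom.id B from
            RingHom.ext hσ, Ideal.map_id]
        exact h0
      simpa [Ideal.map_mul, Ideal.map_span, hσσ] using this
    have h3 : Ideal.span {x * σ x} = Ideal.span {y * σ y} := by
      have hI0 : I.1 * I.1.map σ ≠ 0 := mul_ne_zero (nonZeroDivisors.coe_ne_zero I) h1
      refine mul_left_cancel₀ hI0 ?_
      rw [← Ideal.span_singleton_mul_span_singleton, ← Ideal.span_singleton_mul_span_singleton]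
      calc I.1 * I.1.map σ * (Ideal.span {x} * Ideal.span {σ x})
          = (Ideal.span {x} * I.1.map σ) * (Ideal.span {σ x} * I.1) := by ring
        _ = (Ideal.span {y} * I.1) * (Ideal.span {σ y} * I.1.map σ) := by rw [h2]; exact congrArg (· * _) h
        _ = _ := by ring
    obtain ⟨u, hu⟩ := Ideal.span_singleton_eq_span_singleton.1 h3
    have hx0 : x * σ x ≠ 0 := mul_ne_zero hx ((map_ne_zero_iff σ σ.injective).2 hx)
    refine ⟨u, ⟨Units.ext ?_, x, y, hx, hy, by rw [← hu, mul_comm]⟩,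
      I, x, y, rfl, hx, hy, h, by rw [← hu, mul_comm]⟩
    rw [coe_unitAut]
    refine mul_left_cancel₀ hx0 ?_
    have h4 := congrArg σ hu
    simp only [map_mul, hσ] at h4
    rw [hu]
    linear_combination h4
  choose! f hf using key
  refine (relIndex_le_relIndex_of_div_mem f (fun c hc => (hf c hc).1) ?_ hfin).1
  rintro a ha b hb ⟨ε, hε⟩
  have h1 : NormRel σ b⁻¹ ((f b)⁻¹ : Bˣ) := NormRel.inv hσ (by simp) (hf b hb).2
  have h2 := (hf a ha).2.mul h1
  have h3 : ((f a : Bˣ) : B) * ((f b)⁻¹ : Bˣ) = ε * σ ε := by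
    rw [← Units.val_mul, ← div_eq_mul_inv, ← hε, involNorm_apply, Units.val_mul, coe_unitAut]
  rw [h3, ← div_eq_mul_inv] at h2
  obtain ⟨J, 𝔞, hJ, h𝔞⟩ := h2.exists_ideal hσ hne hfix hspan ε.isUnit
  have h𝔞0 : 𝔞 ≠ ⊥ := by
    rintro rfl
    rw [Ideal.map_bot] at h𝔞
    exact nonZeroDivisors.coe_ne_zero J h𝔞.symm
  rw [← hJ]
  exact ⟨ClassGroup.mk0 ⟨𝔞, mem_nonZeroDivisors_of_ne_zero h𝔞0⟩, hι _ _ h𝔞⟩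

theorem relIndex_twist_le_card_ker [Finite (ClassGroup A)] (hσ : ∀ x, σ (σ x) = x)
    (hne : ∃ x, σ x ≠ x) (hfix : ∀ x, σ x = x → ∃ a, algebraMap A B a = x)
    (hspan : Ideal.span (Set.range fun x => σ x - x) = ⊤)
    {ι : ClassGroup A →* ClassGroup B}
    (hι : ∀ (I : (Ideal A)⁰) (J : (Ideal B)⁰), I.1.map (algebraMap A B) = J.1 →
      ι (ClassGroup.mk0 I) = ClassGroup.mk0 J) :
    (involTwist (unitAut σ)).range.relIndex (involNorm (unitAut σ)).ker ≤ Nat.card ι.ker ∧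
    (involTwist (unitAut σ)).range.relIndex (involNorm (unitAut σ)).ker ≠ 0 := by
  have key : ∀ ε ∈ (involNorm (unitAut σ)).ker, ∃ (z : B) (𝔞 : (Ideal A)⁰), z ≠ 0 ∧
      (ε : B) * σ z = z ∧ 𝔞.1.map (algebraMap A B) = Ideal.span {z} := by
    intro ε hε
    rw [MonoidHom.mem_ker, involNorm_apply, ← Units.val_inj, Units.val_mul, coe_unitAut] at hε
    obtain ⟨z, hz, h⟩ := exists_mul_apply_eq_of_norm_eq (σ := σ) hσ hne (x := 1) (y := ε)
      one_ne_zero (by simpa using hε)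
    rw [one_mul] at h
    have h1 := map_comap_of_involution_stable hσ hfix hspan (J := Ideal.span {z}) (by
      rw [Ideal.map_span, Set.image_singleton]
      conv_rhs => rw [← h, Ideal.span_singleton_mul_left_unit ε.isUnit])
    refine ⟨z, ⟨_, mem_nonZeroDivisors_of_ne_zero ?_⟩, hz, h, h1⟩
    intro h0
    replace h0 : Ideal.comap (algebraMap A B) (Ideal.span {z}) = ⊥ := h0
    rw [h0, Ideal.map_bot, eq_comm, Ideal.span_singleton_eq_bot] at h1
    exact hz h1
  choose! z 𝔞 hz0 hz h𝔞 using key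
  have hcard : (⊥ : Subgroup (ClassGroup A)).relIndex ι.ker = Nat.card ι.ker :=
    Subgroup.relIndex_bot_left _
  rw [← hcard]
  refine relIndex_le_relIndex_of_div_mem (fun ε => ClassGroup.mk0 (𝔞 ε)) ?_ ?_
    (hcard ▸ Nat.card_pos.ne')
  · intro ε hε
    have : Ideal.span {z ε} ≠ ⊥ := by simpa using hz0 ε hε
    rw [MonoidHom.mem_ker, hι (𝔞 ε) ⟨_, mem_nonZeroDivisors_of_ne_zero this⟩ (h𝔞 ε hε)]
    exact (ClassGroup.mk0_eq_one_iff _).2 ⟨⟨_, rfl⟩⟩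
  · intro a ha b hb h
    rw [Subgroup.mem_bot, div_eq_one, ClassGroup.mk0_eq_mk0_iff] at h
    obtain ⟨x, y, hx, hy, h⟩ := h
    have h1 := congrArg (Ideal.map (algebraMap A B)) h
    rw [Ideal.map_mul, Ideal.map_mul, h𝔞 a ha, h𝔞 b hb, Ideal.map_span, Ideal.map_span,
      Set.image_singleton, Set.image_singleton, Ideal.span_singleton_mul_span_singleton,
      Ideal.span_singleton_mul_span_singleton] at h1
    obtain ⟨u, hu⟩ := Ideal.span_singleton_eq_span_singleton.1 h1
    refine ⟨u, ?_⟩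
    have h2 := congrArg σ hu
    simp only [map_mul, AlgEquiv.commutes] at h2
    rw [involTwist_apply, div_eq_div_iff_mul_eq_mul, ← Units.val_inj, Units.val_mul, Units.val_mul,
      coe_unitAut]
    have hx0 : algebraMap A B x ≠ 0 := by simpa using hx
    have hza : σ (z a) ≠ 0 := (map_ne_zero_iff σ σ.injective).2 (hz0 a ha)
    refine mul_left_cancel₀ (mul_ne_zero hx0 hza) ?_
    linear_combination (b : B) * h2 + algebraMap A B y * hz b hb -
      algebraMap A B x * u * hz a ha - hu

end AmbiguousClasses

section NormIndex
open nonZeroDivisors NumberField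

variable {A B : Type*} [CommRing A] [IsDedekindDomain A] [CommRing B] [IsDedekindDomain B]
  [Algebra A B] [FaithfulSMul A B] {σ : B ≃ₐ[A] B}

theorem four_mul_card_range_le [Finite (ClassGroup A)] [Finite (ClassGroup B)] (hσ : ∀ x, σ (σ x) = x)
    (hne : ∃ x, σ x ≠ x) (hfix : ∀ x, σ x = x → ∃ a, algebraMap A B a = x)
    (hspan : Ideal.span (Set.range fun x => σ x - x) = ⊤)
    {ι : ClassGroup A →* ClassGroup B}
    (hι : ∀ (I : (Ideal A)⁰) (J : (Ideal B)⁰), I.1.map (algebraMap A B) = J.1 →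
      ι (ClassGroup.mk0 I) = ClassGroup.mk0 J)
    {s : ClassGroup B →* ClassGroup B}
    (hs : ∀ (I : (Ideal B)⁰) (J : (Ideal B)⁰), I.1.map σ = J.1 →
      s (ClassGroup.mk0 I) = ClassGroup.mk0 J)
    {N : ClassGroup B →* ClassGroup A} (hN : ∀ c, N (s c) = N c)
    {n : ℕ} (hB : (squares Bˣ).index = 2 ^ (2 * n)) (hA : (squares Aˣ).index = 2 ^ n)
    (hneg : ∀ x y : B, y ≠ 0 → y * σ y ≠ - (x * σ x)) :
    4 * Nat.card N.range ≤ Nat.card (ClassGroup A) := by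
  have hτ := unitAut_unitAut (σ := σ) hσ
  obtain ⟨hD, hD0⟩ := relIndex_twist_le_card_ker hσ hne hfix hspan hι
  have hsq : ∀ u : Bˣ, u ^ 2 = 1 ↔ u = 1 ∨ u = -1 := by
    intro u
    rw [← Units.val_inj, ← Units.val_inj, ← Units.val_inj, Units.val_pow_eq_pow_val, Units.val_one,
      Units.val_neg, Units.val_one, sq_eq_one_iff]
  have hH : (squares (involTwist (unitAut σ)).ker).index = 2 ^ n := by
    let f : Aˣ →* (involTwist (unitAut σ)).ker :=
      (Units.map (algebraMap A B : A →* B)).codRestrict _ fun a =>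
        mem_involTwist_ker.2 (Units.ext (σ.commutes a))
    rw [← hA]
    refine (index_squares_eq (MulEquiv.ofBijective f ⟨?_, ?_⟩)).symm
    · intro a b h
      refine Units.ext (FaithfulSMul.algebraMap_injective A B ?_)
      exact congrArg (fun u : (involTwist (unitAut σ)).ker => ((u : Bˣ) : B)) h
    · rintro ⟨u, hu⟩
      have hu' := mem_involTwist_ker.1 hu
      obtain ⟨a, ha⟩ := hfix u (congrArg Units.val hu')
      obtain ⟨b, hb⟩ := hfix (u⁻¹ : Bˣ) (by
        have := congrArg (fun v : Bˣ => ((v⁻¹ : Bˣ) : B)) hu'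
        simpa only [← map_inv, coe_unitAut] using this)
      have hab : a * b = 1 := FaithfulSMul.algebraMap_injective A B (by
        rw [map_mul, ha, hb, map_one, Units.mul_inv])
      exact ⟨⟨a, b, hab, by rw [mul_comm, hab]⟩, Subtype.ext (Units.ext ha)⟩
  have hneg1 : (-1 : Bˣ) ∉ normUnits σ := by
    rintro ⟨-, x, y, -, hy, h⟩
    exact hneg x y hy (by simpa using h)
  have hWY : (involNorm (unitAut σ)).range ≤ normUnits σ := by
    rintro _ ⟨u, rfl⟩
    refine ⟨?_, 1, u, one_ne_zero, u.ne_zero, by simp [involNorm_apply, coe_unitAut]⟩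
    rw [involNorm_apply, map_mul, hτ, mul_comm]
  have hYH : normUnits σ ≤ (involTwist (unitAut σ)).ker := fun u hu =>
    mem_involTwist_ker.2 hu.1
  have h1 := two_mul_relIndex_le hτ hsq (Units.ext (by simp [coe_unitAut]))
    (fun h => hneg1 (hWY h)) hB hH hD0
  have h3 := Subgroup.relIndex_mul_relIndex _ _ _ hWY hYH
  have hWH0 : (involNorm (unitAut σ)).range.relIndex (involTwist (unitAut σ)).ker ≠ 0 := by
    have a : squares (involTwist (unitAut σ)).ker ≤
        (involNorm (unitAut σ)).range.subgroupOf (involTwist (unitAut σ)).ker := by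
      rintro _ ⟨h, rfl⟩
      refine ⟨h, ?_⟩
      rw [involNorm_apply, mem_involTwist_ker.1 h.2]
      simp [pow_two]
    have h4 := Subgroup.index_dvd_of_le a
    rw [hH] at h4
    intro h0
    rw [Subgroup.relIndex] at h0
    rw [h0, zero_dvd_iff] at h4
    exact (pow_pos two_pos n).ne' h4
  have hY2 : 2 ≤ (normUnits σ).relIndex (involTwist (unitAut σ)).ker := by
    by_contra! h
    have h4 : (normUnits σ).relIndex (involTwist (unitAut σ)).ker ≠ 0 := fun h0 =>
      hWH0 (by rw [← h3, h0, mul_zero])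
    have h5 : (normUnits σ).relIndex (involTwist (unitAut σ)).ker = 1 := by omega
    rw [Subgroup.relIndex_eq_one] at h5
    exact hneg1 (h5 (mem_involTwist_ker.2 (Units.ext (by simp [coe_unitAut]))))
  have hWY0 : (involNorm (unitAut σ)).range.relIndex (normUnits σ) ≠ 0 := fun h0 =>
    hWH0 (by rw [← h3, h0, zero_mul])
  have h6 := relIndex_ambiguous_le hσ hne hfix hspan hι hs hWY0
  have h7 : Nat.card N.range ≤ Nat.card (involTwist s).ker := by
    have e1 := (involTwist s).ker.card_mul_index
    have e2 := N.ker.card_mul_index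
    rw [Subgroup.index_ker] at e1 e2
    have e3 : (involTwist s).range ≤ N.ker := by
      rintro _ ⟨c, rfl⟩
      rw [MonoidHom.mem_ker, involTwist_apply, _root_.map_div, hN, div_self']
    have e4 := Nat.card_le_card_of_injective _ (Subgroup.inclusion_injective e3)
    have e5 : 0 < Nat.card N.ker := Nat.card_pos
    refine Nat.le_of_mul_le_mul_left (c := Nat.card N.ker) ?_ e5
    rw [e2, ← e1, mul_comm]
    gcongr
  have h8 : Nat.card (involTwist s).ker = Nat.card ι.range * ι.range.relIndex (involTwist s).ker := by
    have : ι.range ≤ (involTwist s).ker := by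
      rintro _ ⟨a, rfl⟩
      obtain ⟨I, rfl⟩ := ClassGroup.mk0_surjective a
      have h0 : I.1.map (algebraMap A B) ≠ ⊥ := by
        rw [Ne, Ideal.map_eq_bot_iff_of_injective (FaithfulSMul.algebraMap_injective A B)]
        exact nonZeroDivisors.coe_ne_zero I
      rw [mem_involTwist_ker, hι I ⟨_, mem_nonZeroDivisors_of_ne_zero h0⟩ rfl]
      refine hs _ _ ?_
      refine (Ideal.map_map (algebraMap A B) (σ : B →+* B)).trans ?_
      have : (σ : B →+* B).comp (algebraMap A B) = algebraMap A B := RingHom.ext σ.commutes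
      rw [this]
    have h10 := Subgroup.relIndex_mul_relIndex ⊥ _ _ bot_le this
    rw [Subgroup.relIndex_bot_left, Subgroup.relIndex_bot_left] at h10
    exact h10.symm
  have h9 := ι.ker.card_mul_index
  rw [Subgroup.index_ker] at h9
  rw [← h9]
  calc 4 * Nat.card N.range ≤ 4 * Nat.card (involTwist s).ker := by gcongr
    _ ≤ 4 * (Nat.card ι.range * (involNorm (unitAut σ)).range.relIndex (normUnits σ)) := by
      rw [h8]; gcongr
    _ = Nat.card ι.range * (2 * ((involNorm (unitAut σ)).range.relIndex (normUnits σ) * 2)) := by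
      ring
    _ ≤ Nat.card ι.range * (2 * ((involNorm (unitAut σ)).range.relIndex (normUnits σ) *
      (normUnits σ).relIndex (involTwist (unitAut σ)).ker)) := by gcongr
    _ ≤ Nat.card ι.range * Nat.card ι.ker := by
      rw [h3]; gcongr; exact h1.trans hD
    _ = _ := mul_comm _ _

end NormIndex

section NegOneNorm
open nonZeroDivisors NumberField

variable {L E : Type*} [Field L] [NumberField L] [Field E] [NumberField E] [Algebra L E]

theorem units_rank_add_one (K : Type*) [Field K] [NumberField K] [IsTotallyComplex K] :
    2 * (Units.rank K + 1) = Module.finrank ℚ K := by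
  classical
  rw [IsTotallyComplex.finrank, Units.rank, Nat.sub_add_cancel Fintype.card_pos,
    InfinitePlace.card_eq_nrRealPlaces_add_nrComplexPlaces,
    IsTotallyComplex.nrRealPlaces_eq_zero, zero_add]

theorem involution_of_finrank_two (h2 : Module.finrank L E = 2) {σ : 𝓞 E ≃ₐ[𝓞 L] 𝓞 E}
    (hσ1 : ∃ x, σ x ≠ x) : (∀ x, σ (σ x) = x) ∧
      ∀ x, σ x = x → ∃ a, algebraMap (𝓞 L) (𝓞 E) a = x := by
  have : Algebra.IsQuadraticExtension L E := ⟨h2⟩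
  have hgal : IsGalois L E := inferInstance
  let τ : Gal(E/L) := (galRestrict (𝓞 L) L E (𝓞 E)).symm σ
  have hτσ : galRestrict (𝓞 L) L E (𝓞 E) τ = σ := MulEquiv.apply_symm_apply _ _
  have hτ : ∀ x : 𝓞 E, ((σ x : 𝓞 E) : E) = τ x := by
    intro x
    rw [← hτσ]
    exact algebraMap_galRestrict_apply (𝓞 L) τ x
  have hτ1 : τ ≠ 1 := by
    rintro h
    obtain ⟨x, hx⟩ := hσ1
    exact hx (RingOfIntegers.ext (by rw [hτ, h]; rfl))
  have hcard : Nat.card Gal(E/L) = 2 := by rw [IsGalois.card_aut_eq_finrank, h2]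
  have hττ : τ ^ 2 = 1 := by rw [← hcard]; exact pow_card_eq_one'
  have hall : ∀ g : Gal(E/L), g = 1 ∨ g = τ := by
    have : Finite Gal(E/L) := Nat.finite_of_card_ne_zero (by omega)
    obtain ⟨x, y, hxy, huniv⟩ := Nat.card_eq_two_iff.1 hcard
    intro g
    have h1 : ∀ g : Gal(E/L), g = x ∨ g = y := fun g => by
      have : g ∈ ({x, y} : Set Gal(E/L)) := huniv ▸ Set.mem_univ g
      simpa using this
    rcases h1 g with rfl | rfl <;> rcases h1 1 with h | h <;> rcases h1 τ with h' | h' <;>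
      simp_all
  refine ⟨fun x => RingOfIntegers.ext ?_, fun x hx => ?_⟩
  · rw [hτ, hτ]
    have := DFunLike.congr_fun hττ (x : E)
    rwa [pow_two] at this
  · have h3 : (x : E) ∈ (⊥ : IntermediateField L E) := by
      rw [IsGalois.mem_bot_iff_fixed]
      intro g
      rcases hall g with rfl | rfl
      · rfl
      · rw [← hτ, hx]
    obtain ⟨a, ha⟩ := IntermediateField.mem_bot.1 h3
    have hai : IsIntegral ℤ a := by
      have : IsIntegral ℤ (algebraMap L E a) := ha ▸ x.isIntegral_coe
      exact (isIntegral_algebraMap_iff (algebraMap L E).injective).1 this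
    exact ⟨⟨a, hai⟩, RingOfIntegers.ext ha⟩

/-- `-1` is a relative norm in a quadratic extension of totally complex number fields which is
unramified in the strong sense that the `σ x - x` generate the unit ideal. -/
theorem exists_norm_eq_neg_norm [IsTotallyComplex L] (h2 : Module.finrank L E = 2)
    {σ : 𝓞 E ≃ₐ[𝓞 L] 𝓞 E} (hspan : Ideal.span (Set.range fun x => σ x - x) = ⊤) :
    ∃ x y : 𝓞 E, y ≠ 0 ∧ y * σ y = - (x * σ x) := by
  by_contra! hneg
  have hne : ∃ x, σ x ≠ x := by
    by_contra! h
    simp only [h, sub_self, Set.range_const, Ideal.span_singleton_zero] at hspan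
    exact bot_ne_top hspan
  obtain ⟨hσ, hfix⟩ := involution_of_finrank_two h2 hne
  have : FiniteDimensional L E := Module.finite_of_finrank_eq_succ h2
  have : IsTotallyComplex E := isTotallyComplex_of_algebra L E
  have hinj := FaithfulSMul.algebraMap_injective (𝓞 L) (𝓞 E)
  have hσinj : Function.Injective (σ : 𝓞 E →+* 𝓞 E) := σ.injective
  obtain ⟨ι, hι⟩ := exists_classGroupHom (Ideal.mapHom (algebraMap (𝓞 L) (𝓞 E)) : _ →* _)
    (fun I hI => by
      rw [MonoidHom.coe_coe, Ideal.mapHom_apply, Ne, Ideal.map_eq_bot_iff_of_injective hinj]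
      exact hI)
    (fun x => ⟨algebraMap (𝓞 L) (𝓞 E) x, by simp [Ideal.map_span]⟩)
  obtain ⟨s, hs⟩ := exists_classGroupHom (Ideal.mapHom (σ : 𝓞 E →+* 𝓞 E) : _ →* _)
    (fun I hI => by
      rw [MonoidHom.coe_coe, Ideal.mapHom_apply, Ne, Ideal.map_eq_bot_iff_of_injective hσinj]
      exact hI)
    (fun x => ⟨σ x, by simp [Ideal.map_span]⟩)
  obtain ⟨N, hN⟩ := exists_classGroupHom 
    ((Ideal.relNorm (𝓞 L) : Ideal (𝓞 E) →*₀ Ideal (𝓞 L)) : Ideal (𝓞 E) →* Ideal (𝓞 L))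
    (fun I hI => by
      change Ideal.relNorm (𝓞 L) I ≠ ⊥
      rwa [Ne, Ideal.relNorm_eq_bot_iff])
    (fun x => ⟨_, Ideal.relNorm_singleton _ x⟩)
  have hN' : ∀ I : (Ideal (𝓞 E))⁰, Ideal.relNorm (𝓞 L) I.1 ∈ (Ideal (𝓞 L))⁰ := fun I =>
    mem_nonZeroDivisors_of_ne_zero (by
      rw [Ideal.zero_eq_bot, Ne, Ideal.relNorm_eq_bot_iff]
      exact nonZeroDivisors.coe_ne_zero I)
  have hNs : ∀ c, N (s c) = N c := by
    intro c
    obtain ⟨I, rfl⟩ := ClassGroup.mk0_surjective c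
    have h0 : I.1.map (σ : 𝓞 E →+* 𝓞 E) ≠ ⊥ := by
      rw [Ne, Ideal.map_eq_bot_iff_of_injective hσinj]
      exact nonZeroDivisors.coe_ne_zero I
    rw [hs I ⟨_, mem_nonZeroDivisors_of_ne_zero h0⟩ rfl, hN I ⟨_, hN' I⟩ rfl]
    exact hN _ _ (Ideal.relNorm_map_algEquiv σ I.1)
  have hNι : ∀ a, N (ι a) = a ^ 2 := by
    intro a
    obtain ⟨I, rfl⟩ := ClassGroup.mk0_surjective a
    have h0 : I.1.map (algebraMap (𝓞 L) (𝓞 E)) ≠ ⊥ := by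
      rw [Ne, Ideal.map_eq_bot_iff_of_injective hinj]
      exact nonZeroDivisors.coe_ne_zero I
    rw [hι I ⟨_, mem_nonZeroDivisors_of_ne_zero h0⟩ rfl, ← map_pow]
    refine hN _ _ ?_
    change Ideal.relNorm (𝓞 L) (I.1.map _) = I.1 ^ 2
    rw [Ideal.relNorm_algebraMap, finrank_ringOfIntegers, h2]
  have hn1 := units_rank_add_one L
  have hn2 := units_rank_add_one E
  have hn3 := Module.finrank_mul_finrank ℚ L E
  rw [h2, ← hn1, ← hn2] at hn3
  have key := four_mul_card_range_le hσ hne hfix hspan (ι := ι) hι (s := s) hs hNs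
    (n := Units.rank L + 1)
    (by rw [index_squares_units]; congr 1; omega) (index_squares_units L)
    (fun x y hy => hneg x y hy)
  have h1 := N.range.card_mul_index
  have h3 : 0 < Nat.card N.range := Nat.card_pos
  have h4 : 2 < Nat.card (ClassGroup (𝓞 L) ⧸ N.range) := by
    change 2 < N.range.index
    rw [← h1] at key
    by_contra! h
    nlinarith
  obtain ⟨χ, ψ, hχ, hψ, hχψ⟩ := exists_two_quadraticChar (Q := ClassGroup (𝓞 L) ⧸ N.range)
    (by
      intro q
      obtain ⟨a, rfl⟩ := QuotientGroup.mk_surjective q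
      rw [← QuotientGroup.mk_pow, QuotientGroup.eq_one_iff]
      exact ⟨ι a, hNι a⟩) h4
  have htriv : ∀ χ : ClassGroup (𝓞 L) ⧸ N.range →* ℤˣ,
      ∀ (I : (Ideal (𝓞 E))⁰) (J : (Ideal (𝓞 L))⁰), Ideal.relNorm (𝓞 L) I.1 = J.1 →
      (χ.comp (QuotientGroup.mk' _)) (ClassGroup.mk0 J) = 1 := by
    intro χ I J h
    have h1 : ClassGroup.mk0 J ∈ N.range := ⟨_, hN I J h⟩
    rw [MonoidHom.comp_apply, QuotientGroup.mk'_apply, (QuotientGroup.eq_one_iff _).2 h1, map_one]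
  have hext : ∀ χ : ClassGroup (𝓞 L) ⧸ N.range →* ℤˣ,
      χ.comp (QuotientGroup.mk' _) = 1 → χ = 1 := by
    intro χ h
    refine MonoidHom.ext fun q => ?_
    obtain ⟨a, rfl⟩ := QuotientGroup.mk_surjective q
    exact DFunLike.congr_fun h a
  rcases eq_one_or_eq_one_or_eq_of_trivial_on_norms h2 _ _ (htriv χ) (htriv ψ) with h | h | h
  · exact hχ (hext _ h)
  · exact hψ (hext _ h)
  · exact hχψ (hext _ h)

end NegOneNorm

section TernaryRational
open NumberField

theorem AdjoinRoot.exists_eq_add_mul_root {F : Type*} [Field F] {f : F[X]} (hf : f.Monic)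
    (hdeg : f.natDegree = 2) (t : AdjoinRoot f) :
    ∃ r s : F, t = algebraMap F _ r + algebraMap F _ s * AdjoinRoot.root f := by
  obtain ⟨p, rfl⟩ := AdjoinRoot.mk_surjective t
  have h1 : AdjoinRoot.mk f p = AdjoinRoot.mk f (p %ₘ f) := by
    conv_lhs => rw [← modByMonic_add_div p f]
    simp
  have h2 : (p %ₘ f).natDegree ≤ 1 := by
    have := natDegree_modByMonic_lt p hf (fun h => by simp [h] at hdeg)
    omega
  obtain ⟨s, r, h3⟩ := exists_eq_X_add_C_of_natDegree_le_one h2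
  refine ⟨r, s, ?_⟩
  rw [h1, h3, map_add, map_mul, AdjoinRoot.mk_C, AdjoinRoot.mk_C, AdjoinRoot.mk_X, add_comm]
  rfl

theorem AdjoinRoot.eq_zero_of_add_mul_root {F : Type*} [Field F] {f : F[X]}
    (hdeg : f.natDegree = 2) {r s : F}
    (h : algebraMap F _ r + algebraMap F _ s * AdjoinRoot.root f = 0) : r = 0 ∧ s = 0 := by
  have h1 : AdjoinRoot.mk f (C r + C s * X) = 0 := by
    rw [map_add, map_mul, AdjoinRoot.mk_C, AdjoinRoot.mk_C, AdjoinRoot.mk_X]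
    exact h
  rw [AdjoinRoot.mk_eq_zero] at h1
  have h2 : C r + C s * X = 0 := by
    refine eq_zero_of_dvd_of_natDegree_lt h1 ?_
    rw [hdeg]
    refine (natDegree_add_le _ _).trans_lt ?_
    have := (natDegree_C_mul_le s X).trans natDegree_X_le
    rw [natDegree_C]
    omega
  have e0 := congrArg (coeff · 0) h2
  have e1 := congrArg (coeff · 1) h2
  simp only [coeff_add, coeff_C_zero, coeff_C_mul, coeff_X_zero, coeff_X_one, coeff_zero,
    coeff_C_succ, mul_zero, add_zero, zero_add, mul_one] at e0 e1
  exact ⟨e0, e1⟩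

theorem exists_isotropic_of_isTotallyComplex {L : Type*} [Field L] [NumberField L]
    [IsTotallyComplex L] {δ : L} {β a b : 𝓞 L} (hδ : δ ^ 2 = -3 * β) (hab : 3 * a + β * b = 1) :
    ∃ x y z : L, (x ≠ 0 ∨ y ≠ 0 ∨ z ≠ 0) ∧ x ^ 2 + y ^ 2 + 3 * z ^ 2 = 0 := by
  by_cases hω : ∃ ω : L, ω ^ 2 + ω + 1 = 0
  · obtain ⟨ω, hω⟩ := hω
    exact ⟨2 * ω + 1, 0, 1, by simp, by linear_combination 4 * hω⟩
  push Not at hω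
  let f : L[X] := X ^ 2 + X + 1
  have hdeg : f.natDegree = 2 := by
    simp only [f]; compute_degree!
  have hmonic : f.Monic := by
    simp only [f]; monicity!
  have hirr : Irreducible f := by
    refine (irreducible_iff_roots_eq_zero_of_degree_le_three (by omega) (by omega)).2 ?_
    refine Multiset.eq_zero_of_forall_notMem fun x hx => hω x ?_
    simpa [f] using (isRoot_of_mem_roots hx)
  have : Fact (Irreducible f) := ⟨hirr⟩
  have hfd : FiniteDimensional L (AdjoinRoot f) := (AdjoinRoot.powerBasis hirr.ne_zero).finite
  have hfr : Module.finrank L (AdjoinRoot f) = 2 := by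
    rw [(AdjoinRoot.powerBasis hirr.ne_zero).finrank, AdjoinRoot.powerBasis_dim, hdeg]
  have : CharZero (AdjoinRoot f) := charZero_of_injective_algebraMap (algebraMap L _).injective
  have : NumberField (AdjoinRoot f) := NumberField.of_module_finite L _
  have : Algebra.IsQuadraticExtension L (AdjoinRoot f) := ⟨hfr⟩
  have hgal : IsGalois L (AdjoinRoot f) := inferInstance
  set ω := AdjoinRoot.root f with hωdef
  have hroot : ω ^ 2 + ω + 1 = 0 := by
    have := AdjoinRoot.eval₂_root f
    simpa [f] using this
  obtain ⟨τ, hτ⟩ : ∃ τ : Gal(AdjoinRoot f/L), τ ≠ 1 := by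
    have hc : Nat.card Gal(AdjoinRoot f/L) = 2 := by rw [IsGalois.card_aut_eq_finrank, hfr]
    have : Finite Gal(AdjoinRoot f/L) := Nat.finite_of_card_ne_zero (by omega)
    have : Nontrivial Gal(AdjoinRoot f/L) := by
      rw [← Finite.one_lt_card_iff_nontrivial]; omega
    exact exists_ne 1
  have hτω : τ ω = -1 - ω := by
    have h1 : (τ ω) ^ 2 + τ ω + 1 = 0 := by
      rw [← map_pow, ← map_add, ← map_one τ, ← map_add, hroot, map_zero]
    have h2 : (τ ω - ω) * (τ ω - (-1 - ω)) = 0 := by linear_combination h1 - hroot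
    rcases mul_eq_zero.1 h2 with h | h
    · exfalso
      refine hτ (AlgEquiv.ext fun t => ?_)
      obtain ⟨r, s, rfl⟩ := AdjoinRoot.exists_eq_add_mul_root hmonic hdeg t
      rw [map_add, map_mul, AlgEquiv.commutes, AlgEquiv.commutes, sub_eq_zero.1 h]
      rfl
    · exact sub_eq_zero.1 h
  let σ := galRestrict (𝓞 L) L (AdjoinRoot f) (𝓞 (AdjoinRoot f)) τ
  have hσ : ∀ x, ((σ x : 𝓞 (AdjoinRoot f)) : AdjoinRoot f) = τ x := fun x =>
    algebraMap_galRestrict_apply (𝓞 L) τ x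
  have hωi : IsIntegral ℤ ω := ⟨X ^ 2 + X + 1, by monicity!, by simpa using hroot⟩
  let θ : AdjoinRoot f := 2 * ω + 1
  have hθ : θ ^ 2 = -3 := by simp only [θ]; linear_combination 4 * hroot
  have hθ0 : θ ≠ 0 := fun h => by rw [h] at hθ; norm_num at hθ
  have hτθ : τ θ = -θ := by
    simp only [θ, map_add, map_mul, map_one, hτω, map_ofNat]
    ring
  let η : AdjoinRoot f := algebraMap L _ δ / θ
  have hη : η ^ 2 = algebraMap L _ (β : L) := by
    simp only [η, div_pow, hθ, ← map_pow, hδ]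
    rw [map_mul]
    have : algebraMap L (AdjoinRoot f) (-3) = -3 := by rw [map_neg, map_ofNat]
    rw [this]
    field_simp
  have hτη : τ η = -η := by
    simp only [η]
    rw [map_div₀, hτθ, AlgEquiv.commutes, div_neg]
  have hηi : IsIntegral ℤ η := by
    refine IsIntegral.of_pow (n := 2) (by norm_num) ?_
    rw [hη]
    exact β.isIntegral_coe.map (algebraMap L (AdjoinRoot f) : L →+* _).toIntAlgHom
  have hspan : Ideal.span (Set.range fun x => σ x - x) = ⊤ := by
    rw [Ideal.eq_top_iff_one]
    let Ω : 𝓞 (AdjoinRoot f) := ⟨ω, hωi⟩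
    let H : 𝓞 (AdjoinRoot f) := ⟨η, hηi⟩
    have m1 : σ Ω - Ω ∈ Ideal.span (Set.range fun x => σ x - x) := Ideal.subset_span ⟨Ω, rfl⟩
    have m2 : σ H - H ∈ Ideal.span (Set.range fun x => σ x - x) := Ideal.subset_span ⟨H, rfl⟩
    have e : (1 : 𝓞 (AdjoinRoot f)) = (algebraMap (𝓞 L) _ b * (σ H - H)) * (σ H - H) -
        ((1 - 4 * algebraMap (𝓞 L) _ a) * -(σ Ω - Ω)) * (σ Ω - Ω) := by
      apply RingOfIntegers.ext
      have hab' := congrArg (fun t : 𝓞 L => algebraMap L (AdjoinRoot f) (t : L)) hab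
      simp only [map_add, map_mul, map_one, map_ofNat] at hab'
      have c1 : (((algebraMap (𝓞 L) (𝓞 (AdjoinRoot f)) a) : 𝓞 (AdjoinRoot f)) : AdjoinRoot f) =
        algebraMap L _ (a : L) := rfl
      have c2 : (((algebraMap (𝓞 L) (𝓞 (AdjoinRoot f)) b) : 𝓞 (AdjoinRoot f)) : AdjoinRoot f) =
        algebraMap L _ (b : L) := rfl
      simp only [map_sub, map_mul, map_one, map_neg, map_ofNat, c1, c2, hσ]
      change (1 : AdjoinRoot f) = algebraMap L _ (b : L) * (τ η - η) * (τ η - η) -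
        (1 - 4 * algebraMap L _ (a : L)) * -(τ ω - ω) * (τ ω - ω)
      rw [hτη, hτω]
      have : algebraMap L (AdjoinRoot f) (b : L) * (-η - η) * (-η - η) =
        4 * algebraMap L (AdjoinRoot f) (b : L) * algebraMap L (AdjoinRoot f) (β : L) := by
        rw [← hη]; ring
      rw [this]
      linear_combination -4 * hab' - 4 * (1 - 4 * algebraMap L (AdjoinRoot f) (a : L)) * hroot
    rw [e]
    exact sub_mem (Ideal.mul_mem_left _ _ m2) (Ideal.mul_mem_left _ _ m1)
  obtain ⟨x, y, hy, hxy⟩ := exists_norm_eq_neg_norm hfr hspan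
  have hxy' := congrArg (fun t : 𝓞 (AdjoinRoot f) => (t : AdjoinRoot f)) hxy
  simp only [map_mul, map_neg, hσ] at hxy'
  have hy0 : (y : AdjoinRoot f) ≠ 0 := by simpa using hy
  obtain ⟨r, s, hrs⟩ := AdjoinRoot.exists_eq_add_mul_root hmonic hdeg
    ((x : AdjoinRoot f) / y)
  have hN : ((x : AdjoinRoot f) / y) * τ ((x : AdjoinRoot f) / y) = -1 := by
    have : τ (y : AdjoinRoot f) ≠ 0 := (map_ne_zero_iff τ τ.injective).2 hy0
    rw [map_div₀, div_mul_div_comm, div_eq_iff (mul_ne_zero hy0 this)]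
    linear_combination hxy'
  rw [hrs, map_add, map_mul, AlgEquiv.commutes, AlgEquiv.commutes, ← hωdef, hτω] at hN
  have h1 : r ^ 2 - r * s + s ^ 2 = -1 := by
    apply (algebraMap L (AdjoinRoot f)).injective
    simp only [map_add, map_sub, map_mul, map_pow, map_neg, map_one]
    linear_combination hN + (algebraMap L (AdjoinRoot f) s) ^ 2 * hroot
  refine ⟨r - s / 2, 1, s / 2, by simp, by linear_combination h1⟩

end TernaryRational

section TernaryRepresentation
open NumberField

theorem exists_ternary_of_isotropic {F : Type*} [Field F] [CharZero F] {x y z : F}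
    (h0 : x ≠ 0 ∨ y ≠ 0 ∨ z ≠ 0) (h : x ^ 2 + y ^ 2 + 3 * z ^ 2 = 0) (β : F) :
    ∃ X Y Z : F, X ^ 2 + Y ^ 2 + 3 * Z ^ 2 = β := by
  have key : ∀ p q r t : F, t ≠ 0 → t = 2 * (p * x + q * y + 3 * (r * z)) →
      ∃ X Y Z : F, X ^ 2 + Y ^ 2 + 3 * Z ^ 2 = β := by
    intro p q r t ht e
    obtain ⟨s, hs⟩ : ∃ s : F, s * t = β - (p ^ 2 + q ^ 2 + 3 * r ^ 2) :=
      ⟨_ / t, div_mul_cancel₀ _ ht⟩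
    refine ⟨p + s * x, q + s * y, r + s * z, ?_⟩
    rw [e] at hs
    linear_combination s ^ 2 * h + hs
  rcases h0 with h0 | h0 | h0
  · exact key 1 0 0 (2 * x) (by simpa using h0) (by ring)
  · exact key 0 1 0 (2 * y) (by simpa using h0) (by ring)
  · exact key 0 0 1 (6 * z) (by simpa using h0) (by ring)

theorem exists_ternary_of_isotropic_quadratic {F : Type*} [Field F] [CharZero F]
    {β x y z x' y' z' : F} (h0 : x ≠ 0 ∨ y ≠ 0 ∨ z ≠ 0 ∨ x' ≠ 0 ∨ y' ≠ 0 ∨ z' ≠ 0)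
    (h : x ^ 2 + y ^ 2 + 3 * z ^ 2 = 3 * β * (x' ^ 2 + y' ^ 2 + 3 * z' ^ 2))
    (hb : x * x' + y * y' + 3 * (z * z') = 0) :
    ∃ X Y Z : F, X ^ 2 + Y ^ 2 + 3 * Z ^ 2 = β := by
  by_cases hD : x' ^ 2 + y' ^ 2 + 3 * z' ^ 2 = 0
  · rw [hD, mul_zero] at h
    by_cases h1 : x ≠ 0 ∨ y ≠ 0 ∨ z ≠ 0
    · exact exists_ternary_of_isotropic h1 h β
    · exact exists_ternary_of_isotropic (x := x') (y := y') (z := z') (by tauto) hD β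
  · set D := x' ^ 2 + y' ^ 2 + 3 * z' ^ 2 with hDd
    have h3 : 3 * D ≠ 0 := mul_ne_zero three_ne_zero hD
    refine ⟨3 * (y * z' - z * y') / (3 * D), 3 * (z * x' - x * z') / (3 * D),
      (x * y' - y * x') / (3 * D), ?_⟩
    field_simp
    linear_combination D * h - (x * x' + y * y' + 3 * (z * z')) * hb +
      (x ^ 2 + y ^ 2 + 3 * z ^ 2) * hDd.symm

theorem exists_ternary_of_pos {F : Type*} [Field F] [NumberField F] {β a b : 𝓞 F}
    (hab : 3 * a + β * b = 1) (hpos : ∀ σ : F →+* ℝ, 0 < σ β) :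
    ∃ x y z : F, x ^ 2 + y ^ 2 + 3 * z ^ 2 = β := by
  by_cases hsq : ∃ δ : F, δ ^ 2 = -3 * β
  · obtain ⟨δ, hδ⟩ := hsq
    have : IsTotallyComplex F := by
      refine ⟨fun v => ?_⟩
      by_contra hv
      rw [InfinitePlace.not_isComplex_iff_isReal] at hv
      have h1 := hpos (InfinitePlace.embedding_of_isReal hv)
      have h2 := congrArg (InfinitePlace.embedding_of_isReal hv) hδ
      simp only [map_pow, map_mul, map_neg, map_ofNat] at h2
      nlinarith [sq_nonneg (InfinitePlace.embedding_of_isReal hv δ)]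
    obtain ⟨x, y, z, h0, h⟩ := exists_isotropic_of_isTotallyComplex hδ hab
    exact exists_ternary_of_isotropic h0 h _
  push Not at hsq
  let f : F[X] := X ^ 2 + C (3 * (β : F))
  have hdeg : f.natDegree = 2 := natDegree_X_pow_add_C
  have hmonic : f.Monic := monic_X_pow_add_C _ two_ne_zero
  have hirr : Irreducible f := by
    refine (irreducible_iff_roots_eq_zero_of_degree_le_three (by omega) (by omega)).2 ?_
    refine Multiset.eq_zero_of_forall_notMem fun x hx => hsq x ?_
    have : x ^ 2 + 3 * β = 0 := by simpa [f] using (isRoot_of_mem_roots hx)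
    linear_combination this
  have : Fact (Irreducible f) := ⟨hirr⟩
  have hfd : FiniteDimensional F (AdjoinRoot f) := (AdjoinRoot.powerBasis hirr.ne_zero).finite
  have : CharZero (AdjoinRoot f) := charZero_of_injective_algebraMap (algebraMap F _).injective
  have : NumberField (AdjoinRoot f) := NumberField.of_module_finite F _
  set δ := AdjoinRoot.root f with hδd
  have hδ : δ ^ 2 = -3 * algebraMap F (AdjoinRoot f) β := by
    have := AdjoinRoot.eval₂_root f
    have h2 : δ ^ 2 + 3 * algebraMap F (AdjoinRoot f) β = 0 := by
      rw [← map_ofNat (algebraMap F (AdjoinRoot f)) 3]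
      simpa [f] using this
    linear_combination h2
  have : IsTotallyComplex (AdjoinRoot f) := by
    refine ⟨fun v => ?_⟩
    by_contra hv
    rw [InfinitePlace.not_isComplex_iff_isReal] at hv
    have h1 := hpos ((InfinitePlace.embedding_of_isReal hv).comp (algebraMap F (AdjoinRoot f)))
    have h2 := congrArg (InfinitePlace.embedding_of_isReal hv) hδ
    simp only [map_pow, map_mul, map_neg, map_ofNat] at h2
    rw [RingHom.comp_apply] at h1
    nlinarith [sq_nonneg (InfinitePlace.embedding_of_isReal hv δ)]
  have hab' : 3 * algebraMap (𝓞 F) (𝓞 (AdjoinRoot f)) a +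
      algebraMap (𝓞 F) (𝓞 (AdjoinRoot f)) β * algebraMap (𝓞 F) (𝓞 (AdjoinRoot f)) b = 1 := by
    rw [← map_one (algebraMap (𝓞 F) (𝓞 (AdjoinRoot f))), ← hab]
    simp only [map_add, map_mul, map_ofNat]
  obtain ⟨X, Y, Z, h0, h⟩ := exists_isotropic_of_isTotallyComplex
    (β := algebraMap (𝓞 F) (𝓞 (AdjoinRoot f)) β) hδ hab'
  obtain ⟨x, x', rfl⟩ := AdjoinRoot.exists_eq_add_mul_root hmonic hdeg X
  obtain ⟨y, y', rfl⟩ := AdjoinRoot.exists_eq_add_mul_root hmonic hdeg Y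
  obtain ⟨z, z', rfl⟩ := AdjoinRoot.exists_eq_add_mul_root hmonic hdeg Z
  rw [← hδd] at h
  obtain ⟨h1, h2⟩ := AdjoinRoot.eq_zero_of_add_mul_root hdeg
    (r := x ^ 2 + y ^ 2 + 3 * z ^ 2 - 3 * β * (x' ^ 2 + y' ^ 2 + 3 * z' ^ 2))
    (s := 2 * (x * x' + y * y' + 3 * (z * z'))) (by
      rw [← hδd]
      simp only [map_add, map_sub, map_mul, map_pow, map_ofNat]
      linear_combination h - (algebraMap F (AdjoinRoot f) x' ^ 2 +
        algebraMap F (AdjoinRoot f) y' ^ 2 + 3 * algebraMap F (AdjoinRoot f) z' ^ 2) * hδ)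
  refine exists_ternary_of_isotropic_quadratic ?_ (sub_eq_zero.1 h1)
    ((mul_eq_zero.1 h2).resolve_left two_ne_zero)
  by_contra hc
  push Not at hc
  obtain ⟨rfl, rfl, rfl, rfl, rfl, rfl⟩ := hc
  simp at h0

end TernaryRepresentation

section Approximation
open NumberField IsDedekindDomain

theorem NumberField.exists_forall_sub_mem_pow {F : Type*} [Field F] [NumberField F]
    {I : Ideal (𝓞 F)} (hI : I ≠ ⊥) (k : ℕ) (x : HeightOneSpectrum (𝓞 F) → 𝓞 F) :
    ∃ y, ∀ v : HeightOneSpectrum (𝓞 F), I ≤ v.asIdeal → y - x v ∈ v.asIdeal ^ k := by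
  have hfin := Ideal.finite_factors hI
  obtain ⟨y, hy⟩ := IsDedekindDomain.exists_forall_sub_mem_ideal (s := hfin.toFinset)
    (fun v : HeightOneSpectrum (𝓞 F) => v.asIdeal) (fun _ => k) (fun v _ => v.prime)
    (fun v _ w _ h h' => h (HeightOneSpectrum.ext h')) (fun v => x v)
  exact ⟨y, fun v hv => hy v (by simpa [Ideal.dvd_iff_le] using hv)⟩

theorem NumberField.exists_pow_sub_one_mem {F : Type*} [Field F] [NumberField F]
    {I : Ideal (𝓞 F)} (hI : I ≠ ⊥) :
    ∃ N, 0 < N ∧ ∀ x b : 𝓞 F, x * b - 1 ∈ I → x ^ N - 1 ∈ I := by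
  have : Finite (𝓞 F ⧸ I) := Ideal.finiteQuotientOfFreeOfNeBot I hI
  refine ⟨Nat.card (𝓞 F ⧸ I)ˣ, Nat.card_pos, fun x b h => ?_⟩
  have h1 : Ideal.Quotient.mk I x * Ideal.Quotient.mk I b = 1 := by
    rw [← map_mul, ← map_one (Ideal.Quotient.mk I)]
    exact Ideal.Quotient.eq.2 h
  have h2 := congrArg Units.val
    (pow_card_eq_one' (x := (⟨Ideal.Quotient.mk I x, Ideal.Quotient.mk I b, h1,
      by rw [mul_comm, h1]⟩ : (𝓞 F ⧸ I)ˣ)))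
  rw [← Ideal.Quotient.eq, map_pow, map_one]
  rwa [Units.val_pow_eq_pow_val] at h2

theorem NumberField.exists_unit_lt_one {F : Type*} [Field F] [NumberField F]
    (w₁ : InfinitePlace F) {I : Ideal (𝓞 F)} (hI : I ≠ ⊥) :
    ∃ u : (𝓞 F)ˣ, (u : 𝓞 F) - 1 ∈ I ∧ ∀ w : InfinitePlace F, w ≠ w₁ → w (u : F) < 1 := by
  obtain ⟨u, hu⟩ := Units.dirichletUnitTheorem.exists_unit F w₁
  obtain ⟨N, hN, h⟩ := exists_pow_sub_one_mem hI
  refine ⟨u ^ N, ?_, fun w hw => ?_⟩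
  · have := h u ↑u⁻¹ (by simp)
    simpa using this
  · have h0 : 0 < w (u : F) := by
      rw [InfinitePlace.pos_iff]; simp
    have h1 : w (u : F) < 1 := by
      have := hu w hw
      rwa [Real.log_neg_iff h0] at this
    have : ((u ^ N : (𝓞 F)ˣ) : F) = (u : F) ^ N := by simp
    rw [this, map_pow]
    exact pow_lt_one₀ h0.le h1 hN.ne'

theorem NumberField.InfinitePlace.exists_of_real {F : Type*} [Field F] (σ : F →+* ℝ) :
    ∃ w : InfinitePlace F, w.IsReal ∧ ∀ x, w x = |σ x| := by
  refine ⟨InfinitePlace.mk (Complex.ofRealHom.comp σ), ?_, fun x => ?_⟩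
  · rw [InfinitePlace.isReal_mk_iff, ComplexEmbedding.isReal_iff]
    ext x
    simp
  · simp [InfinitePlace.apply]

theorem exists_sub_sq_coprime_three {F : Type*} [Field F] [NumberField F]
    {w₁ : InfinitePlace F} (hw₁ : w₁.IsComplex) {α : 𝓞 F} (hα : ∀ σ : F →+* ℝ, 0 < σ α) :
    ∃ z a b : 𝓞 F, 3 * a + (α - z ^ 2) * b = 1 ∧ ∀ σ : F →+* ℝ, 0 < σ (α - z ^ 2 : 𝓞 F) := by
  classical
  have hI : Ideal.span {(3 : 𝓞 F)} ≠ ⊥ := by simp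
  obtain ⟨z, hz⟩ := exists_forall_sub_mem_pow hI 1 fun v => if α ∈ v.asIdeal then 1 else 0
  obtain ⟨u, hu, hlt⟩ := exists_unit_lt_one w₁ hI
  obtain ⟨k, hk⟩ : ∃ k : ℕ, ∀ σ : F →+* ℝ, σ z ^ 2 * (σ u ^ 2) ^ k < σ α := by
    have : ∀ᶠ k : ℕ in Filter.atTop, ∀ σ : F →+* ℝ, σ z ^ 2 * (σ u ^ 2) ^ k < σ α := by
      rw [Filter.eventually_all]
      intro σ
      obtain ⟨w, hw, hσ⟩ := InfinitePlace.exists_of_real σ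
      have h1 : |σ u| < 1 := by
        rw [← hσ]
        refine hlt w ?_
        rintro rfl
        exact InfinitePlace.not_isReal_iff_isComplex.2 hw₁ hw
      have h2 := (tendsto_pow_atTop_nhds_zero_of_lt_one (sq_nonneg (σ u))
        ((sq_lt_one_iff_abs_lt_one _).2 h1)).const_mul (σ z ^ 2)
      rw [mul_zero] at h2
      exact h2.eventually_lt_const (hα σ)
    exact this.exists
  have hcop : Ideal.span {(3 : 𝓞 F), α - (z * u ^ k) ^ 2} = ⊤ := by
    by_contra hne
    obtain ⟨m, hm, hle⟩ := Ideal.exists_le_maximal _ hne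
    have h3 : (3 : 𝓞 F) ∈ m := hle (Ideal.subset_span (by simp))
    have hβ : α - (z * u ^ k) ^ 2 ∈ m := hle (Ideal.subset_span (by simp))
    have hm0 : m ≠ ⊥ := by
      rintro rfl
      simp at h3
    have hle3 : Ideal.span {(3 : 𝓞 F)} ≤ m := (Ideal.span_singleton_le_iff_mem _).2 h3
    have hzm := hz ⟨m, hm.isPrime, hm0⟩ hle3
    have hum : (u : 𝓞 F) ∉ m := fun h => hm.ne_top (Ideal.eq_top_of_isUnit_mem _ h u.isUnit)
    simp only [pow_one] at hzm
    split_ifs at hzm with hα'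
    · have h1 : (z * u ^ k) ^ 2 ∈ m := by
        have := sub_mem hα' hβ
        rwa [sub_sub_cancel] at this
      have h2 := hm.isPrime.mem_of_pow_mem _ h1
      rcases hm.isPrime.mem_or_mem h2 with h4 | h4
      · refine hm.ne_top ((Ideal.eq_top_iff_one _).2 ?_)
        have := sub_mem h4 hzm
        rwa [sub_sub_cancel] at this
      · exact hum (hm.isPrime.mem_of_pow_mem _ h4)
    · rw [sub_zero] at hzm
      refine hα' ?_
      have : (z * u ^ k) ^ 2 ∈ m := Ideal.pow_mem_of_mem _ (Ideal.mul_mem_right _ _ hzm) _ two_pos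
      simpa using add_mem hβ this
  rw [Ideal.eq_top_iff_one, Ideal.mem_span_pair] at hcop
  obtain ⟨a, b, hab⟩ := hcop
  refine ⟨z * u ^ k, a, b, by rw [← hab]; ring, fun σ => ?_⟩
  have := hk σ
  simp only [map_sub, map_mul, map_pow]
  rw [mul_pow, ← pow_mul, mul_comm k 2, pow_mul]
  linarith

end Approximation

namespace LinearMap.BilinForm

variable {k V : Type*} [Field k] [AddCommGroup V] [Module k V] (B : LinearMap.BilinForm k V)

/-- The endomorphism `x ↦ B x u • w`. -/
def rankOne (u w : V) : Module.End k V := (B.flip u).smulRight w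

@[simp] theorem rankOne_apply (u w x : V) : B.rankOne u w x = B x u • w := rfl

/-- The reflection in the vector `g`. -/
def reflection (g : V) : Module.End k V := 1 - (2 / B g g) • B.rankOne g g

/-- The Eichler transformation attached to an isotropic vector `e` and a vector `w` orthogonal
to `e`. -/
def eichler (e w : V) : Module.End k V :=
  1 + B.rankOne e w - B.rankOne w e - (B w w / 2) • B.rankOne e e

theorem reflection_apply (g x : V) : B.reflection g x = x - (2 / B g g * B x g) • g := by
  simp [reflection, mul_smul]

theorem eichler_apply (e w x : V) :
    B.eichler e w x = x + B x e • w - B x w • e - (B w w / 2 * B x e) • e := by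
  simp [eichler, mul_smul]

variable {B}

theorem reflection_apply_of_orthogonal {g x : V} (h : B x g = 0) : B.reflection g x = x := by
  simp [reflection_apply, h]

theorem reflection_isometry (hB : B.IsSymm) {g : V} (hg : B g g ≠ 0) (x y : V) :
    B (B.reflection g x) (B.reflection g y) = B x y := by
  simp only [reflection_apply, map_sub, map_smul, LinearMap.sub_apply, LinearMap.smul_apply,
    smul_eq_mul, hB.eq g y]
  rw [hB.eq y g]
  field_simp
  ring

theorem reflection_mul_self {g : V} (hg : B g g ≠ 0) : B.reflection g * B.reflection g = 1 := by
  ext x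
  simp only [Module.End.mul_apply, reflection_apply, map_sub, map_smul,
    Module.End.one_apply]
  match_scalars
  · ring
  · field_simp
    ring

theorem mul_rankOne_mul {S T : Module.End k V} (h : ∀ x y, B (T x) y = B x (S y)) (u w : V) :
    S * B.rankOne u w * T = B.rankOne (S u) (S w) := by
  ext x
  simp [Module.End.mul_apply, h]

theorem reflection_adjoint (hB : B.IsSymm) {g : V} (x y : V) :
    B (B.reflection g x) y = B x (B.reflection g y) := by
  simp only [reflection_apply, map_sub, map_smul, LinearMap.sub_apply, LinearMap.smul_apply,
    smul_eq_mul]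
  rw [hB.eq g y]
  ring

theorem reflection_conj_eichler (hB : B.IsSymm) {g : V} (hg : B g g ≠ 0) (e w : V) :
    B.reflection g * B.eichler e w * B.reflection g =
      B.eichler (B.reflection g e) (B.reflection g w) := by
  have h := fun u w => mul_rankOne_mul (reflection_adjoint hB (g := g)) u w
  simp only [eichler, mul_add, add_mul, mul_sub, sub_mul, mul_one, reflection_mul_self hg, h,
    mul_smul_comm, smul_mul_assoc, reflection_isometry hB hg]

theorem eichler_mul [CharZero k] (hB : B.IsSymm) {e w w' : V} (he : B e e = 0) (hw : B w e = 0)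
    (hw' : B w' e = 0) : B.eichler e w * B.eichler e w' = B.eichler e (w + w') := by
  have h1 : B e w = 0 := by rw [hB.eq, hw]
  have h2 : B w w' = B w' w := hB.eq _ _
  ext x
  simp only [Module.End.mul_apply, eichler_apply, map_sub, map_add, map_smul,
    LinearMap.add_apply, he, hw', h1,
    h2]
  match_scalars <;> field_simp <;> ring

theorem eichler_smul_left (κ : k) (e w : V) : B.eichler (κ • e) w = B.eichler e (κ • w) := by
  ext x
  simp only [eichler_apply, map_smul, LinearMap.smul_apply, smul_eq_mul]
  match_scalars <;> ring

/-- A hyperbolic pair. -/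
structure IsHyperbolicPair (B : LinearMap.BilinForm k V) (e f : V) : Prop where
  left : B e e = 0
  right : B f f = 0
  pair : B e f = 1

theorem IsHyperbolicPair.symm (hB : B.IsSymm) {e f : V} (h : B.IsHyperbolicPair e f) :
    B.IsHyperbolicPair f e := ⟨h.right, h.left, by rw [hB.eq, h.pair]⟩

variable [CharZero k] {N : Submonoid (Module.End k V)}

theorem eichler_swap_mem (hB : B.IsSymm)
    (hN : ∀ g, B g g ≠ 0 → ∀ T ∈ N, B.reflection g * T * B.reflection g ∈ N) {e f : V}
    (h : B.IsHyperbolicPair e f) {w : V} (hwe : B w e = 0) (hwf : B w f = 0) {κ : k} (hκ : κ ≠ 0)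
    (hw : B.eichler e w ∈ N) : B.eichler (κ • f) w ∈ N := by
  have hg : B (κ • f - e) (κ • f - e) = -2 * κ := by
    simp only [map_sub, map_smul, LinearMap.sub_apply, LinearMap.smul_apply, smul_eq_mul, h.left,
      h.right, h.pair, (h.symm hB).pair]
    ring
  have hg0 : B (κ • f - e) (κ • f - e) ≠ 0 := by
    rw [hg]; exact mul_ne_zero (by norm_num) hκ
  have := hN _ hg0 _ hw
  rw [reflection_conj_eichler hB hg0,
    reflection_apply_of_orthogonal (x := w) (by simp [hwe, hwf])] at this
  convert this using 2
  rw [reflection_apply, hg]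
  simp only [map_sub, map_smul, smul_eq_mul, h.left, h.pair]
  have : 2 / (-2 * κ) * (κ * 1 - 0) = -1 := by field_simp; simp
  rw [this]
  module

theorem eichler_smul_mem (hB : B.IsSymm)
    (hN : ∀ g, B g g ≠ 0 → ∀ T ∈ N, B.reflection g * T * B.reflection g ∈ N) {e f : V}
    (h : B.IsHyperbolicPair e f) {w : V} (hwe : B w e = 0) (hwf : B w f = 0) (κ : k)
    (hw : B.eichler e w ∈ N) : B.eichler e (κ • w) ∈ N := by
  rcases eq_or_ne κ 0 with rfl | hκ
  · have : B.eichler e ((0 : k) • w) = 1 := by simp [eichler, rankOne]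
    rw [this]
    exact N.one_mem
  · have h1 := eichler_swap_mem hB hN h hwe hwf one_ne_zero hw
    rw [one_smul] at h1
    rw [← eichler_smul_left]
    exact eichler_swap_mem hB hN (h.symm hB) hwf hwe hκ h1

theorem eichler_mem (hB : B.IsSymm)
    (hN : ∀ g, B g g ≠ 0 → ∀ T ∈ N, B.reflection g * T * B.reflection g ∈ N) {e f : V}
    (h : B.IsHyperbolicPair e f) {s : V} (hse : B s e = 0) (hsf : B s f = 0) (hss : B s s ≠ 0)
    (hs : B.eichler e s ∈ N) {w : V} (hwe : B w e = 0) (hwf : B w f = 0) :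
    B.eichler e w ∈ N := by
  have key : ∀ w : V, B w e = 0 → B w f = 0 → B w w ≠ 0 → B s w ≠ 0 → B.eichler e w ∈ N := by
    intro w hwe hwf hww hsw
    have h1 := hN w hww _ hs
    rw [reflection_conj_eichler hB hww,
      reflection_apply_of_orthogonal (x := e) (by rw [hB.eq, hwe]), reflection_apply] at h1
    have h2 := N.mul_mem h1 (eichler_smul_mem hB hN h hse hsf (-1) hs)
    rw [eichler_mul hB h.left (by simp [hse, hwe]) (by simp [hse])] at h2
    have hc : 2 / B w w * B s w ≠ 0 := mul_ne_zero (div_ne_zero two_ne_zero hww) hsw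
    have h3 := eichler_smul_mem hB hN h (by simp [hse, hwe]) (by simp [hsf, hwf])
      (-(2 / B w w * B s w)⁻¹) h2
    convert h3 using 2
    match_scalars
    · field_simp
    · ring
  obtain ⟨κ, h1, h2⟩ : ∃ κ : k, B (w + κ • s) (w + κ • s) ≠ 0 ∧ B s (w + κ • s) ≠ 0 := by
    have e1 : ∀ κ, B s (w + κ • s) = B s w + κ * B s s := fun κ => by simp
    have e2 : ∀ κ, B (w + κ • s) (w + κ • s) = B w w + 2 * κ * B s w + κ ^ 2 * B s s := fun κ => by
      simp only [map_add, map_smul, LinearMap.add_apply, LinearMap.smul_apply, smul_eq_mul,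
        hB.eq w s]
      ring
    simp only [e1, e2]
    by_cases h0 : B w w - (B s w) ^ 2 / B s s + B s s = 0
    · refine ⟨2 - B s w / B s s, ?_, ?_⟩
      · have : B w w + 2 * (2 - B s w / B s s) * B s w + (2 - B s w / B s s) ^ 2 * B s s =
          (B w w - (B s w) ^ 2 / B s s + B s s) + 3 * B s s := by field_simp; ring
        rw [this, h0, zero_add]
        exact mul_ne_zero three_ne_zero hss
      · have : B s w + (2 - B s w / B s s) * B s s = 2 * B s s := by field_simp; ring
        rw [this]
        exact mul_ne_zero two_ne_zero hss
    · refine ⟨1 - B s w / B s s, ?_, ?_⟩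
      · convert h0 using 1
        field_simp; ring
      · have : B s w + (1 - B s w / B s s) * B s s = B s s := by field_simp; ring
        rw [this]
        exact hss
  have h3 := N.mul_mem (key _ (by simp [hwe, hse]) (by simp [hwf, hsf]) h1 h2)
    (eichler_smul_mem hB hN h hse hsf (-κ) hs)
  rw [eichler_mul hB h.left (by simp [hse, hwe]) (by simp [hse])] at h3
  convert h3 using 2
  module

end LinearMap.BilinForm

namespace LinearMap.BilinForm

section Reach

variable {k V : Type*} [Field k] [CharZero k] [AddCommGroup V] [Module k V]
  {B : LinearMap.BilinForm k V} {N : Submonoid (Module.End k V)} {e f : V}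

theorem exists_map_eq_of_pairing_ne_zero (hB : B.IsSymm) (h : B.IsHyperbolicPair e f)
    (hN : ∀ w, B w e = 0 → B w f = 0 → B.eichler e w ∈ N) {v : V} {α : k} (hv : B v v = 2 * α)
    (hb : B v e ≠ 0) : ∃ T ∈ N, T v = (α / B v e) • e + B v e • f := by
  set a := B v f with ha
  set b := B v e with hbd
  have hfe := (h.symm hB).pair
  have hev : B e v = b := hB.eq _ _
  have hfv : B f v = a := hB.eq _ _
  set w := v - a • e - b • f with hw
  have hwe : B w e = 0 := by simp [hw, h.left, hfe, ← hbd]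
  have hwf : B w f = 0 := by simp [hw, h.right, h.pair, ← ha]
  have hvw : B v w = 2 * α - 2 * a * b := by
    simp only [hw, map_sub, map_smul, smul_eq_mul, hv, ← ha, ← hbd]; ring
  have hww : B w w = 2 * α - 2 * a * b := by
    have : B w w = B v w := by
      have := congrArg (fun t => B t w) hw
      simpa only [map_sub, LinearMap.sub_apply, map_smul, LinearMap.smul_apply, hB.eq e w,
        hB.eq f w, hwe, hwf, smul_zero, sub_zero] using this
    rw [this, hvw]
  refine ⟨B.eichler e (-b⁻¹ • w), hN _ (by simp [hwe]) (by simp [hwf]), ?_⟩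
  have hve : v = a • e + b • f + w := by rw [hw]; abel
  rw [eichler_apply]
  simp only [map_smul, LinearMap.smul_apply, smul_eq_mul, hvw, hww, ← hbd]
  conv_lhs => rw [hve]
  match_scalars <;> field_simp <;> ring

theorem exists_map_eq_of_hyperbolic (hB : B.IsSymm) (h : B.IsHyperbolicPair e f)
    (hN : ∀ w, B w e = 0 → B w f = 0 → B.eichler e w ∈ N)
    (hN' : ∀ w, B w e = 0 → B w f = 0 → B.eichler f w ∈ N) {a b α : k} (hab : a * b = α) {w : V}
    (hwe : B w e = 0) (hwf : B w f = 0) (h0 : a - b * (B w w / 2) ≠ 0) :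
    ∃ T ∈ N, T (a • e + b • f) =
      (a - b * (B w w / 2)) • e + (α / (a - b * (B w w / 2))) • f := by
  have hfe := (h.symm hB).pair
  have hew : B e w = 0 := by rw [hB.eq, hwe]
  have hfw : B f w = 0 := by rw [hB.eq, hwf]
  have h1 : B.eichler e w (a • e + b • f) = (a - b * (B w w / 2)) • e + b • w + b • f := by
    rw [eichler_apply]
    simp only [map_add, map_smul, LinearMap.add_apply, LinearMap.smul_apply, smul_eq_mul, h.left,
      hfe, hew, hfw]
    match_scalars <;> ring
  set a' := a - b * (B w w / 2) with ha'
  set v := a' • e + b • w + b • f with hv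
  have hvf : B v f = a' := by simp [hv, h.pair, hwf, h.right]
  have hvv : B v v = 2 * α := by
    simp only [hv, map_add, map_smul, LinearMap.add_apply, LinearMap.smul_apply, smul_eq_mul,
      h.left, h.right, h.pair, hfe, hew, hfw, hwe, hwf, ha', ← hab]
    ring
  obtain ⟨T, hT, hTv⟩ := exists_map_eq_of_pairing_ne_zero hB (h.symm hB)
    (fun w h1 h2 => hN' w h2 h1) hvv (by rw [hvf]; exact h0)
  refine ⟨T * B.eichler e w, N.mul_mem hT (hN w hwe hwf), ?_⟩
  rw [Module.End.mul_apply, h1, hTv, hvf, add_comm]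

theorem exists_map_eq_hyperbolic (hB : B.IsSymm) (h : B.IsHyperbolicPair e f)
    (hN : ∀ w, B w e = 0 → B w f = 0 → B.eichler e w ∈ N)
    (hN' : ∀ w, B w e = 0 → B w f = 0 → B.eichler f w ∈ N) {v : V} {α : k} (hα : α ≠ 0)
    (hv : B v v = 2 * α) : ∃ T ∈ N, ∃ a b : k, a * b = α ∧ T v = a • e + b • f := by
  by_cases hb : B v e = 0
  · by_cases ha : B v f = 0
    · have h1 : B.eichler e v v = v - (2 * α) • e := by
        rw [eichler_apply, hb, hv]; simp
      have h2 : B (v - (2 * α) • e) f = -(2 * α) := by simp [ha, h.pair]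
      have h20 : -(2 * α) ≠ 0 := neg_ne_zero.2 (mul_ne_zero two_ne_zero hα)
      have hev : B e v = 0 := by rw [hB.eq, hb]
      obtain ⟨T, hT, hTv⟩ := exists_map_eq_of_pairing_ne_zero hB (h.symm hB)
        (fun w h1 h2 => hN' w h2 h1) (v := v - (2 * α) • e) (α := α)
        (by simp [hv, hb, h.left, hev]) (by rw [h2]; exact h20)
      rw [h2] at hTv
      exact ⟨T * B.eichler e v, N.mul_mem hT (hN v hb ha), _, _, mul_div_cancel₀ _ h20, by
        rw [Module.End.mul_apply, h1, hTv, add_comm]⟩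
    · obtain ⟨T, hT, hTv⟩ := exists_map_eq_of_pairing_ne_zero hB (h.symm hB)
        (fun w h1 h2 => hN' w h2 h1) hv ha
      exact ⟨T, hT, _, _, mul_div_cancel₀ _ ha, by rw [hTv, add_comm]⟩
  · obtain ⟨T, hT, hTv⟩ := exists_map_eq_of_pairing_ne_zero hB h hN hv hb
    exact ⟨T, hT, _, _, div_mul_cancel₀ _ hb, hTv⟩

end Reach

section Integral

variable {k V : Type*} [NormedField k] [IsUltrametricDist k] [CharZero k] [AddCommGroup V]
  [Module k V] {B : LinearMap.BilinForm k V} {N : Submonoid (Module.End k V)} {e f s : V} {ϖ : k}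

theorem exists_map_eq_integral_of_even (hB : B.IsSymm) (h : B.IsHyperbolicPair e f)
    (hN : ∀ w, B w e = 0 → B w f = 0 → B.eichler e w ∈ N)
    (hN' : ∀ w, B w e = 0 → B w f = 0 → B.eichler f w ∈ N)
    (hse : B s e = 0) (hsf : B s f = 0) (hs : ‖B s s / 2‖ = 1)
    {α : k} (hα1 : ‖α‖ ≤ 1) {a b : k} (hab : a * b = α) (hb : 1 < ‖b‖) {i : ℕ}
    (hi : ‖b‖ * ‖ϖ‖ ^ (2 * i) = 1) :
    ∃ T ∈ N, ∃ a' b' : k, ‖a'‖ ≤ 1 ∧ ‖b'‖ ≤ 1 ∧ T (a • e + b • f) = a' • e + b' • f := by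
  have ha : ‖a‖ < 1 := by
    rw [← hab, norm_mul] at hα1
    by_contra! h1
    nlinarith
  have h1 : ‖b * (B (ϖ ^ i • s) (ϖ ^ i • s) / 2)‖ = 1 := by
    have : b * (B (ϖ ^ i • s) (ϖ ^ i • s) / 2) = b * ϖ ^ (2 * i) * (B s s / 2) := by
      simp only [map_smul, LinearMap.smul_apply, smul_eq_mul]; ring
    rw [this, norm_mul, hs, norm_mul, norm_pow, hi, mul_one]
  have h2 : ‖a - b * (B (ϖ ^ i • s) (ϖ ^ i • s) / 2)‖ = 1 := by
    rw [sub_eq_add_neg, IsUltrametricDist.norm_add_eq_max_of_norm_ne_norm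
        (by rw [norm_neg, h1]; exact ha.ne), norm_neg, h1,
      max_eq_right ha.le]
  obtain ⟨T, hT, hT'⟩ := exists_map_eq_of_hyperbolic hB h hN hN' hab (w := ϖ ^ i • s)
    (by simp [hse]) (by simp [hsf]) (by rw [← norm_ne_zero_iff, h2]; exact one_ne_zero)
  exact ⟨T, hT, _, _, h2.le, by rw [norm_div, h2, div_one]; exact hα1, hT'⟩

theorem exists_map_eq_integral_of_one_lt (hB : B.IsSymm) (h : B.IsHyperbolicPair e f)
    (hN : ∀ w, B w e = 0 → B w f = 0 → B.eichler e w ∈ N)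
    (hN' : ∀ w, B w e = 0 → B w f = 0 → B.eichler f w ∈ N)
    (hse : B s e = 0) (hsf : B s f = 0) (hs : ‖B s s / 2‖ = 1)
    (hϖ1 : ‖ϖ‖ < 1) (hϖ0 : ϖ ≠ 0) (hϖ : ∀ x : k, x ≠ 0 → ∃ n : ℤ, ‖x‖ = ‖ϖ‖ ^ n)
    (hW : ∀ α : k, ‖α‖ = 1 → ∃ w, B w e = 0 ∧ B w f = 0 ∧ ‖1 - B w w / 2 / α‖ = ‖ϖ‖)
    {α : k} (hα : α ≠ 0) (hα1 : ‖α‖ ≤ 1) {a b : k} (hab : a * b = α) (hb : 1 < ‖b‖) :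
    ∃ T ∈ N, ∃ a' b' : k, ‖a'‖ ≤ 1 ∧ ‖b'‖ ≤ 1 ∧ T (a • e + b • f) = a' • e + b' • f := by
  have hp : 0 < ‖ϖ‖ := norm_pos_iff.2 hϖ0
  have ha0 : a ≠ 0 := by rintro rfl; exact hα (by rw [← hab, zero_mul])
  have hb0 : b ≠ 0 := by rintro rfl; exact hα (by rw [← hab, mul_zero])
  have hle : ∀ x : k, ‖x‖ < 1 → ‖x‖ ≤ ‖ϖ‖ := by
    intro x hx
    rcases eq_or_ne x 0 with rfl | hx0
    · simp
    obtain ⟨n, hn⟩ := hϖ x hx0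
    rw [hn] at hx ⊢
    have : 1 ≤ n := by
      by_contra! h0
      exact absurd hx (not_lt.2 (one_le_zpow_of_nonpos₀ hp hϖ1.le (by omega)))
    calc ‖ϖ‖ ^ n ≤ ‖ϖ‖ ^ (1 : ℤ) := zpow_le_zpow_right_of_le_one₀ hp hϖ1.le this
      _ = _ := zpow_one _
  obtain ⟨n, hn⟩ : ∃ n : ℕ, ‖b‖ * ‖ϖ‖ ^ n = 1 := by
    obtain ⟨n, hn⟩ := hϖ b hb0
    have : n ≤ 0 := by
      by_contra! h0
      rw [hn] at hb
      exact absurd hb (not_lt.2 (zpow_le_one₀ hp hϖ1.le h0.le))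
    obtain ⟨m, hm⟩ := Int.eq_ofNat_of_zero_le (neg_nonneg.2 this)
    refine ⟨m, ?_⟩
    rw [hn, ← zpow_natCast, ← zpow_add₀ hp.ne', ← hm]
    simp
  rcases Nat.even_or_odd' n with ⟨i, rfl | rfl⟩
  · exact exists_map_eq_integral_of_even hB h hN hN' hse hsf hs hα1 hab hb hn
  rcases hα1.lt_or_eq with hlt | heq
  · have h1 : ‖b * (B (ϖ ^ (i + 1) • s) (ϖ ^ (i + 1) • s) / 2)‖ = ‖ϖ‖ := by
      have : b * (B (ϖ ^ (i + 1) • s) (ϖ ^ (i + 1) • s) / 2) =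
          b * ϖ ^ (2 * i + 1) * ϖ * (B s s / 2) := by
        simp only [map_smul, LinearMap.smul_apply, smul_eq_mul]; ring
      rw [this, norm_mul, hs, norm_mul, norm_mul, norm_pow, hn, mul_one, one_mul]
    have ha : ‖a‖ < ‖ϖ‖ := by
      have h2 := hle α hlt
      rw [← hab, norm_mul] at h2
      have : 0 < ‖a‖ := norm_pos_iff.2 ha0
      nlinarith
    have h2 : ‖a - b * (B (ϖ ^ (i + 1) • s) (ϖ ^ (i + 1) • s) / 2)‖ = ‖ϖ‖ := by
      rw [sub_eq_add_neg, IsUltrametricDist.norm_add_eq_max_of_norm_ne_norm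
        (by rw [norm_neg, h1]; exact ha.ne), norm_neg, h1,
        max_eq_right ha.le]
    obtain ⟨T, hT, hT'⟩ := exists_map_eq_of_hyperbolic hB h hN hN' hab (w := ϖ ^ (i + 1) • s)
      (by simp [hse]) (by simp [hsf]) (by rw [← norm_ne_zero_iff, h2]; exact hp.ne')
    refine ⟨T, hT, _, _, h2.le.trans hϖ1.le, ?_, hT'⟩
    rw [norm_div, h2, div_le_one hp]
    exact hle α hlt
  · obtain ⟨w, hwe, hwf, hw⟩ := hW α heq
    have h1 : a - b * (B ((a / α) • w) ((a / α) • w) / 2) = a * (1 - B w w / 2 / α) := by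
      simp only [map_smul, LinearMap.smul_apply, smul_eq_mul, ← hab]
      field_simp
    have hab' : ‖a‖ * ‖b‖ = 1 := by rw [← norm_mul, hab, heq]
    have h2 : ‖a - b * (B ((a / α) • w) ((a / α) • w) / 2)‖ = ‖a‖ * ‖ϖ‖ := by
      rw [h1, norm_mul, hw]
    have hpa : 0 < ‖a‖ := norm_pos_iff.2 ha0
    have h20 : a - b * (B ((a / α) • w) ((a / α) • w) / 2) ≠ 0 := by
      rw [← norm_ne_zero_iff, h2]; positivity
    obtain ⟨T, hT, hT'⟩ := exists_map_eq_of_hyperbolic hB h hN hN' hab (w := (a / α) • w)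
      (by simp [hwe]) (by simp [hwf]) h20
    set a' := a - b * (B ((a / α) • w) ((a / α) • w) / 2)
    have hb' : ‖α / a'‖ = ‖b‖ / ‖ϖ‖ := by
      rw [norm_div, h2, heq, ← hab']
      field_simp
    obtain ⟨T', hT1, a'', b'', ha'', hb'', hT''⟩ := exists_map_eq_integral_of_even (ϖ := ϖ)
      (i := i + 1) hB h hN hN' hse hsf hs hα1 (mul_div_cancel₀ α h20)
      (by rw [hb', lt_div_iff₀ hp]; nlinarith) (by
        rw [hb', ← hn]; field_simp; ring)
    exact ⟨T' * T, N.mul_mem hT1 hT, a'', b'', ha'', hb'', by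
      rw [Module.End.mul_apply, hT', hT'']⟩

theorem exists_map_eq_integral (hB : B.IsSymm) (h : B.IsHyperbolicPair e f)
    (hN : ∀ w, B w e = 0 → B w f = 0 → B.eichler e w ∈ N)
    (hN' : ∀ w, B w e = 0 → B w f = 0 → B.eichler f w ∈ N)
    (hse : B s e = 0) (hsf : B s f = 0) (hs : ‖B s s / 2‖ = 1)
    (hϖ1 : ‖ϖ‖ < 1) (hϖ0 : ϖ ≠ 0) (hϖ : ∀ x : k, x ≠ 0 → ∃ n : ℤ, ‖x‖ = ‖ϖ‖ ^ n)
    (hW : ∀ α : k, ‖α‖ = 1 → ∃ w, B w e = 0 ∧ B w f = 0 ∧ ‖1 - B w w / 2 / α‖ = ‖ϖ‖)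
    {α : k} (hα : α ≠ 0) (hα1 : ‖α‖ ≤ 1) {v : V} (hv : B v v = 2 * α) :
    ∃ T ∈ N, ∃ a b : k, ‖a‖ ≤ 1 ∧ ‖b‖ ≤ 1 ∧ T v = a • e + b • f := by
  obtain ⟨T, hT, a, b, hab, hTv⟩ := exists_map_eq_hyperbolic hB h hN hN' hα hv
  rcases le_or_gt ‖b‖ 1 with hb | hb
  · rcases le_or_gt ‖a‖ 1 with ha | ha
    · exact ⟨T, hT, a, b, ha, hb, hTv⟩
    · obtain ⟨T', hT', b', a', hb', ha', h1⟩ := exists_map_eq_integral_of_one_lt hB (h.symm hB)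
        (fun w h1 h2 => hN' w h2 h1) (fun w h1 h2 => hN w h2 h1) hsf hse hs hϖ1 hϖ0 hϖ
        (fun α hα => (hW α hα).imp fun w h => ⟨h.2.1, h.1, h.2.2⟩) hα hα1
        (by rw [mul_comm]; exact hab) ha
      exact ⟨T' * T, N.mul_mem hT' hT, a', b', ha', hb', by
        rw [Module.End.mul_apply, hTv, add_comm, h1, add_comm]⟩
  · obtain ⟨T', hT', a', b', ha', hb', h1⟩ := exists_map_eq_integral_of_one_lt hB h hN hN' hse hsf
      hs hϖ1 hϖ0 hϖ hW hα hα1 hab hb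
    exact ⟨T' * T, N.mul_mem hT' hT, a', b', ha', hb', by
      rw [Module.End.mul_apply, hTv, h1]⟩

end Integral

end LinearMap.BilinForm

/-- The quadratic form `W² + WX + X² + Y² + Z²`. -/
def quat {A : Type*} [CommRing A] (v : Fin 4 → A) : A :=
  v 0 ^ 2 + v 0 * v 1 + v 1 ^ 2 + v 2 ^ 2 + v 3 ^ 2

/-- The polar form of `quat`. -/
def quatPolar (A : Type*) [CommRing A] : LinearMap.BilinForm A (Fin 4 → A) :=
  LinearMap.mk₂ A (fun v w => 2 * (v 0 * w 0) + v 0 * w 1 + v 1 * w 0 + 2 * (v 1 * w 1)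
    + 2 * (v 2 * w 2) + 2 * (v 3 * w 3))
    (fun _ _ _ => by simp only [Pi.add_apply]; ring)
    (fun _ _ _ => by simp only [Pi.smul_apply, smul_eq_mul]; ring)
    (fun _ _ _ => by simp only [Pi.add_apply]; ring)
    (fun _ _ _ => by simp only [Pi.smul_apply, smul_eq_mul]; ring)

theorem quatPolar_apply {A : Type*} [CommRing A] (v w : Fin 4 → A) :
    quatPolar A v w = 2 * (v 0 * w 0) + v 0 * w 1 + v 1 * w 0 + 2 * (v 1 * w 1)
      + 2 * (v 2 * w 2) + 2 * (v 3 * w 3) := rfl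

theorem quatPolar_isSymm (A : Type*) [CommRing A] : (quatPolar A).IsSymm :=
  ⟨fun v w => by simp only [quatPolar_apply]; ring⟩

theorem quatPolar_self {A : Type*} [CommRing A] (v : Fin 4 → A) :
    quatPolar A v v = 2 * quat v := by
  simp only [quatPolar_apply, quat]; ring

theorem quat_sub_smul {A : Type*} [CommRing A] (v n : Fin 4 → A) (ε : A) :
    quat (v - ε • n) = quat v - ε * quatPolar A v n + ε ^ 2 * quat n := by
  simp only [quatPolar_apply, quat, Pi.sub_apply, Pi.smul_apply, smul_eq_mul]; ring

theorem quat_map {A C : Type*} [CommRing A] [CommRing C] (f : A →+* C) (v : Fin 4 → A) :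
    quat (fun i => f (v i)) = f (quat v) := by
  simp [quat]

theorem quatPolar_map {A C : Type*} [CommRing A] [CommRing C] (f : A →+* C) (v w : Fin 4 → A) :
    quatPolar C (fun i => f (v i)) (fun i => f (w i)) = f (quatPolar A v w) := by
  simp [quatPolar_apply, map_ofNat]

section Valuation

variable {F Γ : Type*} [Field F] [LinearOrderedCommGroupWithZero Γ] (v : Valuation F Γ)

theorem Valuation.map_natCast_le_one (n : ℕ) : v n ≤ 1 := by
  induction n with
  | zero => simp
  | succ n ih => push_cast; exact (v.map_add _ _).trans (max_le ih (by simp))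

theorem Valuation.map_quat_le {x : Fin 4 → F} (hx : ∀ i, v (x i) ≤ 1) : v (quat x) ≤ 1 := by
  have h2 (i) : v (x i ^ 2) ≤ 1 := by rw [map_pow]; exact pow_le_one' (hx i) 2
  have h01 : v (x 0 * x 1) ≤ 1 := by rw [map_mul]; exact mul_le_one' (hx 0) (hx 1)
  exact v.map_add_le (v.map_add_le (v.map_add_le (v.map_add_le (h2 0) h01) (h2 1)) (h2 2)) (h2 3)

theorem Valuation.map_quatPolar_le {x y : Fin 4 → F} (hx : ∀ i, v (x i) ≤ 1)
    (hy : ∀ i, v (y i) ≤ 1) : v (quatPolar F x y) ≤ 1 := by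
  have h (i j) : v (x i * y j) ≤ 1 := by rw [map_mul]; exact mul_le_one' (hx i) (hy j)
  have h2 (i j) : v (2 * (x i * y j)) ≤ 1 := by
    rw [map_mul]; exact mul_le_one' (v.map_natCast_le_one 2) (h i j)
  rw [quatPolar_apply]
  exact v.map_add_le (v.map_add_le (v.map_add_le (v.map_add_le (v.map_add_le (h2 0 0) (h 0 1))
    (h 1 0)) (h2 1 1)) (h2 2 2)) (h2 3 3)

theorem Valuation.exists_reflection_integral [CharZero F] (h6 : v 6 < 1) {x n : Fin 4 → F}
    (hn : ∀ i, v (n i) ≤ 1) {D : F} (hD1 : v D ≤ 1) (hD : ∀ i, v (D * x i) ≤ 1)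
    (hx0 : quat x ≠ 0) (hq : v (quat n - quat x) ≤ v (24 * quat x * D)) :
    ∃ s : F, (s = 1 ∨ s = -1) ∧ ∀ ε : F, v ε ≤ 1 → v (ε - s) ≤ v (24 * quat x * D) →
      quat (x - ε • n) ≠ 0 ∧
      ∀ i, v ((x - (quatPolar F x (x - ε • n) / quat (x - ε • n)) • (x - ε • n)) i) ≤ 1 := by
  set α := quat x with hα
  have h4α : 4 * α ≠ 0 := mul_ne_zero (by norm_num) hx0
  have hv4 : 0 < v (4 * α) := by rw [Valuation.pos_iff]; exact h4α
  have hlt : v (24 * α) < v (4 * α) := by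
    rw [show 24 * α = 6 * (4 * α) by ring, map_mul]
    exact mul_lt_of_lt_one_left hv4 h6
  have hlt' : v (24 * α * D) < v (4 * α) := by
    rw [map_mul]; exact (mul_le_of_le_one_right' hD1).trans_lt hlt
  have hBn : v (D * quatPolar F x n) ≤ 1 := by
    rw [← smul_eq_mul, ← LinearMap.smul_apply, ← map_smul]
    exact v.map_quatPolar_le (x := D • x) hD hn
  have hs : ∃ s : F, (s = 1 ∨ s = -1) ∧ v (4 * α) ≤ v (quat (x - s • n)) := by
    by_contra! hc
    have h1 := hc 1 (Or.inl rfl)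
    have h2 := hc (-1) (Or.inr rfl)
    rw [quat_sub_smul] at h1 h2
    have h3 := v.map_add_lt h1 h2
    have h4 : v (2 * (quat n - α)) < v (4 * α) := by
      rw [map_mul]
      exact (mul_le_of_le_one_left' (v.map_natCast_le_one 2)).trans_lt (hq.trans_lt hlt')
    have h5 := v.map_sub_lt h3 h4
    rw [← hα] at h5
    exact absurd h5 (not_lt.2 (le_of_eq (by congr 1; ring)))
  obtain ⟨s, hs, hs4⟩ := hs
  have hs1 : v s = 1 := by rcases hs with rfl | rfl <;> simp
  have hs2 : s ^ 2 = 1 := by rcases hs with rfl | rfl <;> simp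
  refine ⟨s, hs, fun ε hε1 hε => ?_⟩
  have hqn := v.map_quat_le hn
  have hsq : v ((ε ^ 2 - 1) * quat n) ≤ v (24 * α * D) := by
    rw [← hs2, show (ε ^ 2 - s ^ 2) * quat n = (ε - s) * (ε + s) * quat n by ring, map_mul, map_mul]
    exact (mul_le_of_le_one_right' hqn).trans
      ((mul_le_of_le_one_right' (v.map_add_le hε1 hs1.le)).trans hε)
  have ht : v (4 * α) ≤ v (quat (x - ε • n)) := by
    have h1 : quat (x - ε • n) =
        quat (x - s • n) + ((ε ^ 2 - 1) * quat n - (ε - s) * quatPolar F x n) := by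
      rw [quat_sub_smul, quat_sub_smul, hs2]; ring
    have h2 : v ((ε - s) * quatPolar F x n) < v (4 * α) := by
      rw [map_mul]
      refine (mul_le_mul_left hε _).trans_lt ?_
      rw [← map_mul, mul_assoc, map_mul]
      exact (mul_le_of_le_one_right' hBn).trans_lt hlt
    rw [h1, v.map_add_eq_of_lt_left]
    · exact hs4
    · exact (v.map_sub_lt (hsq.trans_lt hlt') h2).trans_le hs4
  have ht0 : quat (x - ε • n) ≠ 0 := by
    rw [← v.pos_iff]; exact hv4.trans_le ht
  refine ⟨ht0, fun i => ?_⟩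
  set t := x - ε • n with htd
  have hη : v (ε ^ 2 * quat n - α) ≤ v (24 * α * D) := by
    rw [show ε ^ 2 * quat n - α = (ε ^ 2 - 1) * quat n + (quat n - α) by ring]
    exact v.map_add_le hsq hq
  have h1 : (x - (quatPolar F x t / quat t) • t) i =
      ε * n i + (ε ^ 2 * quat n - α) / quat t * t i := by
    have h2 : quatPolar F x t = α + quat t - ε ^ 2 * quat n := by
      rw [htd, quat_sub_smul, _root_.map_sub, map_smul, quatPolar_self, smul_eq_mul]; ring
    have h3 : x i = t i + ε * n i := by simp [htd]
    rw [Pi.sub_apply, Pi.smul_apply, smul_eq_mul, h2, h3]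
    field_simp; ring
  have hεn : v (ε * n i) ≤ 1 := by rw [map_mul]; exact mul_le_one' hε1 (hn i)
  rw [h1]
  refine v.map_add_le hεn ?_
  have h4 : v ((ε ^ 2 * quat n - α) / quat t) ≤ v D := by
    rw [_root_.map_div₀]
    refine div_le_of_le_mul₀ zero_le zero_le (hη.trans ?_)
    rw [show 24 * α * D = D * (6 * (4 * α)) by ring, map_mul]
    refine mul_le_mul_right ?_ _
    rw [map_mul]
    exact (mul_le_of_le_one_left' h6.le).trans ht
  rw [map_mul]
  refine (mul_le_mul_left h4 _).trans ?_
  rw [← map_mul, htd, Pi.sub_apply, Pi.smul_apply, smul_eq_mul, mul_sub]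
  refine v.map_sub_le (hD i) ?_
  rw [map_mul]
  exact mul_le_one' hD1 hεn

end Valuation

theorem Int.exists_six_pow_dvd (k : ℕ) : ∃ w : ℤ, (6 : ℤ) ∣ w ∧ (6 : ℤ) ^ k ∣ w ^ 2 + w + 6 := by
  induction k with
  | zero => exact ⟨0, by simp, by simp⟩
  | succ k ih =>
    obtain ⟨w, ⟨a, ha⟩, ⟨b, hb⟩⟩ := ih
    refine ⟨-(w ^ 2 + 6), ?_, ?_⟩
    · exact Dvd.intro (-(6 * a ^ 2 + 1)) (by rw [ha]; ring)
    · refine Dvd.intro (b * (6 * a ^ 2 - a + 1)) ?_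
      subst ha
      rw [show (-((6 * a) ^ 2 + 6)) ^ 2 + -((6 * a) ^ 2 + 6) + 6 =
        ((6 * a) ^ 2 + 6 * a + 6) * (6 * (6 * a ^ 2 - a + 1)) by ring, hb]
      ring

section
open NumberField IsDedekindDomain

variable {F : Type*} [Field F] [NumberField F]

theorem exists_quat_sub_mem_six_pow (α : 𝓞 F) (k : ℕ) :
    ∃ n : Fin 4 → 𝓞 F, (6 : 𝓞 F) ^ k ∣ quat n - α := by
  obtain ⟨w, -, b, hb⟩ := Int.exists_six_pow_dvd k
  have hcop : IsCoprime (23 : ℤ) (6 ^ k) := IsCoprime.pow_right ⟨-1, 4, by norm_num⟩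
  obtain ⟨c, d, hcd⟩ := hcop
  have hb' : (w : 𝓞 F) ^ 2 + w + 6 = 6 ^ k * b := by exact_mod_cast congrArg (Int.cast (R := 𝓞 F)) hb
  have hcd' : (c : 𝓞 F) * 23 + d * 6 ^ k = 1 := by
    exact_mod_cast congrArg (Int.cast (R := 𝓞 F)) hcd
  refine ⟨![α * c * w + (-1 - w), α * c + 1, α * c + 1, 2 * (α * c) + 2],
    b * ((α * c) ^ 2 + 1 - 2 * α * c) - α * d, ?_⟩
  simp only [quat, Matrix.cons_val]
  linear_combination ((α * c) ^ 2 + 1 - 2 * α * c) * hb' + α * hcd'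

theorem HeightOneSpectrum.exists_mem_pow_valuation_lt (v : HeightOneSpectrum (𝓞 F)) {x : 𝓞 F}
    (hx : x ≠ 0) : ∃ k, ∀ y ∈ v.asIdeal ^ k, v.valuation F y < v.valuation F x := by
  by_contra! h
  have h1 : ∀ k, x ∈ v.asIdeal ^ k := fun k => by
    obtain ⟨y, hy, hle⟩ := h k
    rw [← v.intValuation_le_pow_iff_mem] at hy ⊢
    rw [HeightOneSpectrum.valuation_of_algebraMap, HeightOneSpectrum.valuation_of_algebraMap] at hle
    exact hle.trans hy
  have h2 : x ∈ ⨅ k, v.asIdeal ^ k := by rw [Ideal.mem_iInf]; exact h1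
  rw [Ideal.iInf_pow_eq_bot_of_isDomain _ v.isPrime.ne_top] at h2
  exact hx h2

/-- An element represented by `quat` over the field is represented by a vector which is integral
at the primes above `2` and `3`. -/
theorem exists_quat_eq_integral_at_six {α : 𝓞 F} (hα : α ≠ 0) {x : Fin 4 → F}
    (hx : quat x = α) : ∃ y : Fin 4 → F, quat y = α ∧
      ∀ v : HeightOneSpectrum (𝓞 F), (6 : 𝓞 F) ∈ v.asIdeal → ∀ i, v.valuation F (y i) ≤ 1 := by
  obtain ⟨D, hD⟩ := IsLocalization.exist_integer_multiples_of_finite (nonZeroDivisors (𝓞 F)) x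
  have hD0 : (D : 𝓞 F) ≠ 0 := nonZeroDivisors.coe_ne_zero D
  have h0 : 24 * α * (D : 𝓞 F) ≠ 0 := mul_ne_zero (mul_ne_zero (by norm_num) hα) hD0
  have h6 : Ideal.span {(6 : 𝓞 F)} ≠ ⊥ := by simp
  have hmem (v : HeightOneSpectrum (𝓞 F)) :
      Ideal.span {(6 : 𝓞 F)} ≤ v.asIdeal ↔ (6 : 𝓞 F) ∈ v.asIdeal := by
    rw [Ideal.span_singleton_le_iff_mem]
  obtain ⟨k, hk⟩ : ∃ k, ∀ v : HeightOneSpectrum (𝓞 F), (6 : 𝓞 F) ∈ v.asIdeal →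
      ∀ y ∈ v.asIdeal ^ k, v.valuation F y < v.valuation F (24 * α * (D : 𝓞 F) : 𝓞 F) := by
    have hfin := Ideal.finite_factors h6
    choose K hK using fun v : HeightOneSpectrum (𝓞 F) =>
      HeightOneSpectrum.exists_mem_pow_valuation_lt v h0
    refine ⟨hfin.toFinset.sup K, fun v hv y hy => hK v y (Ideal.pow_le_pow_right ?_ hy)⟩
    exact Finset.le_sup (f := K) (by simpa [Ideal.dvd_iff_le] using hv)
  obtain ⟨n, hn⟩ := exists_quat_sub_mem_six_pow α k
  set n' : Fin 4 → F := fun i => algebraMap (𝓞 F) F (n i) with hn'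
  have hqn' : quat n' - quat x = algebraMap (𝓞 F) F (quat n - α) := by
    rw [hn', quat_map, hx, map_sub]
  have hc : algebraMap (𝓞 F) F (24 * α * D) = 24 * (α : F) * algebraMap (𝓞 F) F D := by
    rw [map_mul, map_mul, map_ofNat]
  have key (v : HeightOneSpectrum (𝓞 F)) (hv : (6 : 𝓞 F) ∈ v.asIdeal) :=
    (v.valuation F).exists_reflection_integral (x := x) (n := n') (D := algebraMap (𝓞 F) F D)
      (by
        have := (v.valuation_lt_one_iff_mem (K := F) 6).2 hv
        rw [← map_ofNat (algebraMap (𝓞 F) F) 6]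
        exact this)
      (fun i => v.valuation_le_one (n i)) (v.valuation_le_one _)
      (fun i => by
        obtain ⟨y, hy⟩ := hD i
        have : algebraMap (𝓞 F) F D * x i = algebraMap (𝓞 F) F y := by
          rw [hy]; simp [Algebra.smul_def]
        rw [this]; exact v.valuation_le_one y)
      (by rw [hx]; simpa using hα)
      (by
        rw [hqn', hx]
        have := hk v hv (quat n - α) (by
          obtain ⟨c, hc⟩ := hn
          rw [hc]
          exact Ideal.mul_mem_right _ _ (Ideal.pow_mem_pow hv k))
        rw [← hc]
        exact this.le)
  have key2 (v : HeightOneSpectrum (𝓞 F)) : ∃ s : 𝓞 F, (6 : 𝓞 F) ∈ v.asIdeal → ∀ ε : 𝓞 F,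
      ε - s ∈ v.asIdeal ^ k → quat (x - (ε : F) • n') ≠ 0 ∧
      ∀ i, v.valuation F ((x - (quatPolar F x (x - (ε : F) • n') / quat (x - (ε : F) • n')) •
        (x - (ε : F) • n')) i) ≤ 1 := by
    by_cases hv : (6 : 𝓞 F) ∈ v.asIdeal
    · obtain ⟨s, hs, h⟩ := key v hv
      obtain ⟨s', hs'⟩ : ∃ s' : 𝓞 F, (s' : F) = s := by
        rcases hs with rfl | rfl
        · exact ⟨1, by simp⟩
        · exact ⟨-1, by simp⟩
      refine ⟨s', fun _ ε hε => h ε (v.valuation_le_one ε) ?_⟩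
      have := hk v hv _ hε
      rw [hx, ← hs', ← hc, ← map_sub]
      exact this.le
    · exact ⟨0, fun h => absurd h hv⟩
  choose s hs using key2
  obtain ⟨ε, hε⟩ := exists_forall_sub_mem_pow h6 k s
  obtain ⟨v₀, hv₀⟩ : ∃ v : HeightOneSpectrum (𝓞 F), (6 : 𝓞 F) ∈ v.asIdeal := by
    have hne : Ideal.span {(6 : 𝓞 F)} ≠ ⊤ := by
      rw [Ne, Ideal.span_singleton_eq_top]
      intro hu
      obtain ⟨u, hu⟩ := hu.exists_right_inv
      have h1 : algebraMap ℚ F (1 / 6) = u := by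
        have h2 := congrArg (algebraMap (𝓞 F) F) hu
        rw [map_mul, map_ofNat, map_one] at h2
        rw [_root_.map_div₀, map_one, map_ofNat, div_eq_iff (by norm_num), ← h2, mul_comm]
      have h2 : IsIntegral ℤ (algebraMap ℚ F (1 / 6)) := by
        rw [h1]; exact u.isIntegral_coe
      rw [isIntegral_algebraMap_iff (algebraMap ℚ F).injective,
        IsIntegrallyClosed.isIntegral_iff] at h2
      obtain ⟨y, hy⟩ := h2
      have h3 : y * 6 = 1 := by
        have : (y : ℚ) * 6 = 1 := by rw [eq_intCast] at hy; rw [hy]; norm_num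
        exact_mod_cast this
      omega
    obtain ⟨M, hM, hle⟩ := Ideal.exists_le_maximal _ hne
    refine ⟨⟨M, hM.isPrime, ?_⟩, hle (Ideal.mem_span_singleton_self _)⟩
    rintro rfl
    exact h6 (le_bot_iff.1 hle)
  have ht0 := (hs v₀ hv₀ ε (hε v₀ ((hmem v₀).2 hv₀))).1
  refine ⟨_, ?_, fun v hv => (hs v hv ε (hε v ((hmem v).2 hv))).2⟩
  rw [quat_sub_smul, hx]
  field_simp
  ring

end

section Pell
open NumberField IsDedekindDomain

theorem AdjoinRoot.irreducible_sq_add_C {F : Type*} [Field F] [CharZero F] {c : ℕ}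
    (hns : ¬ ∃ x : F, x ^ 2 = -(c : F)) : Irreducible (X ^ 2 + C (c : F)) := by
  refine (irreducible_iff_roots_eq_zero_of_degree_le_three
    (by rw [natDegree_X_pow_add_C]) (by rw [natDegree_X_pow_add_C]; norm_num)).2 ?_
  refine Multiset.eq_zero_of_forall_notMem fun x hx => hns ⟨x, ?_⟩
  have := isRoot_of_mem_roots hx
  rw [IsRoot.def, eval_add, eval_pow, eval_X, eval_C] at this
  linear_combination this

section Abstract

variable {F E : Type*} [Field F] [NumberField F] [Field E] [NumberField E] [Algebra F E]
  {c : ℕ} {δ : E} {τ : E →ₐ[F] E}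

theorem exists_integral_coordinates (hδ : δ ^ 2 = -(c : E)) (hτ : τ δ = -δ)
    (hgen : ∀ t : E, ∃ r s : F, t = algebraMap F E r + algebraMap F E s * δ) (m : ℕ)
    {t : E} {y : E} (hy : IsIntegral ℤ y) (ht : t = 1 + 2 * c * m * y) :
    ∃ a b : 𝓞 F, t = algebraMap F E a + m * algebraMap F E b * δ := by
  obtain ⟨r, s, hrs⟩ := hgen y
  have hτy : τ y = algebraMap F E r - algebraMap F E s * δ := by
    rw [hrs, map_add, map_mul, τ.commutes, τ.commutes, hτ]; ring
  have hτi : IsIntegral ℤ (τ y) := hy.map (τ : E →+* E).toIntAlgHom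
  have hδi : IsIntegral ℤ δ := by
    refine IsIntegral.of_pow (n := 2) (by norm_num) ?_
    rw [hδ]
    exact (isIntegral_natCast c).neg
  have h1 : IsIntegral ℤ (2 * r) := by
    have : IsIntegral ℤ (algebraMap F E (2 * r)) := by
      rw [map_mul, map_ofNat, show 2 * algebraMap F E r = y + τ y by rw [hrs] at hτy ⊢; rw [hτy]; ring]
      exact hy.add hτi
    exact (isIntegral_algebraMap_iff (algebraMap F E).injective).1 this
  have h2 : IsIntegral ℤ (2 * c * s) := by
    have : IsIntegral ℤ (algebraMap F E (2 * c * s)) := by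
      have : algebraMap F E (2 * c * s) = -(δ * (y - τ y)) := by
        rw [hτy, hrs, map_mul, map_mul, map_ofNat, map_natCast]
        linear_combination 2 * (algebraMap F E s) * hδ
      rw [this]
      exact (hδi.mul (hy.sub hτi)).neg
    exact (isIntegral_algebraMap_iff (algebraMap F E).injective).1 this
  let r' : 𝓞 F := ⟨2 * r, h1⟩
  let s' : 𝓞 F := ⟨2 * c * s, h2⟩
  have e1 : ((1 + c * m * r' : 𝓞 F) : F) = 1 + c * m * (2 * r) := by
    push_cast; rfl
  have e2 : (s' : F) = 2 * c * s := rfl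
  refine ⟨1 + c * m * r', s', ?_⟩
  rw [e1, e2, ht, hrs]
  simp only [map_add, map_mul, map_one, map_natCast, map_ofNat]
  ring

theorem exists_pell_of_extension (hδ : δ ^ 2 = -(c : E)) (hτ : τ δ = -δ)
    (hgen : ∀ t : E, ∃ r s : F, t = algebraMap F E r + algebraMap F E s * δ) (hc : 0 < c)
    {w₁ : InfinitePlace F} (hw₁ : w₁.IsComplex) {m : ℕ} (hm : 0 < m) :
    ∃ a b : 𝓞 F, b ≠ 0 ∧ a ^ 2 + c * (m * b) ^ 2 = 1 := by
  have hδ0 : δ ≠ 0 := by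
    rintro rfl
    have : (c : E) ≠ 0 := by exact_mod_cast hc.ne'
    apply this
    linear_combination hδ
  have hττ (t : E) : τ (τ t) = t := by
    obtain ⟨r, s, rfl⟩ := hgen t
    simp [hτ]
  obtain ⟨W, hW⟩ := InfinitePlace.comap_surjective (K := E) w₁
  replace hW : W.comap (algebraMap F E) = w₁ := hW
  have hWτ : W.comap (τ : E →+* E) ≠ W := by
    intro h
    rw [← InfinitePlace.mk_embedding W, InfinitePlace.comap_mk, InfinitePlace.mk_eq_iff] at h
    rcases h with h | h
    · have h1 := RingHom.congr_fun h δ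
      simp only [RingHom.comp_apply, RingHom.coe_coe, hτ, map_neg] at h1
      exact hδ0 ((map_eq_zero W.embedding).1 (by linear_combination -h1 / 2))
    · refine (InfinitePlace.not_isReal_iff_isComplex.2 hw₁) ?_
      rw [← hW, ← InfinitePlace.mk_embedding W, InfinitePlace.comap_mk,
        InfinitePlace.isReal_mk_iff, ComplexEmbedding.isReal_iff]
      ext x
      have h1 := RingHom.congr_fun h (algebraMap F E x)
      simp only [RingHom.comp_apply, RingHom.coe_coe, AlgHom.commutes,
        ComplexEmbedding.conjugate_coe_eq] at h1 ⊢
      simp [h1]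
  have hI : Ideal.span {((2 * c * m : ℕ) : 𝓞 E)} ≠ ⊥ := by
    rw [Ne, Ideal.span_singleton_eq_bot]
    exact_mod_cast (by positivity : (2 * c * m) ≠ 0)
  obtain ⟨u, hu1, hu⟩ := exists_unit_lt_one W hI
  obtain ⟨y, hy⟩ := Ideal.mem_span_singleton'.1 hu1
  have hyu : (u : E) = 1 + 2 * c * m * y := by
    have := congrArg (fun t : 𝓞 E => (t : E)) hy
    simp only [map_mul, map_sub, map_one, map_natCast] at this
    push_cast at this
    linear_combination -this
  have hu0 : (u : E) ≠ 0 := by simp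
  have hτu0 : τ (u : E) ≠ 0 := (map_ne_zero_iff τ τ.toRingHom.injective).2 hu0
  have hui : IsIntegral ℤ ((u : E)⁻¹) := by
    have := (u⁻¹ : (𝓞 E)ˣ).val.isIntegral_coe
    simpa using this
  have hyi : IsIntegral ℤ (y : E) := y.isIntegral_coe
  have hmap {x : E} (hx : IsIntegral ℤ x) : IsIntegral ℤ (τ x) :=
    hx.map (τ : E →+* E).toIntAlgHom
  have hε : (u : E) / τ u = 1 + 2 * c * m * ((y - τ y) * τ (u : E)⁻¹) := by
    rw [map_inv₀]
    have h2 : τ (u : E) = 1 + 2 * c * m * τ (y : E) := by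
      rw [hyu]; simp [map_ofNat]
    field_simp
    linear_combination hyu - h2
  obtain ⟨a, b, hab⟩ := exists_integral_coordinates hδ hτ hgen m
    ((hyi.sub (hmap hyi)).mul (hmap hui)) hε
  have hτε : τ ((u : E) / τ u) = algebraMap F E a - m * algebraMap F E b * δ := by
    rw [hab]; simp [hτ, sub_eq_add_neg]
  have hN : ((u : E) / τ u) * τ ((u : E) / τ u) = 1 := by
    rw [_root_.map_div₀, hττ]; field_simp
  refine ⟨a, b, ?_, ?_⟩
  · rintro rfl
    have h1 : (u : E) / τ u = τ ((u : E) / τ u) := by rw [hτε, hab]; simp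
    rw [_root_.map_div₀, hττ, div_eq_div_iff hτu0 hu0] at h1
    have h2 : W (u : E) = W (τ u) := by
      have := congrArg W h1
      rw [map_mul, map_mul] at this
      nlinarith [W.1.nonneg (u : E), W.1.nonneg (τ (u : E)), this, W.pos_iff.2 hu0, W.pos_iff.2 hτu0]
    have h3 : (1 : ℝ) ≤ W (u : E) :=
      InfinitePlace.one_le_of_lt_one (a := (u : 𝓞 E)) (Units.ne_zero u) (fun w hw => hu w hw)
    have h4 := hu _ hWτ
    rw [InfinitePlace.comap_apply] at h4
    exact absurd h3 (not_le.2 (h2.trans_lt h4))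
  · have h1 : algebraMap F E ((a ^ 2 + c * (m * b) ^ 2 : 𝓞 F) : F) = algebraMap F E ((1 : 𝓞 F) : F) := by
      rw [hτε, hab] at hN
      simp only [map_add, map_mul, map_pow, map_natCast, map_one]
      linear_combination hN + (m * algebraMap F E b) ^ 2 * hδ
    exact RingOfIntegers.coe_injective ((algebraMap F E).injective h1)

end Abstract

end Pell

section Pell
open NumberField IsDedekindDomain

theorem IsUltrametricDist.norm_le_one_of_isIntegral {k : Type*} [NormedField k]
    [IsUltrametricDist k] {x : k} (hx : IsIntegral ℤ x) : ‖x‖ ≤ 1 := by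
  have h := (Valuation.integer.integers (NormedField.valuation (K := k))).mem_of_integral
    (x := x) (hx.tower_top)
  have h1 : ‖x‖₊ ≤ 1 := by simpa [Valuation.mem_integer_iff] using h
  exact_mod_cast h1

section Abstract

variable {F E k : Type*} [Field F] [NumberField F] [Field E] [NumberField E] [Algebra F E]
  [NormedField k] [IsUltrametricDist k] {c : ℕ} {δ : E} {τ : E →ₐ[F] E}

theorem exists_pell_at_prime_of_extension (hδ : δ ^ 2 = -(c : E)) (hτ : τ δ = -δ)
    (hgen : ∀ t : E, ∃ r s : F, t = algebraMap F E r + algebraMap F E s * δ) (hc : 0 < c)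
    (ι : E →+* k) {p : Ideal (𝓞 F)} [p.IsMaximal]
    (hp : ∀ x : 𝓞 F, x ∈ p ↔ ‖ι (algebraMap F E x)‖ < 1) {ℓ : ℕ} (hℓ : ℓ.Prime) (hℓ2 : ℓ ≠ 2)
    (hℓp : (ℓ : 𝓞 F) ∈ p) (hℓc : ¬ ℓ ∣ c) (hκ : ‖ι δ - 1‖ < 1) :
    ∃ a b : 𝓞 F, ‖ι (algebraMap F E a) + ι (algebraMap F E b) * ι δ‖ < 1 ∧
      ‖ι (algebraMap F E a) - ι (algebraMap F E b) * ι δ‖ = 1 ∧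
      ∀ r : Ideal (𝓞 F), r.IsPrime → r ≠ p → a ^ 2 + c * b ^ 2 ∉ r := by
  have hle (x : 𝓞 E) : ‖ι x‖ ≤ 1 := by
    refine IsUltrametricDist.norm_le_one_of_isIntegral ?_
    exact x.isIntegral_coe.map ι.toIntAlgHom
  have hℓι : ‖(ℓ : k)‖ < 1 := by
    have := (hp ℓ).1 hℓp
    simpa using this
  have h2ι : ‖(2 : k)‖ = 1 := by
    have hle2 : ‖(2 : k)‖ ≤ 1 := by simpa using IsUltrametricDist.norm_natCast_le_one k 2
    refine le_antisymm hle2 ?_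
    by_contra! h
    obtain ⟨r, hr⟩ := hℓ.odd_of_ne_two hℓ2
    have h1 : (1 : k) = ℓ - 2 * r := by rw [hr]; push_cast; ring
    have h2 : ‖(1 : k)‖ < 1 := by
      rw [h1]
      rw [sub_eq_add_neg]
      refine (IsUltrametricDist.norm_add_le_max _ _).trans_lt (max_lt hℓι ?_)
      rw [norm_neg, norm_mul]
      exact (mul_le_of_le_one_right (norm_nonneg _)
        (IsUltrametricDist.norm_natCast_le_one k r)).trans_lt h
    simp at h2
  have hδi : IsIntegral ℤ δ := by
    refine IsIntegral.of_pow (n := 2) (by norm_num) ?_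
    rw [hδ]
    exact (isIntegral_natCast c).neg
  have hmap {x : E} (hx : IsIntegral ℤ x) : IsIntegral ℤ (τ x) :=
    hx.map (τ : E →+* E).toIntAlgHom
  let P : Ideal (𝓞 E) :=
    { carrier := {x | ‖ι x‖ < 1}
      zero_mem' := by simp
      add_mem' := fun {x y} hx hy => by
        change ‖ι ((x + y : 𝓞 E) : E)‖ < 1
        push_cast
        rw [map_add]
        exact (IsUltrametricDist.norm_add_le_max _ _).trans_lt (max_lt hx hy)
      smul_mem' := fun a x hx => by
        change ‖ι ((a * x : 𝓞 E) : E)‖ < 1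
        push_cast
        rw [map_mul, norm_mul]
        exact (mul_le_of_le_one_left (norm_nonneg _) (hle a)).trans_lt hx }
  have hmemP (x : 𝓞 E) : x ∈ P ↔ ‖ι x‖ < 1 := Iff.rfl
  have hℓP : (ℓ : 𝓞 E) ∈ P := by rw [hmemP]; simpa using hℓι
  have hP0 : P ≠ ⊥ := by
    intro h
    rw [h, Ideal.mem_bot] at hℓP
    exact hℓ.ne_zero (by exact_mod_cast hℓP)
  obtain ⟨h, hh0, x, hx⟩ : ∃ h, 0 < h ∧ ∃ x : 𝓞 E, P ^ h = Ideal.span {x} := by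
    refine ⟨Fintype.card (ClassGroup (𝓞 E)), Fintype.card_pos, ?_⟩
    have h1 : ClassGroup.mk0 (⟨P, mem_nonZeroDivisors_of_ne_zero hP0⟩ ^
        Fintype.card (ClassGroup (𝓞 E))) = 1 := by
      rw [map_pow, pow_card_eq_one]
    rw [ClassGroup.mk0_eq_one_iff] at h1
    exact h1.principal
  have hdvd {y : 𝓞 E} (hy : y ∈ P) : ∃ z, x * z = y ^ h := by
    have := Ideal.pow_mem_pow hy h
    rw [hx, Ideal.mem_span_singleton] at this
    exact this.imp fun _ h => h.symm
  have hxP : x ∈ P := Ideal.pow_le_self hh0.ne' (hx ▸ Ideal.mem_span_singleton_self x)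
  have hI : Ideal.span {((2 * c : ℕ) : 𝓞 E)} ≠ ⊥ := by
    rw [Ne, Ideal.span_singleton_eq_bot]
    exact_mod_cast (by positivity : (2 * c) ≠ 0)
  obtain ⟨N, hN, hNx⟩ := exists_pow_sub_one_mem hI
  obtain ⟨z, hz⟩ := hdvd hℓP
  have hcop : IsCoprime ((ℓ ^ h : ℕ) : ℤ) ((2 * c : ℕ) : ℤ) := by
    rw [Nat.isCoprime_iff_coprime]
    refine Nat.Coprime.pow_left _ (Nat.Coprime.mul_right ?_ ?_)
    · exact (Nat.coprime_primes hℓ Nat.prime_two).2 hℓ2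
    · exact (Nat.Prime.coprime_iff_not_dvd hℓ).2 hℓc
  obtain ⟨A, C, hAC⟩ := hcop
  have hxN : x ^ N - 1 ∈ Ideal.span {((2 * c : ℕ) : 𝓞 E)} := by
    refine hNx x (z * A) ?_
    rw [← mul_assoc, hz, Ideal.mem_span_singleton']
    refine ⟨-C, ?_⟩
    have := congrArg (Int.cast (R := 𝓞 E)) hAC
    push_cast at this ⊢
    linear_combination -this
  obtain ⟨y, hy⟩ := Ideal.mem_span_singleton'.1 hxN
  have hyx : (x : E) ^ N = 1 + 2 * c * (1 : ℕ) * y := by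
    have := congrArg (fun t : 𝓞 E => (t : E)) hy
    simp only [map_mul, map_sub, map_one, map_natCast, map_pow] at this
    push_cast at this ⊢
    linear_combination -this
  obtain ⟨a, b, hab⟩ := exists_integral_coordinates hδ hτ hgen 1 y.isIntegral_coe hyx
  rw [Nat.cast_one, one_mul] at hab
  have hτab : τ (x : E) ^ N = algebraMap F E a - algebraMap F E b * δ := by
    rw [← map_pow, hab]; simp [hτ, sub_eq_add_neg]
  have hιx : ‖ι (τ (x : E))‖ = 1 := by
    let d : 𝓞 E := ⟨δ - 1, hδi.sub isIntegral_one⟩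
    have hd : (d : E) = δ - 1 := rfl
    have hdP : d ∈ P := by
      rw [hmemP, hd, map_sub, map_one]
      exact hκ
    obtain ⟨w, hw⟩ := hdvd hdP
    have h1 : τ (x : E) * τ (w : E) = (-δ - 1) ^ h := by
      rw [← map_mul, ← hτ, ← map_one τ, ← map_sub, ← map_pow]
      congr 1
      have := congrArg (fun t : 𝓞 E => (t : E)) hw
      simpa [hd] using this
    have h2 : ‖ι (-δ - 1)‖ = 1 := by
      have : ι (-δ - 1) = -((ι δ - 1) + 2) := by rw [map_sub, map_neg, map_one]; ring
      rw [this, norm_neg, IsUltrametricDist.norm_add_eq_max_of_norm_ne_norm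
        (by rw [h2ι]; exact hκ.ne), h2ι, max_eq_right hκ.le]
    have h3 : ‖ι (τ (x : E))‖ * ‖ι (τ (w : E))‖ = 1 := by
      rw [← norm_mul, ← map_mul, h1, map_pow, norm_pow, h2, one_pow]
    have h4 : ‖ι (τ (x : E))‖ ≤ 1 := hle ⟨_, hmap x.isIntegral_coe⟩
    have h5 : ‖ι (τ (w : E))‖ ≤ 1 := hle ⟨_, hmap w.isIntegral_coe⟩
    nlinarith [norm_nonneg (ι (τ (x : E)))]
  refine ⟨a, b, ?_, ?_, fun r hr hrp hmem => ?_⟩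
  · rw [← map_mul, ← map_add, ← hab, map_pow, norm_pow]
    exact pow_lt_one₀ (norm_nonneg _) hxP hN.ne'
  · rw [← map_mul, ← map_sub, ← hτab, map_pow, norm_pow, hιx, one_pow]
  · obtain ⟨t, htp, htr⟩ : ∃ t ∈ p, t ∉ r := by
      by_contra! hle
      exact hrp ((‹p.IsMaximal›.eq_of_le hr.ne_top hle).symm)
    have htP : algebraMap (𝓞 F) (𝓞 E) t ∈ P := (hp t).1 htp
    obtain ⟨w, hw⟩ := hdvd htP
    have hw' : (x : E) * w = algebraMap F E (t : F) ^ h := by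
      have := congrArg (fun t : 𝓞 E => (t : E)) hw
      simp only [map_mul, map_pow] at this
      exact this
    have hw'' : τ (x : E) * τ (w : E) = algebraMap F E (t : F) ^ h := by
      rw [← map_mul, hw', map_pow, τ.commutes]
    have hn : algebraMap F E ((a ^ 2 + c * b ^ 2 : 𝓞 F) : F) = (x : E) ^ N * τ (x : E) ^ N := by
      rw [hab, hτab]
      simp only [map_add, map_mul, map_pow, map_natCast]
      linear_combination (algebraMap F E b) ^ 2 * hδ
    have h1 : algebraMap F E ((t ^ (2 * h * N) : 𝓞 F) : F) =
        algebraMap F E ((a ^ 2 + c * b ^ 2 : 𝓞 F) : F) * ((w : E) * τ (w : E)) ^ N := by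
      rw [hn, show (x : E) ^ N * τ (x : E) ^ N * ((w : E) * τ (w : E)) ^ N =
        ((x * w) * (τ (x : E) * τ (w : E))) ^ N by ring, hw', hw'', ← pow_add,
        ← two_mul, ← pow_mul, ← map_pow]
      congr 1
    have hx0 : (x : E) ≠ 0 := by
      intro h
      simp [h] at hιx
    have hn0 : ((a ^ 2 + c * b ^ 2 : 𝓞 F) : F) ≠ 0 := by
      intro h
      rw [h, map_zero] at hn
      exact mul_ne_zero (pow_ne_zero N hx0)
        (pow_ne_zero N ((map_ne_zero_iff τ τ.toRingHom.injective).2 hx0)) hn.symm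
    have hg : ((w : E) * τ (w : E)) ^ N = algebraMap F E
        (((t ^ (2 * h * N) : 𝓞 F) : F) / ((a ^ 2 + c * b ^ 2 : 𝓞 F) : F)) := by
      rw [_root_.map_div₀, h1, mul_div_cancel_left₀]
      exact (map_ne_zero_iff _ (algebraMap F E).injective).2 hn0
    have hi : IsIntegral ℤ (((t ^ (2 * h * N) : 𝓞 F) : F) / ((a ^ 2 + c * b ^ 2 : 𝓞 F) : F)) := by
      rw [← isIntegral_algebraMap_iff (algebraMap F E).injective, ← hg]
      exact (w.isIntegral_coe.mul (hmap w.isIntegral_coe)).pow N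
    let g : 𝓞 F := ⟨_, hi⟩
    have h2 : t ^ (2 * h * N) = (a ^ 2 + c * b ^ 2) * g := by
      apply RingOfIntegers.coe_injective
      change ((t ^ (2 * h * N) : 𝓞 F) : F) = (((a ^ 2 + c * b ^ 2) * g : 𝓞 F) : F)
      exact (mul_div_cancel₀ _ hn0).symm.trans (map_mul (algebraMap (𝓞 F) F) _ g).symm
    exact htr (hr.mem_of_pow_mem _ (h2 ▸ r.mul_mem_right g hmem))

end Abstract

section Concrete

universe u
variable {F : Type u} [Field F] [NumberField F] {c : ℕ}

theorem exists_sqrt_extension (hns : ¬ ∃ x : F, x ^ 2 = -(c : F)) :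
    ∃ (E : Type u) (_ : Field E) (_ : NumberField E) (_ : Algebra F E) (δ : E) (τ : E →ₐ[F] E),
      δ ^ 2 = -(c : E) ∧ τ δ = -δ ∧
      (∀ t : E, ∃ r s : F, t = algebraMap F E r + algebraMap F E s * δ) ∧
      ∀ (k : Type u) [Field k] (ι₀ : F →+* k) (κ : k), κ ^ 2 = -(c : k) →
        ∃ ι : E →+* k, (∀ x, ι (algebraMap F E x) = ι₀ x) ∧ ι δ = κ := by
  have hirr := AdjoinRoot.irreducible_sq_add_C hns
  set f : F[X] := X ^ 2 + C (c : F) with hf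
  have := Fact.mk hirr
  have hmonic : f.Monic := monic_X_pow_add_C _ (by norm_num)
  have hdeg : f.natDegree = 2 := natDegree_X_pow_add_C
  have hfd : FiniteDimensional F (AdjoinRoot f) := (AdjoinRoot.powerBasis hirr.ne_zero).finite
  have : CharZero (AdjoinRoot f) := charZero_of_injective_algebraMap (algebraMap F _).injective
  have : NumberField (AdjoinRoot f) := NumberField.of_module_finite F _
  have hev {R : Type u} [CommRing R] (i : F →+* R) (x : R) : f.eval₂ i x = x ^ 2 + c := by
    rw [hf, eval₂_add, eval₂_pow, eval₂_X, eval₂_C, map_natCast]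
  have hδ : (AdjoinRoot.root f) ^ 2 = -(c : AdjoinRoot f) := by
    have h1 : (AdjoinRoot.root f) ^ 2 + (c : AdjoinRoot f) = 0 :=
      (hev _ _).symm.trans (AdjoinRoot.eval₂_root f)
    linear_combination h1
  refine ⟨AdjoinRoot f, inferInstance, inferInstance, inferInstance, AdjoinRoot.root f,
    AdjoinRoot.liftAlgHom f (Algebra.ofId F (AdjoinRoot f)) (-AdjoinRoot.root f)
      ((hev _ _).trans ?_), hδ, AdjoinRoot.liftAlgHom_root _ _ _ _,
    AdjoinRoot.exists_eq_add_mul_root hmonic hdeg, fun k _ ι₀ κ hκ => ?_⟩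
  · rw [neg_sq, hδ]
    ring
  · have h0 : f.eval₂ ι₀ κ = 0 := by
      rw [hev, hκ]
      ring
    exact ⟨AdjoinRoot.lift ι₀ κ h0, fun x => AdjoinRoot.lift_of h0, AdjoinRoot.lift_root h0⟩

theorem exists_pell (hns : ¬ ∃ x : F, x ^ 2 = -(c : F)) (hc : 0 < c)
    {w₁ : InfinitePlace F} (hw₁ : w₁.IsComplex) {m : ℕ} (hm : 0 < m) :
    ∃ a b : 𝓞 F, b ≠ 0 ∧ a ^ 2 + c * (m * b) ^ 2 = 1 := by
  obtain ⟨E, _, _, _, δ, τ, hδ, hτ, hgen, -⟩ := exists_sqrt_extension hns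
  exact exists_pell_of_extension hδ hτ hgen hc hw₁ hm

theorem exists_pell_at_prime (hns : ¬ ∃ x : F, x ^ 2 = -(c : F)) (hc : 0 < c) {k : Type u}
    [NormedField k] [IsUltrametricDist k] (ι : F →+* k) {p : Ideal (𝓞 F)} [p.IsMaximal]
    (hp : ∀ x : 𝓞 F, x ∈ p ↔ ‖ι x‖ < 1) {ℓ : ℕ} (hℓ : ℓ.Prime) (hℓ2 : ℓ ≠ 2)
    (hℓp : (ℓ : 𝓞 F) ∈ p) (hℓc : ¬ ℓ ∣ c) {κ : k} (hκ : κ ^ 2 = -(c : k)) (hκ1 : ‖κ - 1‖ < 1) :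
    ∃ a b : 𝓞 F, ‖ι a + ι b * κ‖ < 1 ∧ ‖ι a - ι b * κ‖ = 1 ∧
      ∀ r : Ideal (𝓞 F), r.IsPrime → r ≠ p → a ^ 2 + c * b ^ 2 ∉ r := by
  obtain ⟨E, _, _, _, δ, τ, hδ, hτ, hgen, h⟩ := exists_sqrt_extension hns
  obtain ⟨ι', h1, h2⟩ := h k ι κ hκ
  obtain ⟨a, b, hab⟩ := exists_pell_at_prime_of_extension hδ hτ hgen hc ι'
    (fun x => by rw [h1]; exact hp x) hℓ hℓ2 hℓp hℓc (by rw [h2]; exact hκ1)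
  simp only [h1, h2] at hab
  exact ⟨a, b, hab⟩

end Concrete

end Pell

section ChoiceOfPrime

theorem exists_eq_add_mul_of_mem_adjoin {E : Type*} [Field E] [CharZero E] {c : ℚ} {x y : E}
    (hx : x ^ 2 = c) (hy : y ∈ IntermediateField.adjoin ℚ {x}) : ∃ a b : ℚ, y = a + b * x := by
  have hi : IsAlgebraic ℚ x := ⟨X ^ 2 - C c, X_pow_sub_C_ne_zero two_pos c, by simp [hx]⟩
  have hy' : y ∈ Algebra.adjoin ℚ {x} := by
    rw [← IntermediateField.adjoin_simple_toSubalgebra_of_isAlgebraic hi]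
    exact hy
  induction hy' using Algebra.adjoin_induction with
  | mem z hz => exact ⟨0, 1, by rw [Set.mem_singleton_iff.1 hz]; simp⟩
  | algebraMap r => exact ⟨r, 0, by simp⟩
  | add u v hu hv ihu ihv =>
    obtain ⟨a, b, rfl⟩ := ihu (by
      have := IntermediateField.adjoin_simple_toSubalgebra_of_isAlgebraic hi
      rw [← this] at hu; exact hu)
    obtain ⟨a', b', rfl⟩ := ihv (by
      have := IntermediateField.adjoin_simple_toSubalgebra_of_isAlgebraic hi
      rw [← this] at hv; exact hv)
    exact ⟨a + a', b + b', by push_cast; ring⟩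
  | mul u v hu hv ihu ihv =>
    obtain ⟨a, b, rfl⟩ := ihu (by
      have := IntermediateField.adjoin_simple_toSubalgebra_of_isAlgebraic hi
      rw [← this] at hu; exact hu)
    obtain ⟨a', b', rfl⟩ := ihv (by
      have := IntermediateField.adjoin_simple_toSubalgebra_of_isAlgebraic hi
      rw [← this] at hv; exact hv)
    exact ⟨a * a' + b * b' * c, a * b' + a' * b, by
      push_cast
      linear_combination (b : E) * b' * hx⟩

theorem adjoin_sqrt_neg_prime_ne {E : Type*} [Field E] [CharZero E] {c d : ℕ} (hc : c.Prime)
    (hd : d.Prime) (hcd : c ≠ d) {x y : E} (hx : x ^ 2 = -(c : E)) (hy : y ^ 2 = -(d : E)) :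
    IntermediateField.adjoin ℚ {x} ≠ IntermediateField.adjoin ℚ {y} := by
  intro h
  have hy' : y ∈ IntermediateField.adjoin ℚ {x} :=
    h ▸ IntermediateField.mem_adjoin_simple_self ℚ y
  obtain ⟨a, b, hab⟩ := exists_eq_add_mul_of_mem_adjoin (c := -(c : ℚ)) (by push_cast; exact hx) hy'
  have h1 : ((2 * a * b : ℚ) : E) * x = ((b ^ 2 * c - a ^ 2 - d : ℚ) : E) := by
    push_cast
    rw [hab] at hy
    linear_combination hy - (b : E) ^ 2 * hx
  have hcpos : (0 : ℚ) < c := by exact_mod_cast hc.pos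
  have hdpos : (0 : ℚ) < d := by exact_mod_cast hd.pos
  have hzero : 2 * a * b = 0 := by
    by_contra hne
    have h2 : (b ^ 2 * c - a ^ 2 - d) ^ 2 = -c * (2 * a * b) ^ 2 := by
      have : (((b ^ 2 * c - a ^ 2 - d) ^ 2 : ℚ) : E) = ((-c * (2 * a * b) ^ 2 : ℚ) : E) := by
        rw [Rat.cast_pow, ← h1, mul_pow, hx]
        push_cast
        ring
      exact_mod_cast this
    have := sq_nonneg (b ^ 2 * c - a ^ 2 - d)
    have h3 : 0 < (2 * a * b) ^ 2 := by positivity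
    nlinarith
  have h2 : b ^ 2 * c - a ^ 2 - d = 0 := by
    rw [hzero, Rat.cast_zero, zero_mul] at h1
    exact_mod_cast h1.symm
  rcases mul_eq_zero.1 hzero with h3 | h3
  · have ha : a = 0 := by simpa using h3
    have h4 : b ^ 2 * c = d := by rw [ha] at h2; linarith
    have hb : b ≠ 0 := by rintro rfl; simp at h4; exact hdpos.ne h4
    have := Fact.mk hc
    have := Fact.mk hd
    have h5 := congrArg (padicValRat c) h4
    rw [padicValRat.mul (pow_ne_zero _ hb) hcpos.ne', padicValRat.pow, padicValRat.self hc.one_lt,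
      padicValRat.of_nat, padicValNat_primes hcd] at h5
    push_cast at h5
    omega
  · rw [h3] at h2
    nlinarith [sq_nonneg a]

theorem exists_prime_neg_not_sq (F : Type*) [Field F] [NumberField F] {ℓ : ℕ} (hℓ : ℓ.Prime)
    (hℓ2 : ℓ ≠ 2) : ∃ c : ℕ, c.Prime ∧ c % 4 = 1 ∧ c ≡ ℓ - 1 [MOD ℓ] ∧ ¬ ∃ x : F, x ^ 2 = -(c : F) := by
  have hcop : Nat.Coprime 4 ℓ := by
    have : Nat.Coprime 2 ℓ := (Nat.coprime_primes Nat.prime_two hℓ).2 (Ne.symm hℓ2)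
    exact Nat.Coprime.pow_left 2 this
  obtain ⟨r, hr1, hr2⟩ := Nat.chineseRemainder hcop 1 (ℓ - 1)
  have hrcop : r.Coprime (4 * ℓ) := by
    refine Nat.Coprime.mul_right ?_ ?_
    · rw [Nat.Coprime, hr1.gcd_eq]; simp
    · rw [Nat.Coprime, hr2.gcd_eq]
      have := hℓ.two_le
      have h := Nat.coprime_self_sub_left (m := 1) (n := ℓ) (by omega)
      exact h.2 (by simp)
  have hinf := Nat.infinite_setOfPred_prime_and_modEq
    (mul_ne_zero four_ne_zero hℓ.ne_zero) hrcop
  have : Finite (IntermediateField ℚ F) :=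
    Field.finite_intermediateField_of_exists_primitive_element ℚ F
      (Field.exists_primitive_element ℚ F)
  by_contra! hcon
  have hall : ∀ c : {p : ℕ | p.Prime ∧ p ≡ r [MOD (4 * ℓ)]}, ∃ x : F, x ^ 2 = -((c : ℕ) : F) := by
    rintro ⟨c, hc, hcr⟩
    exact hcon c hc ((hcr.of_mul_right ℓ).trans hr1) ((hcr.of_mul_left 4).trans hr2)
  choose f hf using hall
  have := hinf.to_subtype
  obtain ⟨c, d, hcd, h⟩ := Finite.exists_ne_map_eq_of_infinite
    fun c => IntermediateField.adjoin ℚ {f c}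
  exact adjoin_sqrt_neg_prime_ne c.2.1 d.2.1 (fun h => hcd (Subtype.ext h)) (hf c) (hf d) h
end ChoiceOfPrime

section Completion
open NumberField IsDedekindDomain HeightOneSpectrum

variable {F : Type*} [Field F] [NumberField F]

/-- A dense embedding into a normed field whose unit balls pull back to those of a finite place. -/
structure IsCompletionAt (p : HeightOneSpectrum (𝓞 F)) {k : Type*} [NormedField k]
    (ι : F →+* k) : Prop where
  dense : DenseRange ι
  norm_le_one_iff : ∀ x, ‖ι x‖ ≤ 1 ↔ p.valuation F x ≤ 1
  norm_lt_one_iff : ∀ x, ‖ι x‖ < 1 ↔ p.valuation F x < 1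

namespace IsCompletionAt

variable {p : HeightOneSpectrum (𝓞 F)} {k : Type*} [NormedField k] {ι : F →+* k}

theorem charZero (ι : F →+* k) : CharZero k := charZero_of_injective_ringHom ι.injective

theorem norm_algebraMap_lt_one_iff (h : IsCompletionAt p ι) (x : 𝓞 F) :
    ‖ι (algebraMap (𝓞 F) F x)‖ < 1 ↔ x ∈ p.asIdeal := by
  rw [h.norm_lt_one_iff]
  exact valuation_lt_one_iff_mem p x

theorem norm_algebraMap_le_one (h : IsCompletionAt p ι) (x : 𝓞 F) :
    ‖ι (algebraMap (𝓞 F) F x)‖ ≤ 1 :=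
  (h.norm_le_one_iff _).2 (p.valuation_le_one x)

variable [IsUltrametricDist k]

theorem exists_map_norm_eq (h : IsCompletionAt p ι) {x : k} (hx : x ≠ 0) :
    ∃ y : F, y ≠ 0 ∧ ‖ι y‖ = ‖x‖ := by
  obtain ⟨y, hy⟩ := h.dense.exists_dist_lt x (norm_pos_iff.2 hx)
  rw [dist_eq_norm] at hy
  have : ‖ι y‖ = ‖x‖ := by
    rw [sub_eq_add_neg] at hy
    rw [IsUltrametricDist.norm_eq_of_add_norm_lt_max (hy.trans_le (le_max_left _ _)), norm_neg]
  refine ⟨y, ?_, this⟩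
  rintro rfl
  rw [map_zero, norm_zero] at this
  exact hx (norm_eq_zero.1 this.symm)

theorem exists_uniformizer (h : IsCompletionAt p ι) :
    ∃ ϖ : k, ‖ϖ‖ < 1 ∧ ϖ ≠ 0 ∧ ∀ x : k, x ≠ 0 → ∃ n : ℤ, ‖x‖ = ‖ϖ‖ ^ n := by
  obtain ⟨π, hπ⟩ := p.valuation_exists_uniformizer F
  have hπ0 : π ≠ 0 := by
    rintro rfl
    rw [map_zero] at hπ
    exact WithZero.exp_ne_zero hπ.symm
  refine ⟨ι π, (h.norm_lt_one_iff π).2 ?_, (_root_.map_ne_zero ι).2 hπ0, fun x hx => ?_⟩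
  · rw [hπ]
    exact WithZero.exp_lt_exp.2 (by norm_num)
  obtain ⟨y, hy0, hy⟩ := h.exists_map_norm_eq hx
  have hv0 : p.valuation F y ≠ 0 := (_root_.map_ne_zero _).2 hy0
  set n := WithZero.log (p.valuation F y) with hn
  have hvy : p.valuation F (y * π ^ n) = 1 := by
    rw [map_mul, map_zpow₀, hπ, ← WithZero.exp_log hv0, ← WithZero.exp_zsmul, ← WithZero.exp_add,
      ← hn]
    simp
  have h1 : ‖ι (y * π ^ n)‖ = 1 :=
    le_antisymm ((h.norm_le_one_iff _).2 hvy.le)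
      (not_lt.1 fun hlt => ((h.norm_lt_one_iff _).1 hlt).ne hvy)
  refine ⟨-n, ?_⟩
  rw [← hy, zpow_neg]
  rw [map_mul, norm_mul, map_zpow₀, norm_zpow] at h1
  exact eq_inv_of_mul_eq_one_left h1

theorem exists_algebraMap_sub_lt (h : IsCompletionAt p ι) {x : k} (hx : ‖x‖ ≤ 1) :
    ∃ y : 𝓞 F, ‖x - ι (algebraMap (𝓞 F) F y)‖ < 1 := by
  obtain ⟨y, hy⟩ := h.dense.exists_dist_lt x one_pos
  rw [dist_eq_norm] at hy
  have hy1 : ‖ι y‖ ≤ 1 := by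
    have : ι y = x + -(x - ι y) := by ring
    rw [this]
    refine (IsUltrametricDist.norm_add_le_max _ _).trans (max_le hx ?_)
    rw [norm_neg]
    exact hy.le
  obtain ⟨a, ha⟩ := p.exists_valuation_sub_lt_of_integer ((h.norm_le_one_iff _).1 hy1) 1
  refine ⟨a, ?_⟩
  have h2 := (h.norm_lt_one_iff _).2 ha
  rw [map_sub] at h2
  have : x - ι (algebraMap (𝓞 F) F a) = (x - ι y) + -(ι (algebraMap (𝓞 F) F a) - ι y) := by ring
  rw [this]
  refine (IsUltrametricDist.norm_add_le_max _ _).trans_lt (max_lt hy ?_)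
  rw [norm_neg]
  exact h2
end IsCompletionAt

theorem isCompletionAt_embedding (p : HeightOneSpectrum (𝓞 F)) :
    IsCompletionAt p (FinitePlace.embedding (K := F) p) where
  dense := p.denseRange_algebraMap F
  norm_le_one_iff x := by
    rw [FinitePlace.norm_embedding', NNReal.coe_le_one,
      WithZeroMulInt.toNNReal_le_one_iff (NumberField.HeightOneSpectrum.one_lt_absNorm_nnreal p)]
  norm_lt_one_iff x := by
    rw [FinitePlace.norm_embedding', NNReal.coe_lt_one,
      WithZeroMulInt.toNNReal_lt_one_iff (NumberField.HeightOneSpectrum.one_lt_absNorm_nnreal p)]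

theorem properSpace_adicCompletion (p : HeightOneSpectrum (𝓞 F)) :
    ProperSpace (p.adicCompletion F) := by
  rw [Valued.integer.properSpace_iff_completeSpace_and_isDiscreteValuationRing_integer_and_finite_residueField (Γ₀ := WithZero (Multiplicative ℤ))]
  refine ⟨inferInstance, inferInstanceAs (IsDiscreteValuationRing (p.adicCompletionIntegers F)), ?_⟩
  have h := isCompletionAt_embedding p
  have : Finite (𝓞 F ⧸ p.asIdeal) := Ideal.finiteQuotientOfFreeOfNeBot p.asIdeal p.ne_bot
  refine Finite.of_surjective (α := 𝓞 F ⧸ p.asIdeal) (fun q => IsLocalRing.residue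
    (p.adicCompletionIntegers F) (algebraMap (𝓞 F) (p.adicCompletionIntegers F) q.out)) fun r => ?_
  obtain ⟨x, rfl⟩ := IsLocalRing.residue_surjective r
  let x' : p.adicCompletionIntegers F := x
  have hx : ‖(x : p.adicCompletion F)‖ ≤ 1 := by
    rw [FinitePlace.norm_def, NNReal.coe_le_one,
      WithZeroMulInt.toNNReal_le_one_iff (NumberField.HeightOneSpectrum.one_lt_absNorm_nnreal p)]
    exact x.2
  obtain ⟨y, hy⟩ := h.exists_algebraMap_sub_lt hx
  refine ⟨Ideal.Quotient.mk _ y, ?_⟩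
  set z := (Ideal.Quotient.mk p.asIdeal y).out with hz
  have hzy : y - z ∈ p.asIdeal := by
    rw [← Ideal.Quotient.eq, hz]
    exact (Quotient.out_eq' _).symm
  refine (Ideal.Quotient.eq.2 ?_ : IsLocalRing.residue _ x = _).symm
  refine (IsLocalRing.mem_maximalIdeal _).2 fun hu => ?_
  have hu1 := (adicCompletionIntegers.isUnit_iff_valued_eq_one
    (a := x' - algebraMap (𝓞 F) (p.adicCompletionIntegers F) z)).1 hu
  have h1 : ‖(x : p.adicCompletion F) - FinitePlace.embedding p (algebraMap (𝓞 F) F z)‖ < 1 := by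
    have : (x : p.adicCompletion F) - FinitePlace.embedding p (algebraMap (𝓞 F) F z) =
        (x - FinitePlace.embedding p (algebraMap (𝓞 F) F y)) +
          FinitePlace.embedding p (algebraMap (𝓞 F) F (y - z)) := by
      simp only [_root_.map_sub]
      ring
    rw [this]
    exact (IsUltrametricDist.norm_add_le_max _ _).trans_lt
      (max_lt hy ((h.norm_algebraMap_lt_one_iff _).2 hzy))
  rw [FinitePlace.norm_def, NNReal.coe_lt_one,
    WithZeroMulInt.toNNReal_lt_one_iff (NumberField.HeightOneSpectrum.one_lt_absNorm_nnreal p)] at h1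
  exact h1.ne hu1
end Completion

section LocalSquares
open NumberField IsDedekindDomain HeightOneSpectrum Filter Topology

theorem Int.exists_prime_pow_dvd_sq_add {ℓ c : ℕ} (hℓ : ℓ.Prime) (hℓ2 : ℓ ≠ 2)
    (hc : c ≡ ℓ - 1 [MOD ℓ]) (n : ℕ) :
    ∃ w : ℤ, (ℓ : ℤ) ^ (n + 1) ∣ w ^ 2 + c ∧ (ℓ : ℤ) ∣ w - 1 := by
  have hp : Prime (ℓ : ℤ) := Nat.prime_iff_prime_int.1 hℓ
  induction n with
  | zero =>
    refine ⟨1, ?_, by simp⟩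
    have h1 : ((c + 1 : ℕ) : ℤ) = 1 ^ 2 + c := by push_cast; ring
    rw [zero_add, pow_one, ← h1, Int.natCast_dvd_natCast]
    have h2 := hc.add_right 1
    rw [Nat.sub_add_cancel hℓ.one_le] at h2
    exact (Nat.modEq_zero_iff_dvd.1 (h2.trans (by simp [Nat.ModEq])))
  | succ n ih =>
    obtain ⟨w, ⟨q, hq⟩, hw⟩ := ih
    have hcop : IsCoprime (2 * w) (ℓ : ℤ) := by
      refine ((hp.coprime_iff_not_dvd).2 fun hd => ?_).symm
      rcases hp.dvd_or_dvd hd with h | h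
      · have h2 : ℓ ∣ 2 := by exact_mod_cast h
        exact hℓ2 ((Nat.prime_dvd_prime_iff_eq hℓ Nat.prime_two).1 h2)
      · have := dvd_sub h hw
        rw [sub_sub_cancel] at this
        exact hp.not_dvd_one this
    obtain ⟨u, v, huv⟩ := hcop
    refine ⟨w - (ℓ : ℤ) ^ (n + 1) * (q * u), ?_, ?_⟩
    · refine ⟨q * v + (ℓ : ℤ) ^ n * (q * u) ^ 2, ?_⟩
      linear_combination hq - (ℓ : ℤ) ^ (n + 1) * q * huv
    · have : w - (ℓ : ℤ) ^ (n + 1) * (q * u) - 1 = (w - 1) - ℓ * (ℓ ^ n * (q * u)) := by ring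
      rw [this]
      exact dvd_sub hw (dvd_mul_right _ _)

variable {k : Type*} [NormedField k] [IsUltrametricDist k]

theorem IsUltrametricDist.norm_intCast_le_of_dvd {m n : ℤ} (h : m ∣ n) : ‖(n : k)‖ ≤ ‖(m : k)‖ := by
  obtain ⟨q, rfl⟩ := h
  rw [Int.cast_mul, norm_mul]
  exact mul_le_of_le_one_right (norm_nonneg _) (norm_intCast_le_one k q)

theorem exists_sq_eq_neg_natCast [ProperSpace k] {ℓ c : ℕ} (hℓ : ℓ.Prime) (hℓ2 : ℓ ≠ 2)
    (hc : c ≡ ℓ - 1 [MOD ℓ]) (hℓ1 : ‖(ℓ : k)‖ < 1) : ∃ κ : k, κ ^ 2 = -(c : k) ∧ ‖κ - 1‖ < 1 := by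
  choose w hw hw1 using Int.exists_prime_pow_dvd_sq_add hℓ hℓ2 hc
  obtain ⟨κ, -, φ, hφ, hlim⟩ := (isCompact_closedBall (0 : k) 1).tendsto_subseq
    (x := fun n => (w n : k)) fun n => by
      simpa using IsUltrametricDist.norm_intCast_le_one k (w n)
  refine ⟨κ, ?_, ?_⟩
  · have h1 : Tendsto (fun n => (w (φ n) : k) ^ 2 + c) atTop (𝓝 (κ ^ 2 + c)) :=
      (hlim.pow 2).add_const _
    have h2 : Tendsto (fun n => (w (φ n) : k) ^ 2 + c) atTop (𝓝 0) := by
      rw [tendsto_zero_iff_norm_tendsto_zero]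
      refine squeeze_zero (fun _ => norm_nonneg _) (fun n => ?_)
        (tendsto_pow_atTop_nhds_zero_of_lt_one (norm_nonneg (ℓ : k)) hℓ1)
      have h3 := IsUltrametricDist.norm_intCast_le_of_dvd (k := k) (hw (φ n))
      push_cast at h3
      rw [norm_pow] at h3
      exact h3.trans (pow_le_pow_of_le_one (norm_nonneg _) hℓ1.le
        ((hφ.id_le n).trans (Nat.le_succ _)))
    exact eq_neg_of_add_eq_zero_left (tendsto_nhds_unique h1 h2)
  · refine lt_of_le_of_lt (le_of_tendsto ((hlim.sub_const 1).norm) (Eventually.of_forall fun n => ?_))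
      hℓ1
    have h3 := IsUltrametricDist.norm_intCast_le_of_dvd (k := k) (hw1 (φ n))
    push_cast at h3
    exact h3

theorem exists_norm_one_sub_eq_uniformizer {ϖ : k} (hϖ1 : ‖ϖ‖ < 1) (hϖ0 : ϖ ≠ 0)
    (hϖ : ∀ x : k, x ≠ 0 → ∃ n : ℤ, ‖x‖ = ‖ϖ‖ ^ n) (h2 : ‖(2 : k)‖ = 1) {a b α r t : k}
    (ha : ‖a‖ = 1) (hα : ‖α‖ = 1) (hr : ‖r‖ = 1)
    (h : ‖1 - (a * r ^ 2 + b * t ^ 2) / α‖ < 1) :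
    ∃ r' t' : k, ‖1 - (a * r' ^ 2 + b * t' ^ 2) / α‖ = ‖ϖ‖ := by
  have hα0 : α ≠ 0 := by rintro rfl; simp at hα
  have hϖp : 0 < ‖ϖ‖ := norm_pos_iff.2 hϖ0
  by_cases h1 : ‖1 - (a * r ^ 2 + b * t ^ 2) / α‖ = ‖ϖ‖
  · exact ⟨r, t, h1⟩
  have hlt : ‖1 - (a * r ^ 2 + b * t ^ 2) / α‖ < ‖ϖ‖ := by
    rcases eq_or_ne (1 - (a * r ^ 2 + b * t ^ 2) / α) 0 with h0 | h0
    · rw [h0, norm_zero]; exact hϖp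
    · obtain ⟨n, hn⟩ := hϖ _ h0
      rw [hn] at h h1 ⊢
      have hn0 : 0 < n := by
        by_contra! hneg
        exact absurd h (not_lt.2 (one_le_zpow_of_nonpos₀ hϖp hϖ1.le hneg))
      have hn1 : n ≠ 1 := by rintro rfl; simp at h1
      calc ‖ϖ‖ ^ n < ‖ϖ‖ ^ (1 : ℤ) := zpow_lt_zpow_right_of_lt_one₀ hϖp hϖ1 (by omega)
        _ = ‖ϖ‖ := zpow_one _
  have h3 : ‖2 * r + ϖ‖ = 1 := by
    have : ‖2 * r‖ = 1 := by rw [norm_mul, h2, hr, one_mul]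
    rw [IsUltrametricDist.norm_add_eq_max_of_norm_ne_norm (by rw [this]; exact hϖ1.ne'), this]
    exact max_eq_left hϖ1.le
  have h4 : ‖-(a * (ϖ * (2 * r + ϖ)) / α)‖ = ‖ϖ‖ := by
    rw [norm_neg, norm_div, norm_mul, norm_mul, ha, hα, h3]
    ring
  refine ⟨r + ϖ, t, ?_⟩
  have h5 : 1 - (a * (r + ϖ) ^ 2 + b * t ^ 2) / α =
      (1 - (a * r ^ 2 + b * t ^ 2) / α) + -(a * (ϖ * (2 * r + ϖ)) / α) := by
    field_simp
    ring
  rw [h5, IsUltrametricDist.norm_add_eq_max_of_norm_ne_norm (by rw [h4]; exact hlt.ne), h4]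
  exact max_eq_right hlt.le

theorem IsCompletionAt.exists_norm_one_sub_eq_uniformizer {F : Type*} [Field F] [NumberField F]
    {p : HeightOneSpectrum (𝓞 F)} {ι : F →+* k} (h : IsCompletionAt p ι) {ϖ : k} (hϖ1 : ‖ϖ‖ < 1)
    (hϖ0 : ϖ ≠ 0) (hϖ : ∀ x : k, x ≠ 0 → ∃ n : ℤ, ‖x‖ = ‖ϖ‖ ^ n) (h2 : (2 : 𝓞 F) ∉ p.asIdeal)
    {a b : ℕ} (ha : (a : 𝓞 F) ∉ p.asIdeal) (hb : (b : 𝓞 F) ∉ p.asIdeal) {α : k} (hα : ‖α‖ = 1) :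
    ∃ r t : k, ‖1 - (a * r ^ 2 + b * t ^ 2) / α‖ = ‖ϖ‖ := by
  have hα0 : α ≠ 0 := by rintro rfl; simp at hα
  have hunit : ∀ x : 𝓞 F, x ∉ p.asIdeal → ‖ι (algebraMap (𝓞 F) F x)‖ = 1 := fun x hx =>
    le_antisymm (h.norm_algebraMap_le_one x)
      (not_lt.1 fun hlt => hx ((h.norm_algebraMap_lt_one_iff x).1 hlt))
  have ha1 : ‖(a : k)‖ = 1 := by simpa using hunit _ ha
  have hb1 : ‖(b : k)‖ = 1 := by simpa using hunit _ hb
  have h21 : ‖(2 : k)‖ = 1 := by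
    have := hunit _ h2
    rwa [map_ofNat, map_ofNat] at this
  obtain ⟨y, hy⟩ := h.exists_algebraMap_sub_lt hα.le
  have := p.isPrime
  have : p.asIdeal.IsMaximal := p.isMaximal
  let := Ideal.Quotient.field p.asIdeal
  have : Finite (𝓞 F ⧸ p.asIdeal) := Ideal.finiteQuotientOfFreeOfNeBot p.asIdeal p.ne_bot
  let := Fintype.ofFinite (𝓞 F ⧸ p.asIdeal)
  let π := Ideal.Quotient.mk p.asIdeal
  have hne : ∀ x : 𝓞 F, x ∉ p.asIdeal → π x ≠ 0 := fun x hx h0 =>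
    hx (Ideal.Quotient.eq_zero_iff_mem.1 h0)
  have hodd : Fintype.card (𝓞 F ⧸ p.asIdeal) % 2 = 1 := by
    refine FiniteField.odd_card_of_char_ne_two fun hch => hne 2 h2 ?_
    have := ringChar.Nat.cast_ringChar (R := 𝓞 F ⧸ p.asIdeal)
    rw [hch] at this
    rw [map_ofNat]
    exact_mod_cast this
  obtain ⟨r, t, hrt⟩ := FiniteField.exists_root_sum_quadratic
    (f := C (π a) * X ^ 2 + C 0 * X + C 0) (g := C (π b) * X ^ 2 + C 0 * X + C (-π y))
    (degree_quadratic (hne _ ha)) (degree_quadratic (hne _ hb)) hodd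
  obtain ⟨r, rfl⟩ := Ideal.Quotient.mk_surjective r
  obtain ⟨t, rfl⟩ := Ideal.Quotient.mk_surjective t
  have hmem : y - (a * r ^ 2 + b * t ^ 2) ∈ p.asIdeal := by
    rw [← Ideal.Quotient.eq_zero_iff_mem]
    simp only [eval_add, eval_mul, eval_C, eval_pow, eval_X] at hrt
    simp only [_root_.map_sub, _root_.map_add, _root_.map_mul, _root_.map_pow]
    linear_combination -hrt
  set R := ι (algebraMap (𝓞 F) F r)
  set T := ι (algebraMap (𝓞 F) F t)
  have hlt0 : ‖α - (a * R ^ 2 + b * T ^ 2)‖ < 1 := by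
    have h1 := (h.norm_algebraMap_lt_one_iff _).2 hmem
    have h3 : α - (a * R ^ 2 + b * T ^ 2) = (α - ι (algebraMap (𝓞 F) F y)) +
        ι (algebraMap (𝓞 F) F (y - (a * r ^ 2 + b * t ^ 2))) := by
      simp only [_root_.map_sub, _root_.map_add, _root_.map_mul, _root_.map_pow, map_natCast, R, T]
      ring
    rw [h3]
    exact (IsUltrametricDist.norm_add_le_max _ _).trans_lt (max_lt hy h1)
  have hlt : ‖1 - (a * R ^ 2 + b * T ^ 2) / α‖ < 1 := by
    have : 1 - (a * R ^ 2 + b * T ^ 2) / α = (α - (a * R ^ 2 + b * T ^ 2)) / α := by field_simp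
    rw [this, norm_div, hα, div_one]
    exact hlt0
  by_cases hR : ‖R‖ = 1
  · exact _root_.exists_norm_one_sub_eq_uniformizer hϖ1 hϖ0 hϖ h21 ha1 hα hR hlt
  by_cases hT : ‖T‖ = 1
  · rw [add_comm] at hlt
    obtain ⟨t', r', h'⟩ :=
      _root_.exists_norm_one_sub_eq_uniformizer hϖ1 hϖ0 hϖ h21 hb1 hα hT hlt
    exact ⟨r', t', by rw [add_comm]; exact h'⟩
  · exfalso
    have hR1 : ‖R‖ < 1 := lt_of_le_of_ne (h.norm_algebraMap_le_one r) hR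
    have hT1 : ‖T‖ < 1 := lt_of_le_of_ne (h.norm_algebraMap_le_one t) hT
    have h6 : ‖a * R ^ 2 + b * T ^ 2‖ < 1 := by
      refine (IsUltrametricDist.norm_add_le_max _ _).trans_lt (max_lt ?_ ?_)
      · rw [norm_mul, norm_pow, ha1, one_mul]
        exact pow_lt_one₀ (norm_nonneg _) hR1 two_ne_zero
      · rw [norm_mul, norm_pow, hb1, one_mul]
        exact pow_lt_one₀ (norm_nonneg _) hT1 two_ne_zero
    have h7 := (IsUltrametricDist.norm_add_le_max (α - (a * R ^ 2 + b * T ^ 2))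
      (a * R ^ 2 + b * T ^ 2)).trans_lt (max_lt hlt0 h6)
    rw [sub_add_cancel, hα] at h7
    exact lt_irrefl _ h7
end LocalSquares

section CongruenceIsometries
open LinearMap.BilinForm Filter Topology

/-- The isometries of `quat` congruent to the identity modulo `m` on the lattice `R⁴`. -/
def congruenceIsometries {F : Type*} [Field F] (R : Subring F) (m : ℕ) :
    Submonoid (Module.End F (Fin 4 → F)) where
  carrier := {G | (∀ x y, quatPolar F (G x) (G y) = quatPolar F x y) ∧
    ∀ x : Fin 4 → F, (∀ i, x i ∈ R) → ∃ y : Fin 4 → F, (∀ i, y i ∈ R) ∧ G x = x + (m : F) • y}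
  one_mem' := ⟨fun _ _ => rfl, fun x _ => ⟨0, fun _ => R.zero_mem, by simp⟩⟩
  mul_mem' := by
    rintro G H ⟨hG, hG'⟩ ⟨hH, hH'⟩
    refine ⟨fun x y => by rw [Module.End.mul_apply, Module.End.mul_apply, hG, hH], fun x hx => ?_⟩
    obtain ⟨y, hy, hxy⟩ := hH' x hx
    obtain ⟨z, hz, hyz⟩ := hG' (H x) fun i => by
      rw [hxy]
      exact R.add_mem (hx i) (R.mul_mem (natCast_mem R m) (hy i))
    exact ⟨y + z, fun i => R.add_mem (hy i) (hz i), by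
      rw [Module.End.mul_apply, hyz, hxy, smul_add, add_assoc]⟩

variable {F k : Type*} [Field F] [Field k]

/-- The matrix of an endomorphism, with entries mapped along a ring homomorphism. -/
def endToMatrix (ι : F →+* k) : Module.End F (Fin 4 → F) →+* Matrix (Fin 4) (Fin 4) k :=
  ι.mapMatrix.comp
    (LinearMap.toMatrixAlgEquiv' : Module.End F (Fin 4 → F) ≃ₐ[F] _).toRingEquiv.toRingHom

theorem endToMatrix_apply (ι : F →+* k) (T : Module.End F (Fin 4 → F)) (i j : Fin 4) :
    endToMatrix ι T i j = ι (T (Pi.single j 1) i) := by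
  change ι (LinearMap.toMatrixAlgEquiv' T i j) = _
  rw [LinearMap.toMatrixAlgEquiv'_apply]

theorem endToMatrix_mulVec (ι : F →+* k) (T : Module.End F (Fin 4 → F)) (x : Fin 4 → F) :
    (endToMatrix ι T).mulVec (fun i => ι (x i)) = fun i => ι (T x i) := by
  ext i
  have h : T x = (LinearMap.toMatrixAlgEquiv' T).mulVec x := by
    rw [← Matrix.toLinAlgEquiv'_apply, Matrix.toLinAlgEquiv'_toMatrixAlgEquiv']
  rw [h]
  simp only [Matrix.mulVec, dotProduct, map_sum, map_mul]
  rfl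

theorem endToMatrix_rankOne (ι : F →+* k) (u w : Fin 4 → F) :
    endToMatrix ι ((quatPolar F).rankOne u w) = endToMatrix (RingHom.id k)
      ((quatPolar k).rankOne (fun i => ι (u i)) fun i => ι (w i)) := by
  ext i j
  rw [endToMatrix_apply, endToMatrix_apply, rankOne_apply, rankOne_apply, Pi.smul_apply,
    Pi.smul_apply, smul_eq_mul, smul_eq_mul, map_mul, RingHom.id_apply, ← quatPolar_map]
  congr 3
  ext l
  rcases eq_or_ne l j with rfl | h
  · simp
  · simp [h]

theorem endToMatrix_smul (ι : F →+* k) (a : F) (T : Module.End F (Fin 4 → F)) :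
    endToMatrix ι (a • T) = ι a • endToMatrix ι T := by
  ext i j
  simp [endToMatrix_apply]

theorem endToMatrix_reflection (ι : F →+* k) (g : Fin 4 → F) :
    endToMatrix ι ((quatPolar F).reflection g) =
      endToMatrix (RingHom.id k) ((quatPolar k).reflection fun i => ι (g i)) := by
  rw [reflection, reflection, map_sub, map_sub, map_one, map_one, endToMatrix_smul,
    endToMatrix_smul, endToMatrix_rankOne, quatPolar_map, RingHom.id_apply, map_div₀, map_ofNat]

variable {k : Type*} [NormedField k]

/-- The endomorphisms which are limits, for every `m > 0`, of isometries congruent to `1` modulo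
`m`. -/
def congruenceClosure (R : Subring F) (ι : F →+* k) : Submonoid (Module.End k (Fin 4 → k)) :=
  ⨅ m : ℕ+, (((congruenceIsometries R m).map (endToMatrix ι)).topologicalClosure).comap
    (endToMatrix (RingHom.id k))

theorem mem_congruenceClosure {R : Subring F} {ι : F →+* k} {T : Module.End k (Fin 4 → k)} :
    T ∈ congruenceClosure R ι ↔ ∀ m : ℕ, 0 < m → endToMatrix (RingHom.id k) T ∈
      closure (endToMatrix ι '' (congruenceIsometries R m : Set (Module.End F (Fin 4 → F)))) := by
  simp only [congruenceClosure, Submonoid.mem_iInf]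
  exact ⟨fun h m hm => h ⟨m, hm⟩, fun h m => h m m.2⟩
end CongruenceIsometries

section CongruenceNormal
open LinearMap.BilinForm Filter Topology

variable {F : Type*} [Field F] {R : Subring F}

theorem mul_apply_mem_of_forall_single {a : F} {T : Module.End F (Fin 4 → F)}
    (h : ∀ i j, a * T (Pi.single j 1) i ∈ R) {x : Fin 4 → F} (hx : ∀ i, x i ∈ R) (i : Fin 4) :
    a * T x i ∈ R := by
  have h1 := congrFun (endToMatrix_mulVec (RingHom.id F) T x) i
  simp only [RingHom.id_apply, Matrix.mulVec, dotProduct, endToMatrix_apply] at h1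
  rw [← h1, Finset.mul_sum]
  refine R.sum_mem fun j _ => ?_
  rw [← mul_assoc]
  exact R.mul_mem (h i j) (hx j)

theorem exists_natCast_mul_apply_mem (hR : ∀ x : F, ∃ D : ℕ, 0 < D ∧ (D : F) * x ∈ R)
    (T : Module.End F (Fin 4 → F)) :
    ∃ D : ℕ, 0 < D ∧ ∀ x : Fin 4 → F, (∀ i, x i ∈ R) → ∀ i, (D : F) * T x i ∈ R := by
  choose d hd hdR using hR
  let f : Fin 4 × Fin 4 → ℕ := fun ij => d (T (Pi.single ij.2 1) ij.1)
  refine ⟨∏ ij, f ij, Finset.prod_pos fun _ _ => hd _, fun x hx =>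
    mul_apply_mem_of_forall_single (fun i j => ?_) hx⟩
  obtain ⟨q, hq⟩ := Finset.dvd_prod_of_mem f (Finset.mem_univ (i, j))
  rw [hq, Nat.cast_mul, mul_comm (f (i, j) : F), mul_assoc]
  exact R.mul_mem (natCast_mem R q) (hdR _)

theorem exists_reflection_conj_mem [CharZero F]
    (hR : ∀ x : F, ∃ D : ℕ, 0 < D ∧ (D : F) * x ∈ R) {g : Fin 4 → F} (hg : quatPolar F g g ≠ 0)
    {m : ℕ} (hm : 0 < m) : ∃ n : ℕ, 0 < n ∧ ∀ G ∈ congruenceIsometries R n,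
      (quatPolar F).reflection g * G * (quatPolar F).reflection g ∈ congruenceIsometries R m := by
  obtain ⟨D, hD, hDR⟩ := exists_natCast_mul_apply_mem hR ((quatPolar F).reflection g)
  have hD0 : (D : F) ≠ 0 := Nat.cast_ne_zero.2 hD.ne'
  have hB := quatPolar_isSymm F
  refine ⟨m * D ^ 2, by positivity, fun G ⟨hG, hG'⟩ => ⟨fun x y => ?_, fun x hx => ?_⟩⟩
  · simp only [Module.End.mul_apply]
    rw [reflection_isometry hB hg, hG, reflection_isometry hB hg]
  · obtain ⟨y, hy, hxy⟩ := hG' ((D : F) • (quatPolar F).reflection g x) fun i => hDR x hx i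
    refine ⟨(D : F) • (quatPolar F).reflection g y, fun i => hDR y hy i, ?_⟩
    have h1 : G ((quatPolar F).reflection g x) =
        (quatPolar F).reflection g x + ((m * D : ℕ) : F) • y := by
      rw [map_smul] at hxy
      have h2 := congrArg (fun v => (D : F)⁻¹ • v) hxy
      simp only [smul_add, smul_smul, inv_mul_cancel₀ hD0, one_smul] at h2
      rw [h2]
      congr 2
      push_cast
      field_simp
    have h3 : (quatPolar F).reflection g ((quatPolar F).reflection g x) = x := by
      rw [← Module.End.mul_apply, reflection_mul_self hg, Module.End.one_apply]
    rw [Module.End.mul_apply, Module.End.mul_apply, h1, map_add, map_smul, h3, smul_smul]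
    push_cast
    rfl

variable {k : Type*} [NormedField k] {ι : F →+* k}

theorem continuousOn_endToMatrix_reflection :
    ContinuousOn (fun g => endToMatrix (RingHom.id k) ((quatPolar k).reflection g))
      {g | quatPolar k g g ≠ 0} := by
  refine continuousOn_pi.2 fun i => continuousOn_pi.2 fun j => ?_
  simp only [endToMatrix_apply, reflection_apply, RingHom.id_apply, Pi.sub_apply, Pi.smul_apply,
    smul_eq_mul]
  have h1 : Continuous fun g : Fin 4 → k => quatPolar k g g := by
    simp only [quatPolar_apply]
    fun_prop
  have h2 : Continuous fun g : Fin 4 → k => quatPolar k (Pi.single j 1) g := by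
    simp only [quatPolar_apply]
    fun_prop
  exact continuousOn_const.sub (((continuousOn_const.div h1.continuousOn fun _ h => h).mul
    h2.continuousOn).mul (continuous_apply i).continuousOn)

theorem reflection_conj_mem_congruenceClosure [CharZero F]
    (hR : ∀ x : F, ∃ D : ℕ, 0 < D ∧ (D : F) * x ∈ R) (hd : DenseRange ι) {g : Fin 4 → k}
    (hg : quatPolar k g g ≠ 0) {T : Module.End k (Fin 4 → k)} (hT : T ∈ congruenceClosure R ι) :
    (quatPolar k).reflection g * T * (quatPolar k).reflection g ∈ congruenceClosure R ι := by
  rw [mem_congruenceClosure] at hT ⊢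
  intro m hm
  have hopen : IsOpen {g : Fin 4 → k | quatPolar k g g ≠ 0} := by
    refine isOpen_ne_fun ?_ continuous_const
    simp only [quatPolar_apply]
    fun_prop
  have hdense : DenseRange (Pi.map fun _ : Fin 4 => ι) := DenseRange.piMap fun _ => hd
  have hgc := hdense.open_subset_closure_inter hopen hg
  have hP := continuousOn_endToMatrix_reflection (k := k)
  have hcont : ContinuousOn (fun g => endToMatrix (RingHom.id k)
      ((quatPolar k).reflection g * T * (quatPolar k).reflection g))
      {g | quatPolar k g g ≠ 0} := by
    simp only [map_mul]
    exact (hP.mul continuousOn_const).mul hP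
  rw [← closure_closure]
  refine ((hcont g hg).mono Set.inter_subset_left).mem_closure hgc ?_
  rintro _ ⟨hg', x, rfl⟩
  have hx : quatPolar F x x ≠ 0 := by
    intro h0
    refine hg' ?_
    change quatPolar k (fun i => ι (x i)) (fun i => ι (x i)) = 0
    rw [quatPolar_map, h0, map_zero]
  obtain ⟨n, hn, hconj⟩ := exists_reflection_conj_mem hR hx hm
  have hPx : endToMatrix (RingHom.id k) ((quatPolar k).reflection (Pi.map (fun _ => ι) x)) =
      endToMatrix ι ((quatPolar F).reflection x) := (endToMatrix_reflection ι x).symm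
  simp only [map_mul, hPx]
  refine map_mem_closure (f := fun M => endToMatrix ι ((quatPolar F).reflection x) * M *
    endToMatrix ι ((quatPolar F).reflection x)) (by fun_prop) (hT n hn) ?_
  rintro _ ⟨G, hG, rfl⟩
  exact ⟨_, hconj G hG, by simp only [map_mul]⟩
end CongruenceNormal

namespace LinearMap.BilinForm

section Rotation
variable {k V : Type*} [Field k] [AddCommGroup V] [Module k V] (B : LinearMap.BilinForm k V)

/-- The rotation in the plane spanned by the orthogonal vectors `y` and `t`, where
`B t t = 2 * c` and `a ^ 2 + c * d = 1`, `B y y = 2 * d`. -/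
def rotation (c a d : k) (y t : V) : Module.End k V :=
  1 - c • B.rankOne y y - a • B.rankOne y t + a • B.rankOne t y - d • B.rankOne t t

theorem rotation_apply (c a d : k) (y t x : V) : B.rotation c a d y t x =
    x - (c * B x y) • y - (a * B x y) • t + (a * B x t) • y - (d * B x t) • t := by
  simp [rotation, mul_smul]

variable {B}

theorem rotation_isometry (hB : B.IsSymm) {c a d : k} {y t : V} (hy : B y y = 2 * d)
    (ht : B t t = 2 * c) (hyt : B y t = 0) (had : a ^ 2 + c * d = 1) (v w : V) :
    B (B.rotation c a d y t v) (B.rotation c a d y t w) = B v w := by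
  have hty : B t y = 0 := by rw [hB.eq, hyt]
  simp only [rotation_apply, map_sub, map_add, map_smul, LinearMap.sub_apply, LinearMap.add_apply,
    LinearMap.smul_apply, smul_eq_mul, hB.eq y w, hB.eq t w, hy, ht, hyt, hty]
  linear_combination (2 * B v t * d * B w t + 2 * c * B v y * B w y) * had

theorem mul_rotation_mul {S T : Module.End k V} (hST : S * T = 1)
    (hS : ∀ x y, B (S x) (S y) = B x y) (c a d : k) (y t : V) :
    S * B.rotation c a d y t * T = B.rotation c a d (S y) (S t) := by
  have h := mul_rankOne_mul (B := B) (S := S) (T := T) fun x y => by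
    rw [← hS, ← Module.End.mul_apply, hST, Module.End.one_apply]
  simp only [rotation, mul_add, add_mul, mul_sub, sub_mul, mul_one, hST, h, mul_smul_comm,
    smul_mul_assoc]

theorem rotation_smul_eq_eichler [CharZero k] {c a : k} (ha : a ^ 2 = 1) {e t : V}
    (ht : B t t = 2 * c) (μ : k) :
    B.rotation c a 0 (μ • e) t = B.eichler e ((-(a * μ)) • t) := by
  ext x
  simp only [rotation_apply, eichler_apply, map_smul, LinearMap.smul_apply, smul_eq_mul, ht]
  match_scalars
  · ring
  · linear_combination (c * B x e * μ ^ 2) * ha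
  · ring

end Rotation
end LinearMap.BilinForm

section CongruenceRotation
open LinearMap.BilinForm

variable {F : Type*} [Field F] {R : Subring F}

theorem conj_mem_congruenceIsometries {S T G : Module.End F (Fin 4 → F)}
    (hS : S ∈ congruenceIsometries R 1) (hT : T ∈ congruenceIsometries R 1) (hST : S * T = 1)
    {m : ℕ} (hG : G ∈ congruenceIsometries R m) : S * G * T ∈ congruenceIsometries R m := by
  have hmem : ∀ U ∈ congruenceIsometries R 1, ∀ x : Fin 4 → F, (∀ i, x i ∈ R) → ∀ i, U x i ∈ R := by
    intro U hU x hx i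
    obtain ⟨y, hy, h⟩ := hU.2 x hx
    rw [h]
    exact R.add_mem (hx i) (R.mul_mem (natCast_mem R 1) (hy i))
  refine ⟨fun x y => ?_, fun x hx => ?_⟩
  · simp only [Module.End.mul_apply]
    rw [hS.1, hG.1, hT.1]
  · obtain ⟨y, hy, h⟩ := hG.2 (T x) (hmem T hT x hx)
    refine ⟨S y, hmem S hS y hy, ?_⟩
    rw [Module.End.mul_apply, Module.End.mul_apply, h, map_add, map_smul, ← Module.End.mul_apply,
      hST, Module.End.one_apply]

theorem quatPolar_mem {x y : Fin 4 → F} (hx : ∀ i, x i ∈ R) (hy : ∀ i, y i ∈ R) :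
    quatPolar F x y ∈ R := by
  rw [quatPolar_apply]
  have h2 : (2 : F) ∈ R := ofNat_mem R 2
  refine R.add_mem (R.add_mem (R.add_mem (R.add_mem (R.add_mem ?_ ?_) ?_) ?_) ?_) ?_
  all_goals first
    | exact R.mul_mem h2 (R.mul_mem (hx _) (hy _))
    | exact R.mul_mem (hx _) (hy _)

theorem reflection_mem_congruenceIsometries [CharZero F] {g : Fin 4 → F} (hg : ∀ i, g i ∈ R)
    (hq0 : quat g ≠ 0) (hq : (quat g)⁻¹ ∈ R) :
    (quatPolar F).reflection g ∈ congruenceIsometries R 1 := by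
  have hgg : quatPolar F g g ≠ 0 := by
    rw [quatPolar_self]
    exact mul_ne_zero two_ne_zero hq0
  refine ⟨reflection_isometry (quatPolar_isSymm F) hgg, fun x hx =>
    ⟨-((quat g)⁻¹ * quatPolar F x g) • g, fun i => ?_, ?_⟩⟩
  · exact R.mul_mem (R.neg_mem (R.mul_mem hq (quatPolar_mem hx hg))) (hg i)
  · rw [reflection_apply, quatPolar_self]
    match_scalars
    · rfl
    · field_simp

theorem rotation_mem_congruenceIsometries {c m : ℕ} {a b : F} (ha : a ∈ R) (hb : b ∈ R)
    (hab : a ^ 2 + c * (m * b) ^ 2 = 1) {z t : Fin 4 → F} (hz : ∀ i, z i ∈ R) (ht : ∀ i, t i ∈ R)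
    (hzz : quatPolar F z z = 2) (htt : quatPolar F t t = 2 * c) (hzt : quatPolar F z t = 0) :
    (quatPolar F).rotation c a ((m * b) ^ 2) ((m * b) • z) t ∈ congruenceIsometries R m := by
  refine ⟨rotation_isometry (quatPolar_isSymm F) ?_ htt (by simp [hzt]) hab, fun x hx =>
    ⟨(-(c * (m * b ^ 2) * quatPolar F x z)) • z + (-(a * b * quatPolar F x z)) • t +
      (a * b * quatPolar F x t) • z + (-(m * b ^ 2 * quatPolar F x t)) • t, fun i => ?_, ?_⟩⟩
  · simp only [map_smul, LinearMap.smul_apply, smul_eq_mul, hzz]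
    ring
  · have h1 := quatPolar_mem hx hz
    have h2 := quatPolar_mem hx ht
    have hm : (m : F) ∈ R := natCast_mem R m
    have hc : (c : F) ∈ R := natCast_mem R c
    have hb2 := R.mul_mem hm (R.pow_mem hb 2)
    exact R.add_mem (R.add_mem (R.add_mem
      (R.mul_mem (R.neg_mem (R.mul_mem (R.mul_mem hc hb2) h1)) (hz i))
      (R.mul_mem (R.neg_mem (R.mul_mem (R.mul_mem ha hb) h1)) (ht i)))
      (R.mul_mem (R.mul_mem (R.mul_mem ha hb) h2) (hz i)))
      (R.mul_mem (R.neg_mem (R.mul_mem hb2 h2)) (ht i))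
  · rw [LinearMap.BilinForm.rotation_apply]
    simp only [map_smul, smul_eq_mul]
    match_scalars <;> ring

theorem congruenceIsometries_anti {m n : ℕ} (h : m ∣ n) :
    congruenceIsometries R n ≤ congruenceIsometries R m := by
  obtain ⟨q, rfl⟩ := h
  rintro G ⟨hG, hG'⟩
  refine ⟨hG, fun x hx => ?_⟩
  obtain ⟨y, hy, hxy⟩ := hG' x hx
  exact ⟨(q : F) • y, fun i => R.mul_mem (natCast_mem R q) (hy i), by
    rw [hxy, smul_smul, Nat.cast_mul]⟩

end CongruenceRotation

section RotationLimit
open LinearMap.BilinForm Filter Topology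

theorem exists_subseq_tendsto_mul_pow {k : Type*} [NormedField k] [ProperSpace k] {c l : k}
    (hl : 1 < ‖l‖) {A B : ℕ → k} (hB0 : ∀ i, B i ≠ 0) (hB1 : ∀ i, ‖B i‖ ≤ 1)
    (hB : Tendsto B atTop (𝓝 0)) (hAB : ∀ i, A i ^ 2 + c * B i ^ 2 = 1) :
    ∃ (φ n : ℕ → ℕ) (A₀ μ : k), StrictMono φ ∧ A₀ ^ 2 = 1 ∧ μ ≠ 0 ∧
      Tendsto (A ∘ φ) atTop (𝓝 A₀) ∧ Tendsto (B ∘ φ) atTop (𝓝 0) ∧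
      Tendsto (fun i => B (φ i) * l ^ n i) atTop (𝓝 μ) ∧
      Tendsto (fun i => B (φ i) * (l ^ n i)⁻¹) atTop (𝓝 0) := by
  have hl0 : 0 < ‖l‖ := one_pos.trans hl
  have hn (i : ℕ) : ∃ n : ℕ, ‖l‖ ^ n ≤ ‖B i‖⁻¹ ∧ ‖B i‖⁻¹ < ‖l‖ ^ (n + 1) :=
    exists_nat_pow_near ((one_le_inv₀ (norm_pos_iff.2 (hB0 i))).2 (hB1 i)) hl
  choose n hn1 hn2 using hn
  have hup (i : ℕ) : ‖B i * l ^ n i‖ ≤ 1 := by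
    rw [norm_mul, norm_pow, mul_comm, ← le_div_iff₀ (norm_pos_iff.2 (hB0 i)), one_div]
    exact hn1 i
  have hlow (i : ℕ) : ‖l‖⁻¹ ≤ ‖B i * l ^ n i‖ := by
    have := (hn2 i).le
    rw [inv_le_iff_one_le_mul₀ (norm_pos_iff.2 (hB0 i))] at this
    rw [inv_le_iff_one_le_mul₀ hl0, norm_mul, norm_pow]
    linarith [pow_succ ‖l‖ (n i), mul_comm (‖l‖ ^ (n i + 1)) ‖B i‖,
      mul_assoc ‖B i‖ (‖l‖ ^ n i) ‖l‖, congrArg (‖B i‖ * ·) (pow_succ ‖l‖ (n i))]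
  have hA (i : ℕ) : ‖A i‖ ≤ 1 + ‖c‖ := by
    have h1 : ‖A i‖ ^ 2 ≤ 1 + ‖c‖ := by
      rw [← norm_pow, show A i ^ 2 = 1 - c * B i ^ 2 by linear_combination hAB i]
      refine (norm_sub_le _ _).trans ?_
      rw [norm_one, norm_mul, norm_pow]
      gcongr
      exact mul_le_of_le_one_right (norm_nonneg _) (pow_le_one₀ (norm_nonneg _) (hB1 i))
    nlinarith [norm_nonneg (A i), norm_nonneg c]
  obtain ⟨⟨A₀, μ⟩, -, φ, hφ, h⟩ := tendsto_subseq_of_bounded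
    (Metric.isBounded_closedBall (x := (0 : k × k)) (r := 1 + ‖c‖))
    (x := fun i => (A i, B i * l ^ n i)) fun i => by
      rw [mem_closedBall_zero_iff, Prod.norm_def]
      exact max_le (hA i) ((hup i).trans (by linarith [norm_nonneg c]))
  have hAφ : Tendsto (A ∘ φ) atTop (𝓝 A₀) := (continuous_fst.tendsto _).comp h
  have hμ : Tendsto (fun i => B (φ i) * l ^ n (φ i)) atTop (𝓝 μ) :=
    (continuous_snd.tendsto _).comp h
  have hBφ : Tendsto (B ∘ φ) atTop (𝓝 0) := hB.comp hφ.tendsto_atTop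
  refine ⟨φ, n ∘ φ, A₀, μ, hφ, ?_, ?_, hAφ, hBφ, hμ, ?_⟩
  · have h1 := (hAφ.pow 2).add ((hBφ.pow 2).const_mul c)
    have h2 : (fun i => (A ∘ φ) i ^ 2 + c * (B ∘ φ) i ^ 2) = fun _ => 1 := funext fun i => hAB _
    rw [h2] at h1
    simpa using (tendsto_nhds_unique h1 tendsto_const_nhds)
  · rintro rfl
    have h1 := ge_of_tendsto' hμ.norm fun i => hlow (φ i)
    rw [norm_zero] at h1
    exact (inv_pos.2 hl0).not_ge h1
  · refine squeeze_zero_norm (fun i => ?_) (tendsto_zero_iff_norm_tendsto_zero.1 hBφ)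
    rw [norm_mul, norm_inv, norm_pow]
    exact mul_le_of_le_one_right (norm_nonneg _) (inv_le_one_of_one_le₀ (one_le_pow₀ hl.le))

variable {F k : Type*} [Field F] [Field k]

theorem endToMatrix_rotation (ι : F →+* k) (c a d : F) (y t : Fin 4 → F) :
    endToMatrix ι ((quatPolar F).rotation c a d y t) = endToMatrix (RingHom.id k)
      ((quatPolar k).rotation (ι c) (ι a) (ι d) (fun i => ι (y i)) fun i => ι (t i)) := by
  simp only [LinearMap.BilinForm.rotation, map_sub, map_add, map_one, endToMatrix_smul, endToMatrix_rankOne,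
    RingHom.id_apply]

theorem map_reflection_apply (ι : F →+* k) (g x : Fin 4 → F) :
    (fun i => ι ((quatPolar F).reflection g x i)) =
      (quatPolar k).reflection (fun i => ι (g i)) fun i => ι (x i) := by
  ext i
  simp only [reflection_apply, quatPolar_map, Pi.sub_apply, Pi.smul_apply, smul_eq_mul,
    _root_.map_sub, _root_.map_mul, map_div₀, map_ofNat]

theorem continuous_endToMatrix_rotation {k : Type*} [NormedField k] (c : k) (t : Fin 4 → k) :
    Continuous fun p : k × k × (Fin 4 → k) =>
      endToMatrix (RingHom.id k) ((quatPolar k).rotation c p.1 p.2.1 p.2.2 t) := by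
  refine continuous_matrix fun i j => ?_
  simp only [endToMatrix_apply, LinearMap.BilinForm.rotation_apply, quatPolar_apply, Pi.sub_apply,
    Pi.add_apply, Pi.smul_apply, smul_eq_mul, RingHom.id_apply]
  fun_prop

end RotationLimit

namespace LinearMap.BilinForm
variable {k V : Type*} [Field k] [AddCommGroup V] [Module k V] {B : LinearMap.BilinForm k V}

/-- The product of the reflections in `z` and `a • z + b • s` acts diagonally on the isotropic lines
of the plane spanned by `z` and `s`. -/
theorem reflection_reflection_apply_isotropic [CharZero k] (hB : B.IsSymm) {c a b κ : k} {z s : V}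
    (hzz : B z z = 2) (hss : B s s = 2 * c) (hzs : B z s = 0) (hκ : κ ^ 2 = -c)
    (h1 : a + b * κ ≠ 0) (h2 : a - b * κ ≠ 0) :
    B.reflection z (B.reflection (a • z + b • s) (s + κ • z)) =
      ((a - b * κ) / (a + b * κ)) • (s + κ • z) := by
  have hsz : B s z = 0 := by rw [hB.eq, hzs]
  have hc : c = -κ ^ 2 := by rw [hκ, neg_neg]
  subst hc
  have hu : B (a • z + b • s) (a • z + b • s) = 2 * ((a + b * κ) * (a - b * κ)) := by
    simp only [map_add, map_smul, LinearMap.add_apply, LinearMap.smul_apply, smul_eq_mul, hzz, hss,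
      hzs, hsz]
    ring
  have hu' : B (s + κ • z) (a • z + b • s) = 2 * κ * (a - b * κ) := by
    simp only [map_add, map_smul, LinearMap.add_apply, LinearMap.smul_apply, smul_eq_mul, hzz, hss,
      hzs, hsz]
    ring
  have hr : B.reflection (a • z + b • s) (s + κ • z) =
      ((a - b * κ) / (a + b * κ)) • (s - κ • z) := by
    have h3 : 2 / (2 * ((a + b * κ) * (a - b * κ))) * (2 * κ * (a - b * κ)) =
        2 * κ / (a + b * κ) := by
      rw [div_mul_eq_mul_div, div_eq_div_iff (by simp [h1, h2]) h1]
      ring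
    rw [reflection_apply, hu, hu', h3]
    match_scalars <;> rw [div_eq_mul_inv, div_eq_mul_inv] <;>
      nth_rw 1 [← mul_inv_cancel₀ h1] <;> ring
  rw [hr, map_smul, reflection_apply, hzz]
  congr 1
  simp only [map_sub, map_smul, LinearMap.sub_apply, LinearMap.smul_apply, smul_eq_mul, hzz, hsz]
  match_scalars <;> ring

end LinearMap.BilinForm

section RotationLimit
open LinearMap.BilinForm Filter Topology

theorem exists_eichler_mem_congruenceClosure {F k : Type*} [Field F] [CharZero F] [NormedField k]
    [CharZero k] [ProperSpace k] [IsUltrametricDist k] {R : Subring F} {ι : F →+* k} {c ℓ : ℕ}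
    {z s t : Fin 4 → F} (hz : ∀ i, z i ∈ R) (hs : ∀ i, s i ∈ R) (ht : ∀ i, t i ∈ R)
    (hzz : quatPolar F z z = 2) (hss : quatPolar F s s = 2 * c) (htt : quatPolar F t t = 2 * c)
    (hzs : quatPolar F z s = 0) (hzt : quatPolar F z t = 0) (hst : quatPolar F s t = 0)
    {κ : k} (hκ : κ ^ 2 = -(c : k)) (hκ0 : κ ≠ 0) {a b : F} (ha : a ∈ R) (hb : b ∈ R)
    (hN0 : a ^ 2 + c * b ^ 2 ≠ 0) (hN : (a ^ 2 + c * b ^ 2)⁻¹ ∈ R)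
    (hab1 : ‖ι a + ι b * κ‖ < 1) (hab2 : ‖ι a - ι b * κ‖ = 1)
    (hpell : ∀ m : ℕ, 0 < m → ∃ A ∈ R, ∃ b' ∈ R, b' ≠ 0 ∧ ‖ι b'‖ ≤ 1 ∧ A ^ 2 + c * (m * b') ^ 2 = 1)
    (hℓ0 : 0 < ℓ) (hℓ : ‖(ℓ : k)‖ < 1) :
    ∃ ν : k, ν ≠ 0 ∧ (quatPolar k).eichler ((fun i => ι (s i)) + κ • fun i => ι (z i))
      (ν • fun i => ι (t i)) ∈ congruenceClosure R ι := by
  have hB := quatPolar_isSymm F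
  set zk : Fin 4 → k := fun i => ι (z i) with hzk
  set sk : Fin 4 → k := fun i => ι (s i) with hsk
  set tk : Fin 4 → k := fun i => ι (t i) with htk
  have hzzk : quatPolar k zk zk = 2 := by rw [quatPolar_map, hzz, map_ofNat]
  have hssk : quatPolar k sk sk = 2 * c := by
    rw [quatPolar_map, hss, map_mul, map_ofNat, map_natCast]
  have httk : quatPolar k tk tk = 2 * c := by
    rw [quatPolar_map, htt, map_mul, map_ofNat, map_natCast]
  have hzsk : quatPolar k zk sk = 0 := by rw [quatPolar_map, hzs, map_zero]
  have hnorm : (ι a + ι b * κ) * (ι a - ι b * κ) = ι (a ^ 2 + c * b ^ 2) := by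
    simp only [map_add, map_mul, map_pow, map_natCast]
    linear_combination (-(ι b) ^ 2) * hκ
  have hne1 : ι a + ι b * κ ≠ 0 := fun h => by
    rw [h, zero_mul, eq_comm, map_eq_zero] at hnorm
    exact hN0 hnorm
  have hne2 : ι a - ι b * κ ≠ 0 := fun h => by
    rw [h, norm_zero] at hab2
    exact zero_ne_one hab2
  set u : Fin 4 → F := a • z + b • s with hu
  have huR : ∀ i, u i ∈ R := fun i => R.add_mem (R.mul_mem ha (hz i)) (R.mul_mem hb (hs i))
  have hqz : quat z = 1 := by
    have := quatPolar_self z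
    rw [hzz] at this
    exact (mul_left_cancel₀ two_ne_zero (by rw [← this, mul_one]))
  have hqu : quatPolar F u u = 2 * (a ^ 2 + c * b ^ 2) := by
    have hsz : quatPolar F s z = 0 := by rw [hB.eq, hzs]
    simp only [hu, map_add, map_smul, LinearMap.add_apply, LinearMap.smul_apply, smul_eq_mul, hzz,
      hss, hzs, hsz]
    ring
  have hqu' : quat u = a ^ 2 + c * b ^ 2 := by
    rw [quatPolar_self] at hqu
    exact mul_left_cancel₀ two_ne_zero hqu
  have huu : quatPolar F u u ≠ 0 := by
    rw [hqu]; exact mul_ne_zero two_ne_zero hN0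
  have hzz0 : quatPolar F z z ≠ 0 := by rw [hzz]; exact two_ne_zero
  have hrz := reflection_mem_congruenceIsometries hz (by rw [hqz]; exact one_ne_zero)
    (by rw [hqz, inv_one]; exact R.one_mem)
  have hru := reflection_mem_congruenceIsometries huR (by rwa [hqu']) (by rwa [hqu'])
  set S := (quatPolar F).reflection z * (quatPolar F).reflection u with hS
  set T := (quatPolar F).reflection u * (quatPolar F).reflection z with hT
  have hST : S * T = 1 := by
    rw [hS, hT, mul_assoc, ← mul_assoc ((quatPolar F).reflection u), reflection_mul_self huu,
      one_mul, reflection_mul_self hzz0]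
  have hTS : T * S = 1 := by
    rw [hS, hT, mul_assoc, ← mul_assoc ((quatPolar F).reflection z), reflection_mul_self hzz0,
      one_mul, reflection_mul_self huu]
  have hSmem (n : ℕ) : S ^ n ∈ congruenceIsometries R 1 :=
    pow_mem (mul_mem hrz hru) n
  have hTmem (n : ℕ) : T ^ n ∈ congruenceIsometries R 1 :=
    pow_mem (mul_mem hru hrz) n
  have hSTn (n : ℕ) : S ^ n * T ^ n = 1 := by
    rw [← (show Commute S T from hST.trans hTS.symm).mul_pow, hST, one_pow]
  have hStn (n : ℕ) : (S ^ n) t = t := by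
    have h : S t = t := by
      rw [hS, Module.End.mul_apply, reflection_apply_of_orthogonal (g := u),
        reflection_apply_of_orthogonal]
      · rw [hB.eq, hzt]
      · rw [hB.eq, hu]
        simp [hzt, hst]
    induction n with
    | zero => rfl
    | succ n ih => rw [pow_succ, Module.End.mul_apply, h, ih]
  set l : k := (ι a - ι b * κ) / (ι a + ι b * κ) with hl
  have hl0 : l ≠ 0 := div_ne_zero hne2 hne1
  have hl1 : 1 < ‖l‖ := by
    rw [hl, norm_div, hab2, one_div]
    exact (one_lt_inv₀ (norm_pos_iff.2 hne1)).2 hab1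
  have hSe : (quatPolar k).reflection zk ((quatPolar k).reflection (ι a • zk + ι b • sk)
      (sk + κ • zk)) = l • (sk + κ • zk) :=
    reflection_reflection_apply_isotropic (quatPolar_isSymm k) hzzk hssk hzsk hκ hne1 hne2
  have hSf : (quatPolar k).reflection zk ((quatPolar k).reflection (ι a • zk + ι b • sk)
      (sk + (-κ) • zk)) = l⁻¹ • (sk + (-κ) • zk) := by
    have := reflection_reflection_apply_isotropic (quatPolar_isSymm k) hzzk hssk hzsk
      (κ := -κ) (a := ι a) (b := ι b) (by rw [neg_sq, hκ]) (by rwa [mul_neg, ← sub_eq_add_neg])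
      (by rwa [mul_neg, sub_neg_eq_add])
    rw [this, hl, inv_div, mul_neg, sub_neg_eq_add, ← sub_eq_add_neg]
  have huk : (fun i => ι (u i)) = ι a • zk + ι b • sk := by
    ext i
    simp [hu, hzk, hsk]
  have hSk (x : Fin 4 → F) : (fun i => ι (S x i)) = (quatPolar k).reflection zk
      ((quatPolar k).reflection (ι a • zk + ι b • sk) fun i => ι (x i)) := by
    rw [hS, Module.End.mul_apply, map_reflection_apply, map_reflection_apply, huk]
  have hSz (n : ℕ) : (fun i => ι ((S ^ n) z i)) =
      (l ^ n / (2 * κ)) • (sk + κ • zk) - ((l ^ n)⁻¹ / (2 * κ)) • (sk + (-κ) • zk) := by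
    induction n with
    | zero =>
      change zk = _
      rw [pow_zero, inv_one]
      match_scalars <;> field_simp <;> ring
    | succ n ih =>
      rw [pow_succ', Module.End.mul_apply, hSk, ih, map_sub, map_sub, map_smul, map_smul, map_smul,
        map_smul, hSe, hSf, smul_smul, smul_smul, pow_succ, mul_inv]
      congr 2 <;> ring
  set m : ℕ → ℕ := fun i => i.factorial * ℓ ^ i with hmdef
  have hm (i : ℕ) : 0 < m i := by positivity
  have hm0 (i : ℕ) : (m i : F) ≠ 0 := Nat.cast_ne_zero.2 (hm i).ne'
  choose A hAR b' hb'R hb'0 hb'1 hAb using fun i => hpell (m i) (hm i)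
  have hBle (i : ℕ) : ‖ι (m i * b' i)‖ ≤ ‖(ℓ : k)‖ ^ i := by
    rw [map_mul, map_natCast, norm_mul, hmdef, Nat.cast_mul, Nat.cast_pow, norm_mul, norm_pow]
    refine (mul_le_of_le_one_right (by positivity) (hb'1 _)).trans ?_
    exact mul_le_of_le_one_left (by positivity) (IsUltrametricDist.norm_natCast_le_one k _)
  obtain ⟨φ, n, A₀, μ, hφ, hA₀, hμ, hAlim, hBlim, hBl, hBl'⟩ := exists_subseq_tendsto_mul_pow
    (c := (c : k)) hl1 (A := fun i => ι (A i)) (B := fun i => ι (m i * b' i))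
    (fun i => by rw [_root_.map_ne_zero]; exact mul_ne_zero (hm0 i) (hb'0 i))
    (fun i => (hBle i).trans (pow_le_one₀ (norm_nonneg _) hℓ.le))
    (squeeze_zero_norm hBle (tendsto_pow_atTop_nhds_zero_of_lt_one (norm_nonneg _) hℓ))
    (fun i => by rw [← map_pow, ← map_pow, ← map_natCast ι c, ← map_mul, ← map_add, hAb, map_one])
  refine ⟨-(A₀ * (μ / (2 * κ))), neg_ne_zero.2 (mul_ne_zero ?_ (div_ne_zero hμ
    (mul_ne_zero two_ne_zero hκ0))), ?_⟩
  · rintro rfl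
    simp at hA₀
  rw [← rotation_smul_eq_eichler hA₀ httk, mem_congruenceClosure]
  intro M hM
  set y : ℕ → Fin 4 → F := fun i => (m (φ i) * b' (φ i)) • (S ^ n i) z with hy
  have hyk (i : ℕ) : (fun j => ι (y i j)) = (ι (m (φ i) * b' (φ i)) * l ^ n i / (2 * κ)) •
      (sk + κ • zk) - (ι (m (φ i) * b' (φ i)) * (l ^ n i)⁻¹ / (2 * κ)) • (sk + (-κ) • zk) := by
    have h : (fun j => ι (y i j)) = ι (m (φ i) * b' (φ i)) • fun j => ι ((S ^ n i) z j) := by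
      ext j
      simp [hy]
    rw [h, hSz, smul_sub, smul_smul, smul_smul, mul_div_assoc, mul_div_assoc]
  have hylim : Tendsto (fun i j => ι (y i j)) atTop (𝓝 ((μ / (2 * κ)) • (sk + κ • zk))) := by
    rw [show (fun i j => ι (y i j)) = _ from funext hyk]
    have := ((hBl.div_const (2 * κ)).smul_const (sk + κ • zk)).sub
      ((hBl'.div_const (2 * κ)).smul_const (sk + (-κ) • zk))
    rwa [zero_div, zero_smul, sub_zero] at this
  have hlim := ((continuous_endToMatrix_rotation (c : k) tk).tendsto _).comp
    (hAlim.prodMk_nhds ((hBlim.pow 2).prodMk_nhds hylim))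
  rw [zero_pow two_ne_zero] at hlim
  refine mem_closure_of_tendsto hlim ?_
  filter_upwards [eventually_ge_atTop M] with i hi
  refine ⟨S ^ n i * (quatPolar F).rotation c (A (φ i)) ((m (φ i) * b' (φ i)) ^ 2)
    ((m (φ i) * b' (φ i)) • z) t * T ^ n i, ?_, ?_⟩
  · refine congruenceIsometries_anti ?_ (conj_mem_congruenceIsometries (hSmem _) (hTmem _) (hSTn _)
      (rotation_mem_congruenceIsometries (hAR _) (hb'R _) (hAb _) hz ht hzz htt hzt))
    exact (Nat.dvd_factorial hM (hi.trans hφ.le_apply)).mul_right _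
  · rw [mul_rotation_mul (hSTn _) (hSmem _).1, hStn, map_smul, endToMatrix_rotation, map_natCast,
      map_pow]
    rfl

end RotationLimit

section IntegersAway
open IsDedekindDomain NumberField

variable {F : Type*} [Field F] [NumberField F]

/-- The elements of a number field that are integral at all primes other than `p`. -/
def integersAway (p : HeightOneSpectrum (𝓞 F)) : Subring F :=
  ⨅ v : {v : HeightOneSpectrum (𝓞 F) // v ≠ p}, (v.1.valuation F).integer

theorem mem_integersAway {p : HeightOneSpectrum (𝓞 F)} {x : F} :
    x ∈ integersAway p ↔ ∀ v : HeightOneSpectrum (𝓞 F), v ≠ p → v.valuation F x ≤ 1 := by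
  simp only [integersAway, Subring.mem_iInf, Subtype.forall, Valuation.mem_integer_iff]

theorem algebraMap_mem_integersAway (p : HeightOneSpectrum (𝓞 F)) (x : 𝓞 F) :
    algebraMap (𝓞 F) F x ∈ integersAway p :=
  mem_integersAway.2 fun v _ => v.valuation_le_one x

theorem exists_natCast_mul_mem_integersAway (p : HeightOneSpectrum (𝓞 F)) (x : F) :
    ∃ D : ℕ, 0 < D ∧ (D : F) * x ∈ integersAway p := by
  obtain ⟨y, hy, h⟩ := exists_integral_multiples ℤ ℚ {x}
  specialize h x (Finset.mem_singleton_self x)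
  refine ⟨y.natAbs, Int.natAbs_pos.2 hy, ?_⟩
  have h1 : IsIntegral ℤ ((y.natAbs : F) * x) := by
    rw [zsmul_eq_mul] at h
    rcases Int.natAbs_eq y with hy | hy
    · rwa [hy, Int.cast_natCast] at h
    · rw [hy, Int.cast_neg, Int.cast_natCast, neg_mul] at h
      simpa using h.neg
  exact algebraMap_mem_integersAway p ⟨_, h1⟩

theorem inv_mem_integersAway {p : HeightOneSpectrum (𝓞 F)} {x : 𝓞 F}
    (h : ∀ r : Ideal (𝓞 F), r.IsPrime → r ≠ p.asIdeal → x ∉ r) :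
    (algebraMap (𝓞 F) F x)⁻¹ ∈ integersAway p := by
  refine mem_integersAway.2 fun v hv => ?_
  have h1 := h v.asIdeal v.isPrime fun h => hv (HeightOneSpectrum.ext h)
  have h2 : v.valuation F (algebraMap (𝓞 F) F x) = 1 := by
    refine le_antisymm (v.valuation_le_one x) (not_lt.1 fun h => h1 ?_)
    exact (v.valuation_lt_one_iff_mem x).1 h
  rw [map_inv₀, h2, inv_one]

end IntegersAway

section Approximation
open LinearMap.BilinForm

theorem exists_mem_congruenceIsometries_apply_le_one {F k : Type*} [Field F] [NormedField k]
    [IsUltrametricDist k] {R : Subring F} {ι : F →+* k} {T : Module.End k (Fin 4 → k)}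
    (hT : T ∈ congruenceClosure R ι) {x : Fin 4 → F} (hx : ∀ i, ‖T (fun i => ι (x i)) i‖ ≤ 1) :
    ∃ G ∈ congruenceIsometries R 1, ∀ i, ‖ι (G x i)‖ ≤ 1 := by
  have hT' := mem_congruenceClosure.1 hT 1 one_pos
  have hopen : IsOpen {M : Matrix (Fin 4) (Fin 4) k | ∀ i, ‖M.mulVec (fun j => ι (x j)) i‖ ≤ 1} := by
    simp only [Set.ofPred_forall]
    refine isOpen_iInter_of_finite fun i => ?_
    have h1 : IsOpen (Metric.closedBall (0 : k) 1) :=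
      IsUltrametricDist.isOpen_closedBall _ one_ne_zero
    have h2 : Continuous fun M : Matrix (Fin 4) (Fin 4) k => M.mulVec (fun j => ι (x j)) i := by
      fun_prop
    have h3 := h1.preimage h2
    convert h3 using 1
    ext M
    simp
  have hmem : endToMatrix (RingHom.id k) T ∈
      {M : Matrix (Fin 4) (Fin 4) k | ∀ i, ‖M.mulVec (fun j => ι (x j)) i‖ ≤ 1} := by
    intro i
    have := congrFun (endToMatrix_mulVec (RingHom.id k) T fun i => ι (x i)) i
    simp only [RingHom.id_apply] at this
    rw [this]
    exact hx i
  obtain ⟨_, h1, G, hG, rfl⟩ := mem_closure_iff.1 hT' _ hopen hmem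
  refine ⟨G, hG, fun i => ?_⟩
  have := h1 i
  rwa [endToMatrix_mulVec] at this

end Approximation

section StrongApproximation
open LinearMap.BilinForm IsDedekindDomain NumberField

universe u
variable {F : Type u} [Field F] [NumberField F]

theorem exists_prime_natCast_mem (p : HeightOneSpectrum (𝓞 F)) :
    ∃ ℓ : ℕ, ℓ.Prime ∧ (ℓ : 𝓞 F) ∈ p.asIdeal := by
  have := p.isPrime
  obtain ⟨ℓ, hℓ⟩ := CharP.exists (𝓞 F ⧸ p.asIdeal)
  have hmem (n : ℕ) : (n : 𝓞 F) ∈ p.asIdeal ↔ ℓ ∣ n := by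
    rw [← Ideal.Quotient.eq_zero_iff_mem, map_natCast, CharP.cast_eq_zero_iff _ ℓ]
  rcases CharP.char_is_prime_or_zero (𝓞 F ⧸ p.asIdeal) ℓ with h | rfl
  · exact ⟨ℓ, h, (hmem ℓ).2 dvd_rfl⟩
  · have h0 := (hmem _).1 (Ideal.absNorm_mem p.asIdeal)
    exact absurd (Ideal.absNorm_eq_zero_iff.1 (zero_dvd_iff.1 h0)) p.ne_bot

theorem exists_mem_congruenceClosure_apply_le_one {k : Type u} [NormedField k]
    [IsUltrametricDist k] [ProperSpace k] {p : HeightOneSpectrum (𝓞 F)} {ι : F →+* k}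
    (h : IsCompletionAt p ι) (h6 : (6 : 𝓞 F) ∉ p.asIdeal) {w₁ : InfinitePlace F}
    (hw₁ : w₁.IsComplex) {v : Fin 4 → k} (hv0 : quat v ≠ 0) (hv : ‖quat v‖ ≤ 1) :
    ∃ T ∈ congruenceClosure (integersAway p) ι, ∀ i, ‖T v i‖ ≤ 1 := by
  have := IsCompletionAt.charZero ι
  have hsymm := quatPolar_isSymm k
  have h2p : (2 : 𝓞 F) ∉ p.asIdeal := fun h => h6 (by
    rw [show (6 : 𝓞 F) = 3 * 2 by norm_num]; exact p.asIdeal.mul_mem_left _ h)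
  have h3p : ((3 : ℕ) : 𝓞 F) ∉ p.asIdeal := fun h => h6 (by
    rw [show (6 : 𝓞 F) = 2 * (3 : ℕ) by norm_num]; exact p.asIdeal.mul_mem_left _ h)
  obtain ⟨ℓ, hℓ, hℓp⟩ : ∃ ℓ : ℕ, ℓ.Prime ∧ (ℓ : 𝓞 F) ∈ p.asIdeal := by
    exact exists_prime_natCast_mem p
  have hℓ2 : ℓ ≠ 2 := by rintro rfl; exact h2p hℓp
  obtain ⟨c, hc, hc4, hcℓ, hns⟩ := exists_prime_neg_not_sq F hℓ hℓ2
  have hℓc : ¬ ℓ ∣ c := fun h => by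
    have h1 : ℓ ∣ ℓ - 1 := (hcℓ.dvd_iff dvd_rfl).1 h
    exact Nat.not_dvd_of_pos_of_lt (Nat.sub_pos_of_lt hℓ.one_lt) (Nat.sub_lt hℓ.pos one_pos) h1
  have hcp : (c : 𝓞 F) ∉ p.asIdeal := fun h => by
    have hcop : IsCoprime (ℓ : ℤ) c := Nat.isCoprime_iff_coprime.2 ((Nat.Prime.coprime_iff_not_dvd hℓ).2 hℓc)
    obtain ⟨x, y, hxy⟩ := hcop
    refine p.isPrime.ne_top ((Ideal.eq_top_iff_one _).2 ?_)
    have : (1 : 𝓞 F) = x * ℓ + y * c := by exact_mod_cast hxy.symm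
    rw [this]
    exact add_mem (p.asIdeal.mul_mem_left _ hℓp) (p.asIdeal.mul_mem_left _ h)
  have hnat (n : ℕ) (hn : (n : 𝓞 F) ∉ p.asIdeal) : ‖(n : k)‖ = 1 := by
    refine le_antisymm (IsUltrametricDist.norm_natCast_le_one k n) (not_lt.1 fun h1 => hn ?_)
    rw [← h.norm_algebraMap_lt_one_iff]
    simpa using h1
  have hck : ‖(c : k)‖ = 1 := hnat c hcp
  have hℓk : ‖(ℓ : k)‖ < 1 := by
    have := (h.norm_algebraMap_lt_one_iff _).2 hℓp
    simpa using this
  obtain ⟨κ, hκ, hκ1⟩ := exists_sq_eq_neg_natCast hℓ hℓ2 hcℓ hℓk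
  have hκn : ‖κ‖ = 1 := by
    have : ‖κ‖ ^ 2 = 1 := by rw [← norm_pow, hκ, norm_neg, hck]
    nlinarith [norm_nonneg κ]
  have hκ0 : κ ≠ 0 := norm_pos_iff.1 (by rw [hκn]; exact one_pos)
  have : Fact c.Prime := ⟨hc⟩
  obtain ⟨m, n, hmn⟩ := Nat.Prime.sq_add_sq (p := c) (by omega)
  have hmn' : (m : F) ^ 2 + n ^ 2 = c := by exact_mod_cast hmn
  have hmnk : (m : k) ^ 2 + n ^ 2 = c := by exact_mod_cast hmn
  obtain ⟨a, b, hab1, hab2, hab3⟩ := exists_pell_at_prime hns hc.pos ι (p := p.asIdeal)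
    (fun x => (h.norm_algebraMap_lt_one_iff x).symm) hℓ hℓ2 hℓp hℓc hκ hκ1
  have hN0 : (a : F) ^ 2 + c * (b : F) ^ 2 ≠ 0 := fun h0 => by
    rcases eq_or_ne (b : F) 0 with hb | hb
    · have ha : (a : F) = 0 := by
        rw [hb] at h0
        simpa using h0
      rw [ha, hb] at hab2
      simp at hab2
    · exact hns ⟨a / b, by field_simp; linear_combination h0⟩
  set z : Fin 4 → F := ![0, 0, 0, 1] with hz
  set s : Fin 4 → F := ![m, 0, n, 0] with hs
  set t : Fin 4 → F := ![-n, 0, m, 0] with ht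
  set R := integersAway p with hR
  have hint (x : 𝓞 F) : (x : F) ∈ R := algebraMap_mem_integersAway p x
  obtain ⟨ν, hν, hmem⟩ := exists_eichler_mem_congruenceClosure (R := R) (ι := ι) (c := c) (ℓ := ℓ)
    (z := z) (s := s) (t := t)
    (by intro i; fin_cases i <;> simp [hz, R.zero_mem, R.one_mem])
    (by intro i; fin_cases i <;> simp [hs, R.zero_mem, natCast_mem])
    (by intro i; fin_cases i <;> simp [ht, R.zero_mem, natCast_mem])
    (by simp [hz, quatPolar_apply])
    (by simp [hs, quatPolar_apply]; linear_combination 2 * hmn')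
    (by simp [ht, quatPolar_apply]; linear_combination 2 * hmn')
    (by simp [hz, hs, quatPolar_apply]) (by simp [hz, ht, quatPolar_apply])
    (by simp [hs, ht, quatPolar_apply]; ring) hκ hκ0 (hint a) (hint b) hN0
    (by
      have := inv_mem_integersAway (p := p) (x := a ^ 2 + c * b ^ 2) hab3
      simpa using this) hab1 hab2
    (fun M hM => by
      obtain ⟨A, b', hb', hA⟩ := exists_pell hns hc.pos hw₁ hM
      refine ⟨A, hint A, b', hint b', by simpa using hb', h.norm_algebraMap_le_one b', ?_⟩
      exact_mod_cast congrArg (algebraMap (𝓞 F) F) hA) hℓ.pos hℓk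
  set zk : Fin 4 → k := ![0, 0, 0, 1] with hzk
  set sk : Fin 4 → k := ![m, 0, n, 0] with hsk
  set tk : Fin 4 → k := ![-n, 0, m, 0] with htk
  set xk : Fin 4 → k := ![-1, 2, 0, 0] with hxk
  have hzk' : (fun i => ι (z i)) = zk := by ext i; fin_cases i <;> simp [hz, hzk]
  have hsk' : (fun i => ι (s i)) = sk := by ext i; fin_cases i <;> simp [hs, hsk]
  have htk' : (fun i => ι (t i)) = tk := by ext i; fin_cases i <;> simp [ht, htk]
  rw [hzk', hsk', htk'] at hmem
  have hc0 : (c : k) ≠ 0 := Nat.cast_ne_zero.2 hc.ne_zero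
  set e : Fin 4 → k := sk + κ • zk with he
  set f : Fin 4 → k := (4 * (c : k))⁻¹ • (sk - κ • zk) with hf
  have hef : (quatPolar k).IsHyperbolicPair e f := by
    refine ⟨?_, ?_, ?_⟩
    · simp [he, hsk, hzk, quatPolar_apply]
      linear_combination 2 * hmnk + 2 * hκ
    · simp [hf, hsk, hzk, quatPolar_apply]
      linear_combination (2 * (4 * (c : k))⁻¹ ^ 2) * hmnk + (2 * (4 * (c : k))⁻¹ ^ 2) * hκ
    · simp [he, hf, hsk, hzk, quatPolar_apply]
      field_simp
      linear_combination 2 * hmnk - 2 * hκ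
  have hte : quatPolar k tk e = 0 := by
    simp [he, hsk, hzk, htk, quatPolar_apply]
    ring
  have htf : quatPolar k tk f = 0 := by
    simp [hf, hsk, hzk, htk, quatPolar_apply]
    ring
  have hxe : quatPolar k xk e = 0 := by
    simp [he, hsk, hzk, hxk, quatPolar_apply]
  have hxf : quatPolar k xk f = 0 := by
    simp [hf, hsk, hzk, hxk, quatPolar_apply]
  have htt : quatPolar k tk tk = 2 * c := by
    simp [htk, quatPolar_apply]
    linear_combination 2 * hmnk
  have hN := fun g hg T hT => reflection_conj_mem_congruenceClosure
    (exists_natCast_mul_mem_integersAway p) h.dense (g := g) hg (T := T) hT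
  have hNe : ∀ w, quatPolar k w e = 0 → quatPolar k w f = 0 →
      (quatPolar k).eichler e w ∈ congruenceClosure R ι := fun w hwe hwf =>
    eichler_mem hsymm hN hef (s := ν • tk) (by simp [hte]) (by simp [htf])
      (by simp [htt, hν, hc0]) hmem hwe hwf
  have hNf : ∀ w, quatPolar k w e = 0 → quatPolar k w f = 0 →
      (quatPolar k).eichler f w ∈ congruenceClosure R ι := fun w hwe hwf => by
    have := eichler_swap_mem hsymm hN hef hwe hwf one_ne_zero (hNe w hwe hwf)
    rwa [one_smul] at this
  obtain ⟨ϖ, hϖ1, hϖ0, hϖ⟩ := h.exists_uniformizer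
  obtain ⟨T, hT, a', b', ha', hb', hTv⟩ := exists_map_eq_integral hsymm hef hNe hNf hte htf
    (by rw [htt, mul_div_cancel_left₀ _ two_ne_zero, hck]) hϖ1 hϖ0 hϖ
    (fun α hα => by
      obtain ⟨r, t, hrt⟩ := h.exists_norm_one_sub_eq_uniformizer hϖ1 hϖ0 hϖ h2p hcp h3p hα
      refine ⟨r • tk + t • xk, by simp [hte, hxe], by simp [htf, hxf], ?_⟩
      rw [← hrt]
      congr 3
      simp [htk, hxk, quatPolar_apply]
      linear_combination r ^ 2 * hmnk)
    hv0 hv (quatPolar_self v)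
  refine ⟨T, hT, fun i => ?_⟩
  have h4 : ‖(4 * (c : k))⁻¹‖ = 1 := by
    have h4' : ‖(4 : k)‖ = 1 := by
      have := hnat 2 (by exact_mod_cast h2p)
      rw [show (4 : k) = (2 : ℕ) * (2 : ℕ) by norm_num, norm_mul, this, one_mul]
    rw [norm_inv, norm_mul, h4', hck, one_mul, inv_one]
  have hnk (n : ℕ) : ‖(n : k)‖ ≤ 1 := IsUltrametricDist.norm_natCast_le_one k n
  have he1 : ‖e i‖ ≤ 1 := by
    fin_cases i <;> simp [he, hsk, hzk, hnk, hκn]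
  have hf1 : ‖f i‖ ≤ 1 := by
    have : ‖f i‖ = ‖(sk - κ • zk) i‖ := by
      rw [hf, Pi.smul_apply, smul_eq_mul, norm_mul, h4, one_mul]
    rw [this]
    fin_cases i <;> simp [hsk, hzk, hnk, hκn]
  rw [hTv, Pi.add_apply, Pi.smul_apply, Pi.smul_apply, smul_eq_mul, smul_eq_mul]
  refine (IsUltrametricDist.norm_add_le_max _ _).trans (max_le ?_ ?_) <;> rw [norm_mul]
  · exact mul_le_one₀ ha' (norm_nonneg _) he1
  · exact mul_le_one₀ hb' (norm_nonneg _) hf1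

/-- A solution of `quat x = α` can be made integral at a prime `p ∤ 6` without destroying
integrality at the other primes. -/
theorem exists_quat_integral_at {w₁ : InfinitePlace F} (hw₁ : w₁.IsComplex)
    {p : HeightOneSpectrum (𝓞 F)} (h6 : (6 : 𝓞 F) ∉ p.asIdeal) {α : 𝓞 F} (hα : α ≠ 0)
    {x : Fin 4 → F} (hx : quat x = α) :
    ∃ y : Fin 4 → F, quat y = α ∧ (∀ i, p.valuation F (y i) ≤ 1) ∧
      ∀ r : HeightOneSpectrum (𝓞 F), r ≠ p → (∀ i, r.valuation F (x i) ≤ 1) →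
        ∀ i, r.valuation F (y i) ≤ 1 := by
  have := properSpace_adicCompletion p
  have h := isCompletionAt_embedding p
  set ι := FinitePlace.embedding (K := F) p
  have hq : quat (fun i => ι (x i)) = ι α := by rw [quat_map, hx]
  obtain ⟨T, hT, hTx⟩ := exists_mem_congruenceClosure_apply_le_one h h6 hw₁
    (v := fun i => ι (x i)) (by rw [hq]; simpa using hα)
    (by rw [hq]; exact h.norm_algebraMap_le_one α)
  obtain ⟨G, hG, hGx⟩ := exists_mem_congruenceIsometries_apply_le_one hT hTx
  refine ⟨G x, ?_, fun i => (h.norm_le_one_iff _).1 (hGx i), fun r hr hxr i => ?_⟩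
  · have h1 := hG.1 x x
    rw [quatPolar_self, quatPolar_self, hx] at h1
    exact mul_left_cancel₀ two_ne_zero h1
  · have hsum : G x i = ∑ j, x j * G (Pi.single j 1) i := by
      conv_lhs => rw [pi_eq_sum_univ' x]
      simp [map_sum, map_smul]
    rw [hsum]
    refine Valuation.map_sum_le _ fun j _ => ?_
    obtain ⟨y, hy, hxy⟩ := hG.2 (Pi.single j 1) fun i => by
      rcases eq_or_ne i j with rfl | h
      · simp
      · simp [h]
    rw [_root_.map_mul]
    refine mul_le_one' (hxr j) ?_
    refine mem_integersAway.1 ?_ r hr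
    rw [hxy]
    refine Subring.add_mem _ ?_ (Subring.mul_mem _ (natCast_mem _ 1) (hy i))
    rcases eq_or_ne i j with rfl | h
    · simp
    · simp [h]

end StrongApproximation

section NumberFieldCase
open IsDedekindDomain NumberField

universe u
variable {F : Type u} [Field F] [NumberField F]

theorem exists_quat_integral_of_finset {w₁ : InfinitePlace F} (hw₁ : w₁.IsComplex) {α : 𝓞 F}
    (hα : α ≠ 0) (S : Finset (HeightOneSpectrum (𝓞 F))) :
    (∀ v ∈ S, (6 : 𝓞 F) ∉ v.asIdeal) → ∀ x : Fin 4 → F, quat x = α →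
      (∀ v ∉ S, ∀ i, v.valuation F (x i) ≤ 1) →
      ∃ y : Fin 4 → F, quat y = α ∧ ∀ v : HeightOneSpectrum (𝓞 F), ∀ i, v.valuation F (y i) ≤ 1 := by
  classical
  induction S using Finset.induction_on with
  | empty => exact fun _ x hx hS => ⟨x, hx, fun v => hS v (Finset.notMem_empty v)⟩
  | insert p S _ ih =>
    intro h6 x hx hS
    obtain ⟨y, hy, hyp, hyr⟩ :=
      exists_quat_integral_at hw₁ (h6 p (Finset.mem_insert_self p S)) hα hx
    refine ih (fun v hv => h6 v (Finset.mem_insert_of_mem hv)) y hy fun v hv => ?_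
    rcases eq_or_ne v p with rfl | h
    · exact hyp
    · exact hyr v h (hS v (by simp [h, hv]))

theorem exists_quat_eq_of_isComplex {w₁ : InfinitePlace F} (hw₁ : w₁.IsComplex) {α : 𝓞 F}
    (hα : ∀ σ : F →+* ℝ, 0 ≤ σ α) : ∃ x : Fin 4 → 𝓞 F, quat x = α := by
  rcases eq_or_ne α 0 with rfl | hα0
  · exact ⟨0, by simp [quat]⟩
  have hαF : (α : F) ≠ 0 := by simpa using hα0
  have hpos (σ : F →+* ℝ) : 0 < σ α :=
    lt_of_le_of_ne (hα σ) (by rw [ne_comm, _root_.map_ne_zero]; exact hαF)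
  obtain ⟨z, a, b, hab, hz⟩ := exists_sub_sq_coprime_three hw₁ hpos
  obtain ⟨x, y, t, hxyt⟩ := exists_ternary_of_pos hab hz
  obtain ⟨u, hu, hu6⟩ := exists_quat_eq_integral_at_six hα0 (x := ![x - t, 2 * t, y, z]) (by
    have h : ((α - z ^ 2 : 𝓞 F) : F) = α - (z : F) ^ 2 := by simp
    rw [h] at hxyt
    simp only [quat, Matrix.cons_val]
    linear_combination hxyt)
  have hfin : {v : HeightOneSpectrum (𝓞 F) | ∃ i, 1 < v.valuation F (u i)}.Finite := by
    simp only [Set.ofPred_exists]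
    exact Set.finite_iUnion fun i => HeightOneSpectrum.Support.finite (𝓞 F) (u i)
  obtain ⟨y, hy, hyint⟩ := exists_quat_integral_of_finset hw₁ hα0 hfin.toFinset
    (fun v hv h6 => by
      obtain ⟨i, hi⟩ := hfin.mem_toFinset.1 hv
      exact (hu6 v h6 i).not_gt hi) u hu
    (fun v hv i => not_lt.1 fun hi => hv (hfin.mem_toFinset.2 ⟨i, hi⟩))
  choose y' hy' using fun i => HeightOneSpectrum.mem_integers_of_valuation_le_one F (y i)
    fun v => hyint v i
  refine ⟨y', FaithfulSMul.algebraMap_injective (𝓞 F) F ?_⟩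
  rw [← quat_map]
  simp only [hy']
  exact hy

end NumberFieldCase

section Compactness
open Filter Topology IntermediateField

/-- An algebraic number which is negative under some real embedding of every large enough finitely
generated subfield is negative under a real embedding of the whole field. -/
theorem exists_realEmbedding_neg {K : Type*} [Field K] [CharZero K] [Algebra.IsAlgebraic ℚ K]
    {T : Finset K} {α : K}
    (h : ∀ S : Finset K, T ⊆ S → ∃ σ : adjoin ℚ (S : Set K) →+* ℝ,
      ∃ hS : α ∈ adjoin ℚ (S : Set K), σ ⟨α, hS⟩ < 0) :
    ∃ σ : K →+* ℝ, σ α < 0 := by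
  classical
  choose σ hσS hσ using fun S : Finset K => h (T ∪ S) Finset.subset_union_left
  let f (S : Finset K) (y : K) : ℝ :=
    if hy : y ∈ adjoin ℚ ((T ∪ S : Finset K) : Set K) then σ S ⟨y, hy⟩ else 0
  have hmem (y : K) : ∀ᶠ S : Finset K in atTop, y ∈ adjoin ℚ ((T ∪ S : Finset K) : Set K) := by
    filter_upwards [eventually_ge_atTop {y}] with S hS
    exact subset_adjoin _ _ (by simp [Finset.singleton_subset_iff.1 hS])
  have hf (y : K) : ∀ᶠ S : Finset K in atTop,
      ∃ hy : y ∈ adjoin ℚ ((T ∪ S : Finset K) : Set K), f S y = σ S ⟨y, hy⟩ := by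
    filter_upwards [hmem y] with S hS
    exact ⟨hS, dif_pos hS⟩
  have hcomp : IsCompact (Set.univ.pi fun y : K => insert 0 ((minpoly ℚ y).rootSet ℝ)) :=
    isCompact_univ_pi fun y => ((Polynomial.rootSet_finite _ _).insert 0).isCompact
  have hfmem (S : Finset K) : f S ∈ Set.univ.pi fun y : K => insert 0 ((minpoly ℚ y).rootSet ℝ) := by
    intro y _
    by_cases hy : y ∈ adjoin ℚ ((T ∪ S : Finset K) : Set K)
    · refine Or.inr ?_
      rw [Polynomial.mem_rootSet]
      refine ⟨minpoly.ne_zero (Algebra.IsIntegral.isIntegral y), ?_⟩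
      have h1 : aeval (⟨y, hy⟩ : adjoin ℚ ((T ∪ S : Finset K) : Set K)) (minpoly ℚ y) = 0 := by
        apply Subtype.ext
        exact (IntermediateField.aeval_coe _ ⟨y, hy⟩ (minpoly ℚ y)).symm.trans (minpoly.aeval ℚ y)
      have h2 := congrArg (σ S).toRatAlgHom h1
      rw [← Polynomial.aeval_algHom_apply, map_zero] at h2
      rw [show f S y = (σ S).toRatAlgHom ⟨y, hy⟩ from dif_pos hy]
      exact h2
    · exact Or.inl (dif_neg hy)
  set U : Ultrafilter (Finset K) := Ultrafilter.of atTop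
  have hU : (U : Filter (Finset K)) ≤ atTop := Ultrafilter.of_le atTop
  obtain ⟨g, -, hg⟩ := hcomp.ultrafilter_le_nhds (U.map f) (by
    rw [le_principal_iff]
    exact Filter.mem_map.2 (Filter.univ_mem' hfmem))
  have hlim (y : K) : Tendsto (fun S => f S y) U (𝓝 (g y)) := tendsto_pi_nhds.1 hg y
  let τ : K →+* ℝ :=
    { toFun := g
      map_one' := tendsto_nhds_unique_of_eventuallyEq (hlim 1) tendsto_const_nhds (hU (by
        filter_upwards [hf 1] with S h1
        obtain ⟨h1, e1⟩ := h1
        rw [e1]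
        exact map_one (σ S)))
      map_zero' := tendsto_nhds_unique_of_eventuallyEq (hlim 0) tendsto_const_nhds (hU (by
        filter_upwards [hf 0] with S h1
        obtain ⟨h1, e1⟩ := h1
        rw [e1]
        exact map_zero (σ S)))
      map_mul' := fun x y => tendsto_nhds_unique_of_eventuallyEq (hlim (x * y))
        ((hlim x).mul (hlim y)) (hU (by
          filter_upwards [hf x, hf y, hf (x * y)] with S h1 h2 h3
          obtain ⟨h1, e1⟩ := h1
          obtain ⟨h2, e2⟩ := h2
          obtain ⟨h3, e3⟩ := h3
          rw [e1, e2, e3]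
          exact _root_.map_mul (σ S) ⟨x, h1⟩ ⟨y, h2⟩))
      map_add' := fun x y => tendsto_nhds_unique_of_eventuallyEq (hlim (x + y))
        ((hlim x).add (hlim y)) (hU (by
          filter_upwards [hf x, hf y, hf (x + y)] with S h1 h2 h3
          obtain ⟨h1, e1⟩ := h1
          obtain ⟨h2, e2⟩ := h2
          obtain ⟨h3, e3⟩ := h3
          rw [e1, e2, e3]
          exact _root_.map_add (σ S) ⟨x, h1⟩ ⟨y, h2⟩)) }
  refine ⟨τ, lt_of_le_of_ne ?_ ?_⟩
  · refine le_of_tendsto (hlim α) (Eventually.of_forall fun S => ?_)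
    rw [show f S α = σ S ⟨α, hσS S⟩ from dif_pos _]
    exact (hσ S).le
  · rw [_root_.map_ne_zero]
    rintro rfl
    have := hσ ∅
    rw [show (⟨0, hσS ∅⟩ : adjoin ℚ ((T ∪ ∅ : Finset K) : Set K)) = 0 from rfl, map_zero] at this
    exact lt_irrefl _ this

end Compactness

section Descent
open IntermediateField

theorem exists_quat_eq_of_nonneg {K : Type*} [Field K] [CharZero K] [Algebra.IsAlgebraic ℚ K]
    {x : K} {w : ℂ} (hw : aeval w (minpoly ℚ x) = 0) (hwim : w.im ≠ 0) {α : K}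
    (hα : IsIntegral ℤ α) (hpos : ∀ σ : K →+* ℝ, 0 ≤ σ α) :
    ∃ y : Fin 4 → K, (∀ i, IsIntegral ℤ (y i)) ∧ quat y = α := by
  classical
  obtain ⟨S, hS, h⟩ : ∃ S : Finset K, {α, x} ⊆ S ∧ ∀ σ : adjoin ℚ (S : Set K) →+* ℝ,
      ∀ hS : α ∈ adjoin ℚ (S : Set K), 0 ≤ σ ⟨α, hS⟩ := by
    by_contra! h
    obtain ⟨σ, hσ⟩ := exists_realEmbedding_neg h
    exact (hpos σ).not_gt hσ
  set F := adjoin ℚ (S : Set K)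
  have hαF : α ∈ F := subset_adjoin _ _ (hS (by simp))
  have hxF : x ∈ F := subset_adjoin _ _ (hS (by simp))
  have : FiniteDimensional ℚ F :=
    finiteDimensional_adjoin fun y _ => Algebra.IsIntegral.isIntegral y
  have : NumberField F := { to_charZero := inferInstance, to_finiteDimensional := ‹_› }
  have hmin : minpoly ℚ (⟨x, hxF⟩ : F) = minpoly ℚ x :=
    (minpoly.algebraMap_eq (algebraMap F K).injective (⟨x, hxF⟩ : F)).symm
  have hrange := NumberField.Embeddings.range_eval_eq_rootSet_minpoly F ℂ (⟨x, hxF⟩ : F)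
  have hwmem : w ∈ (minpoly ℚ (⟨x, hxF⟩ : F)).rootSet ℂ := by
    rw [mem_rootSet, hmin]
    exact ⟨minpoly.ne_zero (Algebra.IsIntegral.isIntegral x), hw⟩
  rw [← hrange] at hwmem
  obtain ⟨φ, hφ⟩ := hwmem
  have hw₁ : (NumberField.InfinitePlace.mk φ).IsComplex := by
    rw [NumberField.InfinitePlace.isComplex_mk_iff, NumberField.ComplexEmbedding.isReal_iff]
    intro hreal
    have h1 := RingHom.congr_fun hreal ⟨x, hxF⟩
    rw [NumberField.ComplexEmbedding.conjugate_coe_eq] at h1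
    simp only at hφ
    rw [hφ] at h1
    exact hwim (Complex.conj_eq_iff_im.1 h1)
  have hαint : IsIntegral ℤ (⟨α, hαF⟩ : F) :=
    (isIntegral_algHom_iff (algebraMap F K).toIntAlgHom (algebraMap F K).injective).1 hα
  obtain ⟨y, hy⟩ := exists_quat_eq_of_isComplex hw₁ (α := ⟨⟨α, hαF⟩, hαint⟩) fun σ => h σ hαF
  refine ⟨fun i => ((y i : F) : K), fun i =>
    (y i).isIntegral_coe.map (algebraMap F K).toIntAlgHom, ?_⟩
  have := congrArg (fun a : NumberField.RingOfIntegers F => algebraMap F K (algebraMap _ F a)) hy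
  simp only [← quat_map] at this
  exact this

end Descent

/-- Let `K ⊆ ℂ` be an algebraic extension of `ℚ` which is not totally real (some element of
`K` has a non-real conjugate over `ℚ`). Then every `α ∈ 𝓞_K` with `σ(α) ≥ 0` for all
embeddings `σ : K → ℝ` can be written as `α = w² + wx + x² + y² + z²` with
`w, x, y, z ∈ 𝓞_K`; moreover every value `w² + wx + x² + y² + z²` with `w, x, y, z ∈ 𝓞_K`
satisfies `σ(w² + wx + x² + y² + z²) ≥ 0` for all embeddings `σ : K → ℝ`. That is, the
quadratic form `W² + WX + X² + Y² + Z²` is universal over `K`. -/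
theorem stmt_19 (K : Subfield ℂ) (halg : ∀ x : ↥K, IsAlgebraic ℚ (x : ℂ))
    (hnotreal : ∃ x : ↥K, ∃ w : ℂ, aeval w (minpoly ℚ (x : ℂ)) = 0 ∧ w.im ≠ 0) :
    (∀ α : ↥K, IsIntegral ℤ α → (∀ σ : ↥K →+* ℝ, 0 ≤ σ α) →
      ∃ w x y z : ↥K, IsIntegral ℤ w ∧ IsIntegral ℤ x ∧ IsIntegral ℤ y ∧ IsIntegral ℤ z ∧
        α = w ^ 2 + w * x + x ^ 2 + y ^ 2 + z ^ 2) ∧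
    (∀ w x y z : ↥K, IsIntegral ℤ w → IsIntegral ℤ x → IsIntegral ℤ y → IsIntegral ℤ z →
      ∀ σ : ↥K →+* ℝ, 0 ≤ σ (w ^ 2 + w * x + x ^ 2 + y ^ 2 + z ^ 2)) := by
  refine ⟨fun α hα hpos => ?_, fun w x y z _ _ _ _ σ => ?_⟩
  · have : Algebra.IsAlgebraic ℚ K :=
      ⟨fun x => (isAlgebraic_algHom_iff K.subtype.toRatAlgHom K.subtype.injective).1 (halg x)⟩
    obtain ⟨x, w, hw, hwim⟩ := hnotreal
    have hmin : minpoly ℚ (x : ℂ) = minpoly ℚ x :=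
      minpoly.algHom_eq K.subtype.toRatAlgHom K.subtype.injective x
    rw [hmin] at hw
    obtain ⟨y, hy, hyα⟩ := exists_quat_eq_of_nonneg hw hwim hα hpos
    exact ⟨y 0, y 1, y 2, y 3, hy 0, hy 1, hy 2, hy 3, hyα.symm⟩
  · simp only [map_add, map_mul, map_pow]
    nlinarith [sq_nonneg (σ w + σ x), sq_nonneg (σ w), sq_nonneg (σ x), sq_nonneg (σ y),
      sq_nonneg (σ z)]

end
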